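/- Let L be a Lie algebra of compact operators on a complex Banach space X (a linear subspace of B(X), closed under the commutator [A,B] = AB − BA, all of whose elements are compact), and let T be a nonzero element of L. If every element of L has T-stable spectrum, then L is reducible: there exists a closed subspace M of X with M ≠ {0} and M ≠ X such that A(M) ⊆ M for every A ∈ L. -/

import Mathlib

open Filter Topology Metric Set
open scoped Pointwise

section SpectralBound

variable {𝔸 : Type*} [NormedRing 𝔸] [NormedAlgebra ℂ 𝔸]

/-- All points of the spectrum of `a` have modulus at most `c`. -/
def SpecLE (a : 𝔸) (c : ℝ) : Prop := ∀ μ ∈ spectrum ℂ a, ‖μ‖ ≤ c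

theorem SpecLE.mono {a : 𝔸} {c d : ℝ} (h : SpecLE a c) (hcd : c ≤ d) : SpecLE a d :=
  fun μ hμ => (h μ hμ).trans hcd

theorem SpecLE.of_forall_gt {a : 𝔸} {c : ℝ} (h : ∀ d > c, SpecLE a d) : SpecLE a c :=
  fun μ hμ => le_of_forall_gt_imp_ge_of_dense fun d hd => h d hd μ hμ

theorem specLE_zero (c : ℝ) (hc : 0 ≤ c) : SpecLE (0 : 𝔸) c := by
  intro μ hμ
  rcases subsingleton_or_nontrivial 𝔸
  · simp [spectrum.of_subsingleton] at hμ
  · rw [spectrum.zero_eq] at hμ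
    simp_all

theorem SpecLE.smul {a : 𝔸} {c : ℝ} (h : SpecLE a c) (z : ℂ) :
    SpecLE (z • a) (‖z‖ * c) := by
  rcases eq_or_ne z 0 with rfl | hz
  · simpa using specLE_zero (𝔸 := 𝔸) 0 le_rfl
  intro μ hμ
  have := spectrum.unit_smul_eq_smul a (Units.mk0 z hz)
  rw [show (Units.mk0 z hz) • a = z • a from rfl] at this
  rw [this] at hμ
  obtain ⟨ν, hν, rfl⟩ := hμ
  change ‖z • ν‖ ≤ _
  rw [norm_smul]
  exact mul_le_mul_of_nonneg_left (h ν hν) (norm_nonneg z)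

theorem SpecLE.isUnit_sub {a : 𝔸} {c : ℝ} (h : SpecLE a c) {μ : ℂ} (hμ : c < ‖μ‖) :
    IsUnit (algebraMap ℂ 𝔸 μ - a) := by
  by_contra hn
  exact absurd (h μ (spectrum.mem_iff.2 hn)) (not_le.2 hμ)

variable [CompleteSpace 𝔸]

theorem specLE_of_norm_pow_le {a : 𝔸} {C t : ℝ} (ht : 0 ≤ t) (h : ∀ n : ℕ, ‖a ^ n‖ ≤ C * t ^ n) :
    SpecLE a t := by
  intro μ hμ
  by_contra hlt
  push Not at hlt
  have hμ0 : 0 < ‖μ‖ := ht.trans_lt hlt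
  have key : ∀ n : ℕ, 1 ≤ (C * ‖(1 : 𝔸)‖) * (t / ‖μ‖) ^ n := fun n => by
    have h1 := spectrum.norm_le_norm_mul_of_mem (spectrum.pow_mem_pow a n hμ)
    rw [norm_pow] at h1
    have h2 : ‖μ‖ ^ n ≤ C * t ^ n * ‖(1 : 𝔸)‖ :=
      h1.trans (mul_le_mul_of_nonneg_right (h n) (norm_nonneg _))
    rw [div_pow, ← mul_div_assoc, le_div_iff₀ (by positivity)]
    linarith
  have hlim : Tendsto (fun n : ℕ => (C * ‖(1 : 𝔸)‖) * (t / ‖μ‖) ^ n) atTop (𝓝 ((C * ‖(1 : 𝔸)‖) * 0)) :=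
    (tendsto_pow_atTop_nhds_zero_of_lt_one (by positivity)
      ((div_lt_one hμ0).2 hlt)).const_mul _
  have := ge_of_tendsto' hlim key
  norm_num at this

theorem specLE_of_norm_pow_le_pow {a : 𝔸} {t : ℝ} (ht : 0 ≤ t) {n : ℕ} (hn : n ≠ 0)
    (h : ‖a ^ n‖ ≤ t ^ n) : SpecLE a t := by
  intro μ hμ
  have h1 : SpecLE (a ^ n) (t ^ n) := by
    refine specLE_of_norm_pow_le (C := max 1 ‖(1 : 𝔸)‖) (pow_nonneg ht n) fun k => ?_
    rcases Nat.eq_zero_or_pos k with rfl | hk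
    · simp
    · calc ‖(a ^ n) ^ k‖ ≤ ‖a ^ n‖ ^ k := norm_pow_le' _ hk
        _ ≤ (t ^ n) ^ k := pow_le_pow_left₀ (norm_nonneg _) h k
        _ ≤ max 1 ‖(1 : 𝔸)‖ * (t ^ n) ^ k :=
          le_mul_of_one_le_left (by positivity) (le_max_left _ _)
  have h2 := h1 _ (spectrum.pow_mem_pow a n hμ)
  rw [norm_pow] at h2
  exact le_of_pow_le_pow_left₀ hn ht h2

theorem SpecLE.eventually_norm_pow_lt {a : 𝔸} {c t : ℝ} (h : SpecLE a c) (hc : 0 ≤ c)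
    (hct : c < t) : ∀ᶠ n : ℕ in atTop, ‖a ^ n‖ < t ^ n := by
  have hr : spectralRadius ℂ a < ENNReal.ofReal t := by
    refine lt_of_le_of_lt ?_ ((ENNReal.ofReal_lt_ofReal_iff (hc.trans_lt hct)).2 hct)
    refine iSup₂_le fun μ hμ => ?_
    rw [← enorm_eq_nnnorm, ← ofReal_norm]
    exact ENNReal.ofReal_le_ofReal (h μ hμ)
  have := (spectrum.pow_norm_pow_one_div_tendsto_nhds_spectralRadius a).eventually_lt_const hr
  filter_upwards [this, eventually_gt_atTop 0] with n hn hn0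
  rw [ENNReal.ofReal_lt_ofReal_iff (hc.trans_lt hct)] at hn
  have h3 := pow_lt_pow_left₀ hn (by positivity) hn0.ne'
  rwa [← Real.rpow_natCast (_ ^ _), ← Real.rpow_mul (norm_nonneg _), one_div,
    inv_mul_cancel₀ (by exact_mod_cast hn0.ne'), Real.rpow_one] at h3

theorem SpecLE.exists_norm_pow_le {a : 𝔸} {c t : ℝ} (h : SpecLE a c) (hc : 0 ≤ c)
    (hct : c < t) : ∃ C, 0 < C ∧ ∀ n : ℕ, ‖a ^ n‖ ≤ C * t ^ n := by
  have ht : 0 < t := hc.trans_lt hct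
  obtain ⟨N, hN⟩ := eventually_atTop.1 (h.eventually_norm_pow_lt hc hct)
  refine ⟨1 + ∑ k ∈ Finset.range N, ‖a ^ k‖ / t ^ k, by positivity, fun n => ?_⟩
  rw [← div_le_iff₀ (by positivity)]
  rcases lt_or_ge n N with hn | hn
  · have := Finset.single_le_sum (f := fun k => ‖a ^ k‖ / t ^ k) (fun k _ => by positivity)
      (Finset.mem_range.2 hn)
    linarith
  · have h1 : ‖a ^ n‖ / t ^ n ≤ 1 := (div_le_one (by positivity)).2 (hN n hn).le
    have : 0 ≤ ∑ k ∈ Finset.range N, ‖a ^ k‖ / t ^ k := Finset.sum_nonneg fun k _ => by positivity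
    linarith

/-- Upper semicontinuity of the spectral radius. -/
theorem SpecLE.eventually_of_tendsto {a : 𝔸} {c d : ℝ} (h : SpecLE a c) (hc : 0 ≤ c) (hcd : c < d)
    {w : ℕ → 𝔸} (hw : Tendsto w atTop (𝓝 a)) : ∀ᶠ k in atTop, SpecLE (w k) d := by
  obtain ⟨n, hn, hn0⟩ := ((h.eventually_norm_pow_lt hc hcd).and (eventually_gt_atTop 0)).exists
  filter_upwards [((hw.pow n).norm).eventually_lt_const hn] with k hk
  exact specLE_of_norm_pow_le_pow (hc.trans hcd.le) hn0.ne' hk.le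

/-- A maximum principle for the spectral radius. -/
theorem specLE_of_frontier {U : Set ℂ} (hU : Bornology.IsBounded U) {f : ℂ → 𝔸}
    (hf : DiffContOnCl ℂ f U) {c : ℝ} (hc : 0 ≤ c) (h : ∀ ζ ∈ frontier U, SpecLE (f ζ) c)
    {z : ℂ} (hz : z ∈ U) : SpecLE (f z) c := by
  refine SpecLE.of_forall_gt fun t hct => ?_
  have ht : 0 < t := hc.trans_lt hct
  have hcont : ContinuousOn f (frontier U) := hf.continuousOn.mono frontier_subset_closure
  have hcomp : IsCompact (frontier U) :=
    Metric.isCompact_of_isClosed_isBounded isClosed_frontier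
      (hU.closure.subset frontier_subset_closure)
  have mono : ∀ (b : 𝔸) {j k : ℕ}, j ≤ k → ‖b ^ 2 ^ j‖ < t ^ 2 ^ j → ‖b ^ 2 ^ k‖ < t ^ 2 ^ k := by
    intro b j k hjk hj
    induction k, hjk using Nat.le_induction with
    | base => exact hj
    | succ k _ ih =>
      rw [pow_succ 2, pow_mul, pow_mul]
      exact (norm_pow_le' _ two_pos).trans_lt (pow_lt_pow_left₀ ih (norm_nonneg _) two_ne_zero)
  obtain ⟨k, hk⟩ : ∃ k : ℕ, ∀ ζ ∈ frontier U, ‖f ζ ^ 2 ^ k‖ < t ^ 2 ^ k := by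
    have hloc : ∀ ζ ∈ frontier U, ∃ k : ℕ, ∀ᶠ ξ in 𝓝[frontier U] ζ, ‖f ξ ^ 2 ^ k‖ < t ^ 2 ^ k := by
      intro ζ hζ
      have h1 := (h ζ hζ).eventually_norm_pow_lt hc hct
      have h2 : Tendsto (fun k : ℕ => 2 ^ k) atTop atTop :=
        tendsto_pow_atTop_atTop_of_one_lt one_lt_two
      obtain ⟨k, hk⟩ := (h2.eventually h1).exists
      exact ⟨k, (((hcont ζ hζ).pow _).norm).eventually_lt_const hk⟩
    choose! kk hkk using hloc
    obtain ⟨s, hs, hs'⟩ := hcomp.elim_nhdsWithin_subcover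
      (fun ζ => {ξ | ‖f ξ ^ 2 ^ kk ζ‖ < t ^ 2 ^ kk ζ}) hkk
    refine ⟨s.sup kk, fun ζ hζ => ?_⟩
    obtain ⟨ξ, hξ, hζξ⟩ := mem_iUnion₂.1 (hs' hζ)
    exact mono _ (Finset.le_sup hξ) hζξ
  refine specLE_of_norm_pow_le_pow ht.le (n := 2 ^ k) (by positivity) ?_
  have hdiff : DiffContOnCl ℂ (fun z => f z ^ 2 ^ k) U :=
    ⟨hf.differentiableOn.pow _, hf.continuousOn.pow _⟩
  exact Complex.norm_le_of_forall_mem_frontier_norm_le hU hdiff (fun ζ hζ => (hk ζ hζ).le)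
    (subset_closure hz)

theorem exists_radius_avoiding {S : Set ℂ} (hS : S.Countable) (z : ℂ) {a b : ℝ} (hab : a < b) :
    ∃ r, a < r ∧ r < b ∧ ∀ ζ ∈ S, ‖ζ - z‖ ≠ r := by
  have h1 : ((fun ζ => ‖ζ - z‖) '' S).Countable := hS.image _
  have h2 : ¬ (Ioo a b).Countable := by
    intro h
    have := h.measure_zero MeasureTheory.volume
    rw [Real.volume_Ioo] at this
    exact absurd (ENNReal.ofReal_eq_zero.1 this) (by linarith)
  obtain ⟨r, hr, hr'⟩ := not_subset.1 fun hsub => h2 (h1.mono hsub)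
  exact ⟨r, hr.1, hr.2, fun ζ hζ he => hr' ⟨ζ, hζ, he⟩⟩

/-- Lower semicontinuity of the spectral radius at elements with countable spectrum. -/
theorem specLE_of_tendsto {a : 𝔸} (ha : (spectrum ℂ a).Countable) {c : ℝ}
    {ι : Type*} {l : Filter ι} [l.NeBot] {w : ι → 𝔸}
    (hw : Tendsto w l (𝓝 a)) (h : ∀ᶠ k in l, SpecLE (w k) c) : SpecLE a c := by
  intro μ hμ
  by_contra hlt
  push Not at hlt
  obtain ⟨r, hr0, hr1, hr⟩ := exists_radius_avoiding ha μ (sub_pos.2 hlt)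
  have hres : ∀ z ∈ sphere μ r, z ∈ resolventSet ℂ a := by
    intro z hz
    by_contra hn
    exact hr z hn (by simpa [dist_eq_norm] using hz)
  obtain ⟨K, hK⟩ : ∃ K, ∀ z ∈ sphere μ r, ‖resolvent a z‖ ≤ K := by
    refine (isCompact_sphere μ r).exists_bound_of_continuousOn fun z hz => ?_
    exact (spectrum.hasDerivAt_resolvent_const_left (hres z hz)).continuousAt.continuousWithinAt
  have hK1 : ∀ z ∈ sphere μ r, ‖resolvent a z‖ ≤ |K| + 1 := fun z hz =>
    (hK z hz).trans ((le_abs_self K).trans (by linarith))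
  set K' := |K| + 1 with hK'
  have hK'0 : 0 < K' := by positivity
  have hsmall : ∀ᶠ k in l, ‖w k - a‖ < 1 / (2 * K') := by
    have := (tendsto_iff_norm_sub_tendsto_zero.1 hw)
    exact this.eventually_lt_const (by positivity)
  obtain ⟨k, hk, hk2⟩ := (hsmall.and h).exists
  have hwres : ∀ z ∈ closedBall μ r, z ∈ resolventSet ℂ (w k) := by
    intro z hz
    by_contra hn
    have h1 := hk2 z hn
    have h2 : ‖μ‖ ≤ ‖z‖ + ‖z - μ‖ := by
      have := norm_sub_le z (z - μ)
      simpa using this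
    rw [mem_closedBall, dist_eq_norm] at hz
    linarith
  have hbound : ‖resolvent (w k) μ‖ ≤ 2 * K' := by
    have hd : DiffContOnCl ℂ (resolvent (w k)) (ball μ r) := by
      apply DifferentiableOn.diffContOnCl
      rw [closure_ball μ hr0.ne']
      exact fun z hz => (spectrum.hasDerivAt_resolvent_const_left
        (hwres z hz)).differentiableAt.differentiableWithinAt
    refine Complex.norm_le_of_forall_mem_frontier_norm_le isBounded_ball hd (fun z hz => ?_)
      (subset_closure (mem_ball_self hr0))
    rw [frontier_ball μ hr0.ne'] at hz
    have hid : resolvent (w k) z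
        = resolvent a z + resolvent a z * (w k - a) * resolvent (w k) z := by
      have e1 : resolvent a z * (algebraMap ℂ 𝔸 z - a) = 1 :=
        Ring.inverse_mul_cancel _ (hres z hz)
      have e2 : (algebraMap ℂ 𝔸 z - w k) * resolvent (w k) z = 1 :=
        Ring.mul_inverse_cancel _ (hwres z (sphere_subset_closedBall hz))
      calc resolvent (w k) z = (resolvent a z * (algebraMap ℂ 𝔸 z - a)) * resolvent (w k) z := by
            rw [e1, one_mul]
        _ = resolvent a z * ((algebraMap ℂ 𝔸 z - w k) * resolvent (w k) z)
            + resolvent a z * (w k - a) * resolvent (w k) z := by noncomm_ring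
        _ = _ := by rw [e2, mul_one]
    have h1 : ‖resolvent (w k) z‖ ≤ K' + K' * (1 / (2 * K')) * ‖resolvent (w k) z‖ := by
      conv_lhs => rw [hid]
      refine (norm_add_le _ _).trans (add_le_add (hK1 z hz) ?_)
      refine (norm_mul_le _ _).trans (mul_le_mul_of_nonneg_right ?_ (norm_nonneg _))
      exact (norm_mul_le _ _).trans (mul_le_mul (hK1 z hz) hk.le (norm_nonneg _) hK'0.le)
    have h2 : K' * (1 / (2 * K')) = 1 / 2 := by field_simp
    rw [h2] at h1
    linarith
  refine hμ ?_
  have hμw := hwres μ (mem_closedBall_self hr0.le)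
  have e2 : (algebraMap ℂ 𝔸 μ - w k) * resolvent (w k) μ = 1 :=
    Ring.mul_inverse_cancel _ hμw
  have hfac : algebraMap ℂ 𝔸 μ - a
      = (algebraMap ℂ 𝔸 μ - w k) * (1 - resolvent (w k) μ * (a - w k)) := by
    rw [mul_sub, ← mul_assoc, e2]
    noncomm_ring
  have hun : IsUnit (1 - resolvent (w k) μ * (a - w k)) := by
    apply isUnit_one_sub_of_norm_lt_one
    refine (norm_mul_le _ _).trans_lt ?_
    rw [norm_sub_rev a]
    calc ‖resolvent (w k) μ‖ * ‖w k - a‖ ≤ 2 * K' * ‖w k - a‖ :=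
          mul_le_mul_of_nonneg_right hbound (norm_nonneg _)
      _ < 2 * K' * (1 / (2 * K')) := mul_lt_mul_of_pos_left hk (by positivity)
      _ = 1 := by field_simp
  rw [spectrum.mem_resolventSet_iff, hfac]
  exact IsUnit.mul hμw hun

end SpectralBound

section CompactOperators

variable {X : Type*} [NormedAddCommGroup X] [NormedSpace ℂ X]

theorem finite_setOf_hasEigenvalue (K : X →L[ℂ] X) (hK : IsCompactOperator K) {ε : ℝ} (hε : 0 < ε) :
    {μ : ℂ | ε ≤ ‖μ‖ ∧ Module.End.HasEigenvalue (K : X →ₗ[ℂ] X) μ}.Finite := by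
  by_contra hinf
  obtain ⟨μ⟩ : Nonempty (ℕ ↪ {μ : ℂ | ε ≤ ‖μ‖ ∧ Module.End.HasEigenvalue (K : X →ₗ[ℂ] X) μ}) :=
    ⟨Set.Infinite.natEmbedding _ hinf⟩
  choose x hx using fun n => (μ n).2.2.exists_hasEigenvector
  have hKx : ∀ n, K (x n) = (μ n : ℂ) • x n := fun n => (hx n).apply_eq_smul
  have hli : LinearIndependent ℂ x := Module.End.eigenvectors_linearIndependent' _
    (fun n => (μ n : ℂ)) (Subtype.coe_injective.comp μ.injective) x hx
  set V : ℕ → Submodule ℂ X := fun n => Submodule.span ℂ (x '' Iio n) with hV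
  have hxV : ∀ k n, k < n → x k ∈ V n := fun k n hkn =>
    Submodule.subset_span (mem_image_of_mem x (mem_Iio.2 hkn))
  have hVmono : ∀ m n, m ≤ n → V m ≤ V n := fun m n hmn =>
    Submodule.span_mono (image_mono (Iio_subset_Iio hmn))
  have hy : ∀ n, ∃ y ∈ V (n + 1), ‖y‖ ≤ 3 ∧ ∀ z ∈ V n, 1 ≤ ‖y - z‖ := by
    intro n
    have hfin : FiniteDimensional ℂ (V n) :=
      FiniteDimensional.span_of_finite ℂ ((finite_Iio n).image x)
    have hcl : IsClosed (((V n).comap (V (n + 1)).subtype : Submodule ℂ (V (n + 1))) :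
        Set (V (n + 1))) := (Submodule.closed_of_finiteDimensional (V n)).preimage
          continuous_subtype_val
    obtain ⟨y, hy1, hy2⟩ := riesz_lemma_of_norm_lt (c := (2 : ℂ)) (R := 3) (by norm_num)
      (by norm_num) hcl ⟨⟨x n, hxV n (n + 1) n.lt_succ_self⟩, fun hmem => by
        have : x n ∈ V n := hmem
        exact hli.notMem_span_image (s := Iio n) (by simp) this⟩
    exact ⟨y, y.2, hy1, fun z hz => hy2 ⟨z, hVmono n (n + 1) n.le_succ hz⟩ hz⟩
  choose y hyV hyn hyd using hy
  have hKV : ∀ n, ∀ z ∈ V n, K z ∈ V n := by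
    intro n z hz
    have : V n ≤ (V n).comap (K : X →ₗ[ℂ] X) := by
      refine Submodule.span_le.2 ?_
      rintro _ ⟨k, hk, rfl⟩
      change K (x k) ∈ V n
      rw [hKx]
      exact (V n).smul_mem _ (hxV k n hk)
    exact this hz
  have hKsub : ∀ n, ∀ z ∈ V (n + 1), K z - (μ n : ℂ) • z ∈ V n := by
    intro n z hz
    have : V (n + 1) ≤ (V n).comap ((K : X →ₗ[ℂ] X) - (μ n : ℂ) • LinearMap.id) := by
      refine Submodule.span_le.2 ?_
      rintro _ ⟨k, hk, rfl⟩
      change K (x k) - (μ n : ℂ) • x k ∈ V n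
      rw [hKx, ← sub_smul]
      rcases (Nat.lt_succ_iff.1 hk).lt_or_eq with h | rfl
      · exact (V n).smul_mem _ (hxV k n h)
      · simp
    exact this hz
  have hsep : ∀ m n, m < n → ε ≤ ‖K (y n) - K (y m)‖ := by
    intro m n hmn
    have hμ : ε ≤ ‖(μ n : ℂ)‖ := (μ n).2.1
    have hμ0 : (μ n : ℂ) ≠ 0 := norm_pos_iff.1 (hε.trans_le hμ)
    set z := K (y m) - (K (y n) - (μ n : ℂ) • y n) with hz
    have hzV : z ∈ V n := (V n).sub_mem
      (hKV n _ (hVmono (m + 1) n hmn (hyV m))) (hKsub n _ (hyV n))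
    have e : K (y n) - K (y m) = (μ n : ℂ) • (y n - (μ n : ℂ)⁻¹ • z) := by
      rw [smul_sub, smul_inv_smul₀ hμ0, hz]
      abel
    rw [e, norm_smul]
    have := hyd n _ ((V n).smul_mem (μ n : ℂ)⁻¹ hzV)
    nlinarith [norm_nonneg (μ n : ℂ)]
  have hcomp : IsCompact (closure (K '' closedBall 0 3)) :=
    IsCompactOperator.isCompact_closure_image_closedBall (f := (K : X →ₗ[ℂ] X)) hK 3
  obtain ⟨l, -, φ, hφ, hl⟩ := hcomp.tendsto_subseq (x := fun n => K (y n)) fun n =>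
    subset_closure (mem_image_of_mem K (by simpa using hyn n))
  obtain ⟨N, hN⟩ := Metric.cauchySeq_iff'.1 hl.cauchySeq ε hε
  have h1 := hN (N + 1) (by omega)
  rw [dist_eq_norm] at h1
  exact absurd (hsep _ _ (hφ N.lt_succ_self)) (not_le.2 h1)

theorem isCompactOperator_mul_left {A : X →L[ℂ] X} (hA : IsCompactOperator A) (B : X →L[ℂ] X) :
    IsCompactOperator (B * A : X →L[ℂ] X) := hA.clm_comp B

theorem isCompactOperator_mul_right {A : X →L[ℂ] X} (hA : IsCompactOperator A) (B : X →L[ℂ] X) :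
    IsCompactOperator (A * B : X →L[ℂ] X) := hA.comp_clm B

variable [CompleteSpace X]

theorem countable_spectrum (K : X →L[ℂ] X) (hK : IsCompactOperator K) :
    (spectrum ℂ K).Countable := by
  have h : spectrum ℂ K ⊆ {0} ∪ ⋃ n : ℕ,
      {μ : ℂ | 1 / ((n : ℝ) + 1) ≤ ‖μ‖ ∧ Module.End.HasEigenvalue (K : X →ₗ[ℂ] X) μ} := by
    intro μ hμ
    rcases eq_or_ne μ 0 with rfl | h0
    · simp
    · right
      obtain ⟨n, hn⟩ := exists_nat_one_div_lt (norm_pos_iff.2 h0)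
      exact mem_iUnion.2 ⟨n, hn.le, (hK.hasEigenvalue_iff_mem_spectrum h0).2 hμ⟩
  refine Countable.mono h ((countable_singleton 0).union (countable_iUnion fun n => ?_))
  exact (finite_setOf_hasEigenvalue K hK (by positivity)).countable

/-- If `K` and `K'` are compact, then `u ↦ K u K'` maps bounded sets to relatively compact ones. -/
theorem exists_tendsto_mul_mul {ι : Type*} (𝓤 : Ultrafilter ι) {K K' : X →L[ℂ] X}
    (hK : IsCompactOperator K) (hK' : IsCompactOperator K') {C : ℝ} {u : ι → X →L[ℂ] X}
    (hu : ∀ᶠ i in (𝓤 : Filter ι), ‖u i‖ ≤ C) :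
    ∃ l, Tendsto (fun i => K * u i * K') 𝓤 (𝓝 l) := by
  have hC : 0 ≤ C := by
    obtain ⟨i, hi⟩ := hu.exists
    exact (norm_nonneg _).trans hi
  have hpt : ∀ y : X, ∃ l, Tendsto (fun i => K (u i y)) 𝓤 (𝓝 l) := by
    intro y
    have hcomp : IsCompact (closure (K '' closedBall 0 (C * ‖y‖))) :=
      IsCompactOperator.isCompact_closure_image_closedBall (f := (K : X →ₗ[ℂ] X)) hK _
    obtain ⟨l, -, hl⟩ := hcomp.ultrafilter_le_nhds (𝓤.map fun i => K (u i y)) (by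
      rw [le_principal_iff, Ultrafilter.coe_map, mem_map]
      filter_upwards [hu] with i hi
      refine subset_closure (mem_image_of_mem K ?_)
      rw [mem_closedBall_zero_iff]
      exact ((u i).le_opNorm y).trans (mul_le_mul_of_nonneg_right hi (norm_nonneg y)))
    exact ⟨l, hl⟩
  choose l hl using hpt
  refine cauchy_map_iff_exists_tendsto.1 ?_
  refine Metric.cauchy_iff.2 ⟨inferInstance, fun ε hε => ?_⟩
  set η := ε / (4 * (‖K‖ * C + 1)) with hη
  have hη0 : 0 < η := by positivity
  have htb : TotallyBounded (K' '' closedBall 0 1) :=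
    (IsCompactOperator.isCompact_closure_image_closedBall (f := (K' : X →ₗ[ℂ] X)) hK' 1).totallyBounded.subset
      subset_closure
  obtain ⟨t, ht, htc⟩ := Metric.totallyBounded_iff.1 htb η hη0
  have hev : ∀ᶠ i in (𝓤 : Filter ι), ∀ y ∈ t, ‖K (u i y) - l y‖ < ε / 16 := by
    refine (eventually_all_finite ht).2 fun y _ => ?_
    exact (tendsto_iff_norm_sub_tendsto_zero.1 (hl y)).eventually_lt_const (by positivity)
  refine ⟨_, image_mem_map (hev.and hu), ?_⟩
  rintro _ ⟨i, ⟨hi, hi'⟩, rfl⟩ _ ⟨j, ⟨hj, hj'⟩, rfl⟩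
  rw [dist_eq_norm]
  refine lt_of_le_of_lt (ContinuousLinearMap.opNorm_le_of_unit_norm (𝕜 := ℂ) (C := 3 * ε / 4) (by positivity)
    fun x hx => ?_) (by linarith)
  obtain ⟨y, hy, hxy⟩ := mem_iUnion₂.1 (htc (mem_image_of_mem K' (by simp [hx] : x ∈ closedBall (0:X) 1)))
  rw [mem_ball, dist_eq_norm] at hxy
  have e : (K * u i * K' - K * u j * K') x
      = (K (u i y) - l y) - (K (u j y) - l y) + K (u i (K' x - y)) - K (u j (K' x - y)) := by
    simp only [sub_apply, mul_apply_eq_comp, map_sub]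
    abel
  have hb : ∀ k, ‖u k‖ ≤ C → ‖K (u k (K' x - y))‖ ≤ ε / 4 := by
    intro k hk
    calc ‖K (u k (K' x - y))‖ ≤ ‖K‖ * (C * η) := by
          refine (K.le_opNorm _).trans (mul_le_mul_of_nonneg_left ?_ (norm_nonneg _))
          exact ((u k).le_opNorm _).trans (mul_le_mul hk hxy.le (norm_nonneg _) hC)
      _ = (‖K‖ * C) * η := by ring
      _ ≤ (‖K‖ * C + 1) * η := by nlinarith
      _ = ε / 4 := by rw [hη]; field_simp
  rw [e]
  have h1 := hi y hy
  have h2 := hj y hy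
  have h3 := hb i hi'
  have h4 := hb j hj'
  refine (norm_sub_le _ _).trans ((add_le_add_left ((norm_add_le _ _).trans (add_le_add_left (norm_sub_le _ _) _)) _).trans ?_)
  linarith

theorem isCompactOperator_of_approx {Q : X →L[ℂ] X}
    (h : ∀ ε > 0, ∃ l : X →L[ℂ] X, IsCompactOperator l ∧ ‖Q - l‖ ≤ ε) : IsCompactOperator Q := by
  have hcl : IsClosed {f : X →L[ℂ] X | IsCompactOperator f} := isClosed_setOfPred_isCompactOperator
  change Q ∈ {f : X →L[ℂ] X | IsCompactOperator f}
  rw [← hcl.closure_eq]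
  refine Metric.mem_closure_iff.2 fun ε hε => ?_
  obtain ⟨l, hl, hl'⟩ := h (ε / 2) (by positivity)
  exact ⟨l, hl, by rw [dist_eq_norm]; linarith⟩

theorem exists_tendsto_of_approx {ι : Type*} (𝓤 : Ultrafilter ι) {w : ι → X →L[ℂ] X}
    (h : ∀ ε > 0, ∃ l : X →L[ℂ] X, IsCompactOperator l ∧ ∀ᶠ i in (𝓤 : Filter ι), ‖w i - l‖ ≤ ε) :
    ∃ Q, Tendsto w 𝓤 (𝓝 Q) ∧ IsCompactOperator Q := by
  have hc : Cauchy (map w 𝓤) := by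
    refine Metric.cauchy_iff.2 ⟨inferInstance, fun ε hε => ?_⟩
    obtain ⟨l, -, hl⟩ := h (ε / 3) (by positivity)
    refine ⟨_, image_mem_map hl, ?_⟩
    rintro _ ⟨i, hi, rfl⟩ _ ⟨j, hj, rfl⟩
    have := dist_triangle_right (w i) (w j) l
    rw [dist_eq_norm (w i) l, dist_eq_norm (w j) l] at this
    have hi' : ‖w i - l‖ ≤ ε / 3 := hi
    have hj' : ‖w j - l‖ ≤ ε / 3 := hj
    linarith
  obtain ⟨Q, hQ⟩ := cauchy_map_iff_exists_tendsto.1 hc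
  refine ⟨Q, hQ, isCompactOperator_of_approx fun ε hε => ?_⟩
  obtain ⟨l, hl, hl'⟩ := h ε hε
  exact ⟨l, hl, le_of_tendsto ((hQ.sub_const l).norm) hl'⟩

end CompactOperators

section Words

variable {X : Type*} [NormedAddCommGroup X] [NormedSpace ℂ X]

theorem finite_pow {G : Type*} [Monoid G] {M : Set G} (hM : M.Finite) (n : ℕ) :
    (M ^ n).Finite := by
  induction n with
  | zero => simp
  | succ n ih => rw [pow_succ]; exact ih.mul hM

/-- `a` is the sum of a scalar operator of norm at most `θ` and of a compact operator. -/
def ScalarAddCompact (θ : ℝ) (a : X →L[ℂ] X) : Prop :=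
  ∃ c : ℂ, ‖c‖ ≤ θ ∧ IsCompactOperator (a - c • 1 : X →L[ℂ] X)

theorem ScalarAddCompact.mul {θ η : ℝ} (hθ : 0 ≤ θ) {a b : X →L[ℂ] X} (ha : ScalarAddCompact θ a)
    (hb : ScalarAddCompact η b) : ScalarAddCompact (θ * η) (a * b) := by
  obtain ⟨c, hc, hc'⟩ := ha
  obtain ⟨d, hd, hd'⟩ := hb
  refine ⟨c * d, by rw [norm_mul]; exact mul_le_mul hc hd (norm_nonneg _) hθ, ?_⟩
  have e : a * b - (c * d) • (1 : X →L[ℂ] X) = a * (b - d • 1) + d • (a - c • 1) := by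
    simp only [mul_sub, mul_smul_comm, mul_one, smul_sub, smul_smul, mul_comm d c]
    abel
  rw [e]
  exact (isCompactOperator_mul_left hd' a).add (hc'.smul d)

theorem ScalarAddCompact.of_mem_pow {θ : ℝ} (hθ : 0 ≤ θ) {M : Set (X →L[ℂ] X)}
    (hM : ∀ a ∈ M, ScalarAddCompact θ a) {n : ℕ} : ∀ w ∈ M ^ n, ScalarAddCompact (θ ^ n) w := by
  induction n with
  | zero =>
    intro w hw
    rw [pow_zero, Set.mem_one] at hw
    exact ⟨1, by simp, by rw [hw, one_smul, sub_self]; exact isCompactOperator_zero⟩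
  | succ n ih =>
    intro w hw
    rw [pow_succ] at hw
    obtain ⟨a, ha, b, hb, rfl⟩ := Set.mem_mul.1 hw
    rw [pow_succ]
    exact (ih a ha).mul (by positivity) (hM b hb)

variable [CompleteSpace X]

theorem exists_tendsto_of_words {M : Set (X →L[ℂ] X)} (hM : M.Finite) {θ : ℝ} (hθ : 0 ≤ θ)
    (hθ1 : θ < 1) (hdec : ∀ a ∈ M, ScalarAddCompact θ a) {C : ℝ} {ι : Type*} (𝓤 : Ultrafilter ι)
    {w : ι → X →L[ℂ] X} (h : ∀ m : ℕ, ∀ᶠ i in (𝓤 : Filter ι), ∃ a ∈ M ^ m, ∃ b ∈ M ^ m,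
      ∃ u, w i = a * u * b ∧ ‖u‖ ≤ C ∧ ‖a * u‖ ≤ C ∧ ‖u * b‖ ≤ C) :
    ∃ Q, Tendsto w 𝓤 (𝓝 Q) ∧ IsCompactOperator Q := by
  refine exists_tendsto_of_approx 𝓤 fun ε hε => ?_
  have hC : 0 ≤ C := by
    obtain ⟨i, a, -, b, -, u, -, hu, -⟩ := (h 0).exists
    exact (norm_nonneg _).trans hu
  obtain ⟨m, hm⟩ : ∃ m : ℕ, 3 * C * θ ^ m < ε / 2 := by
    have := (tendsto_pow_atTop_nhds_zero_of_lt_one hθ hθ1).const_mul (3 * C)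
    rw [mul_zero] at this
    exact (this.eventually_lt_const (by positivity)).exists
  have hfin : (M ^ m).Finite := finite_pow hM m
  have h1 := h m
  rw [Ultrafilter.eventually_exists_mem_iff hfin] at h1
  obtain ⟨a, ha, h1⟩ := h1
  rw [Ultrafilter.eventually_exists_mem_iff hfin] at h1
  obtain ⟨b, hb, h1⟩ := h1
  obtain ⟨u, hu⟩ : ∃ u : ι → X →L[ℂ] X, ∀ᶠ i in (𝓤 : Filter ι),
      w i = a * u i * b ∧ ‖u i‖ ≤ C ∧ ‖a * u i‖ ≤ C ∧ ‖u i * b‖ ≤ C := h1.choice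
  obtain ⟨c, hc, hac⟩ := ScalarAddCompact.of_mem_pow hθ hdec a ha
  obtain ⟨d, hd, hbd⟩ := ScalarAddCompact.of_mem_pow hθ hdec b hb
  obtain ⟨l, hl⟩ := exists_tendsto_mul_mul 𝓤 hac hbd (hu.mono fun i hi => hi.2.1)
  refine ⟨l, isCompactOperator_of_tendsto hl
    (Eventually.of_forall fun i => isCompactOperator_mul_left hbd _), ?_⟩
  filter_upwards [hu, (tendsto_iff_norm_sub_tendsto_zero.1 hl).eventually_lt_const
    (half_pos hε)] with i ⟨hw, hu1, hu2, hu3⟩ hi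
  have e : w i - l = ((a - c • 1) * u i * (b - d • 1) - l)
      + (c • (u i * b) + d • (a * u i) - (c * d) • u i) := by
    rw [hw]
    simp only [mul_sub, sub_mul, mul_smul_comm, smul_mul_assoc, mul_one, one_mul, smul_sub,
      smul_smul, mul_comm d c]
    abel
  have hθm : θ ^ m ≤ 1 := pow_le_one₀ hθ hθ1.le
  have n1 : ‖c • (u i * b)‖ ≤ θ ^ m * C := by
    rw [norm_smul]; exact mul_le_mul hc hu3 (norm_nonneg _) (by positivity)
  have n2 : ‖d • (a * u i)‖ ≤ θ ^ m * C := by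
    rw [norm_smul]; exact mul_le_mul hd hu2 (norm_nonneg _) (by positivity)
  have n3 : ‖(c * d) • u i‖ ≤ θ ^ m * C := by
    rw [norm_smul, norm_mul]
    refine mul_le_mul ?_ hu1 (norm_nonneg _) (by positivity)
    exact (mul_le_mul hc (hd.trans hθm) (norm_nonneg _) (by positivity)).trans (by simp)
  rw [e]
  refine (norm_add_le _ _).trans ?_
  have n4 := norm_sub_le (c • (u i * b) + d • (a * u i)) ((c * d) • u i)
  have n5 := norm_add_le (c • (u i * b)) (d • (a * u i))
  linarith

theorem false_of_bounded_words {M : Set (X →L[ℂ] X)} (hM : M.Finite) {θ : ℝ} (hθ : 0 ≤ θ)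
    (hθ1 : θ < 1) (hdec : ∀ a ∈ M, ScalarAddCompact θ a)
    (hspec : ∀ n, ∀ w ∈ M ^ n, SpecLE w (θ ^ n)) {C : ℝ} (hC : ∀ n, ∀ w ∈ M ^ n, ‖w‖ ≤ C)
    {δ : ℝ} (hδ : 0 < δ) (hlow : ∀ n, ∃ w ∈ M ^ n, δ ≤ ‖w‖) : False := by
  have hC0 : 0 < C := by
    obtain ⟨w, hw, hw'⟩ := hlow 0
    exact (hδ.trans_le hw').trans_le (hC 0 w hw)
  set Good : (X →L[ℂ] X) → Prop := fun p => ∃ᶠ n in atTop, ∃ w ∈ M ^ n, δ ≤ ‖p * w‖ with hGood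
  have good_one : Good 1 := by
    refine Eventually.frequently (Eventually.of_forall fun n => ?_)
    obtain ⟨w, hw, hw'⟩ := hlow n
    exact ⟨w, hw, by rwa [one_mul]⟩
  have good_succ : ∀ p, Good p → ∃ a ∈ M, Good (p * a) := by
    intro p hp
    by_contra! hcon
    have h1 : ∀ᶠ n in atTop, ∀ a ∈ M, ∀ w ∈ M ^ n, ‖p * a * w‖ < δ := by
      refine (eventually_all_finite hM).2 fun a ha => ?_
      have := hcon a ha
      simp only [hGood, not_frequently] at this
      filter_upwards [this] with n hn w hw
      by_contra hlt
      exact hn ⟨w, hw, not_lt.1 hlt⟩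
    obtain ⟨N, hN⟩ := eventually_atTop.1 h1
    obtain ⟨n, hn, w, hw, hw'⟩ := frequently_atTop.1 hp (N + 1)
    obtain ⟨k, rfl⟩ : ∃ k, n = k + 1 := ⟨n - 1, by omega⟩
    rw [pow_succ'] at hw
    obtain ⟨a, ha, v, hv, rfl⟩ := Set.mem_mul.1 hw
    have := hN k (by omega) a ha v hv
    rw [mul_assoc] at this
    linarith
  have good_norm : ∀ p, Good p → δ / C ≤ ‖p‖ := by
    intro p hp
    obtain ⟨n, w, hw, hw'⟩ := hp.exists
    rw [div_le_iff₀ hC0]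
    exact hw'.trans ((norm_mul_le _ _).trans
      (mul_le_mul_of_nonneg_left (hC n w hw) (norm_nonneg _)))
  choose! nxt hnxt hnxt' using good_succ
  set p : ℕ → X →L[ℂ] X := fun n => Nat.rec 1 (fun _ q => q * nxt q) n with hp
  have p_zero : p 0 = 1 := rfl
  have p_succ : ∀ n, p (n + 1) = p n * nxt (p n) := fun n => rfl
  have p_good : ∀ n, Good (p n) := by
    intro n
    induction n with
    | zero => exact good_one
    | succ n ih => exact hnxt' _ ih
  have p_add : ∀ m k, ∃ q ∈ M ^ k, p (m + k) = p m * q := by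
    intro m k
    induction k with
    | zero => exact ⟨1, by simp, by simp⟩
    | succ k ih =>
      obtain ⟨q, hq, hq'⟩ := ih
      refine ⟨q * nxt (p (m + k)), ?_, ?_⟩
      · rw [pow_succ]
        exact Set.mul_mem_mul hq (hnxt _ (p_good _))
      · rw [← add_assoc, p_succ, ← mul_assoc, ← hq']
  have p_mem : ∀ n, p n ∈ M ^ n := by
    intro n
    obtain ⟨q, hq, hq'⟩ := p_add 0 n
    rw [zero_add, p_zero, one_mul] at hq'
    rwa [hq']
  have conv : ∀ w : ℕ → X →L[ℂ] X, (∀ n, ∃ k ≥ n, w n ∈ M ^ k) →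
      ∃ Q, Tendsto w (hyperfilter ℕ) (𝓝 Q) ∧ IsCompactOperator Q := by
    intro w hw
    refine exists_tendsto_of_words hM hθ hθ1 hdec (C := C) (hyperfilter ℕ) fun m => ?_
    filter_upwards [Nat.hyperfilter_le_atTop (eventually_ge_atTop (m + m))] with n hn
    obtain ⟨k, hk, hwk⟩ := hw n
    obtain ⟨j, rfl⟩ : ∃ j, k = m + j + m := ⟨k - (m + m), by omega⟩
    rw [pow_add] at hwk
    obtain ⟨au, hau, b, hb, hab⟩ := Set.mem_mul.1 hwk
    rw [pow_add] at hau
    obtain ⟨a, ha, u, hu, rfl⟩ := Set.mem_mul.1 hau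
    exact ⟨a, ha, b, hb, u, hab.symm, hC _ u hu, hC (m + j) _ (by rw [pow_add]; exact hau),
      hC (j + m) _ (by rw [pow_add]; exact Set.mul_mem_mul hu hb)⟩
  obtain ⟨D, hD, -⟩ := conv p fun n => ⟨n, le_rfl, p_mem n⟩
  have hDcl : MapClusterPt D atTop p :=
    (hD.mapClusterPt).mono Nat.hyperfilter_le_atTop
  obtain ⟨φ, hφ, hφD⟩ := hDcl.tendsto_subseq
  have hgap : ∀ j, φ j + j ≤ φ (2 * j) := by
    intro j
    rw [two_mul]
    exact (add_comm _ _).trans_le (hφ.add_le_nat j j)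
  choose q hq hq' using fun j => p_add (φ j) (φ (2 * j) - φ j)
  have hqD : ∀ j, p (φ (2 * j)) = p (φ j) * q j := by
    intro j
    rw [← hq' j]
    congr 1
    have := hgap j
    omega
  obtain ⟨Q, hQ, hQc⟩ := conv q fun j => ⟨_, by have := hgap j; omega, hq j⟩
  have hDQ : D = D * Q := by
    have h1 : Tendsto (fun j => p (φ (2 * j))) (hyperfilter ℕ) (𝓝 D) :=
      (hφD.comp (tendsto_id.const_mul_atTop' two_pos)).mono_left Nat.hyperfilter_le_atTop
    have h2 : Tendsto (fun j => p (φ j) * q j) (hyperfilter ℕ) (𝓝 (D * Q)) :=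
      (hφD.mono_left Nat.hyperfilter_le_atTop).mul hQ
    simp only [hqD] at h1
    exact tendsto_nhds_unique h1 h2
  have hQspec : SpecLE Q (1 / 2) := by
    refine specLE_of_tendsto (countable_spectrum Q hQc) hQ ?_
    have h1 := (tendsto_pow_atTop_nhds_zero_of_lt_one hθ hθ1).eventually_le_const
      (show (0 : ℝ) < 1 / 2 by norm_num)
    filter_upwards [Nat.hyperfilter_le_atTop h1] with j hj
    refine (hspec _ _ (hq j)).mono (le_trans (pow_le_pow_of_le_one hθ hθ1.le ?_) hj)
    have := hgap j
    omega
  have hD0 : D ≠ 0 := by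
    have : δ / C ≤ ‖D‖ := ge_of_tendsto' hφD.norm fun n => good_norm _ (p_good _)
    exact norm_pos_iff.1 ((by positivity : 0 < δ / C).trans_le this)
  have hDn : ∀ n, D = D * Q ^ n := by
    intro n
    induction n with
    | zero => simp
    | succ n ih => rw [pow_succ, ← mul_assoc, ← ih]; exact hDQ
  obtain ⟨B, -, hB⟩ := hQspec.exists_norm_pow_le (t := 3 / 4) (by norm_num) (by norm_num)
  have hlim : Tendsto (fun n : ℕ => ‖D‖ * (B * (3 / 4 : ℝ) ^ n)) atTop (𝓝 (‖D‖ * (B * 0))) :=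
    ((tendsto_pow_atTop_nhds_zero_of_lt_one (by norm_num) (by norm_num)).const_mul _).const_mul _
  have : ‖D‖ ≤ ‖D‖ * (B * 0) := ge_of_tendsto' hlim fun n => by
    conv_lhs => rw [hDn n]
    exact (norm_mul_le _ _).trans (mul_le_mul_of_nonneg_left (hB n) (norm_nonneg _))
  simp only [mul_zero, norm_le_zero_iff] at this
  exact hD0 this

end Words

section Adapted

variable {X : Type*} [NormedAddCommGroup X] [NormedSpace ℂ X]

/-- The seminorm adapted to a set `M` of operators with power growth. -/
theorem exists_adapted_seminorm {M : Set (X →L[ℂ] X)} {r : ℝ} (hr : 0 < r) {C : ℝ}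
    (h : ∀ n, ∀ w ∈ M ^ n, r ^ n * ‖w‖ ≤ C) :
    ∃ N : Seminorm ℂ X, (∀ x, N x ≤ C * ‖x‖) ∧ (∀ n, ∀ w ∈ M ^ n, ∀ x, r ^ n * ‖w x‖ ≤ N x) ∧
      ∀ x c, (∀ n, ∀ w ∈ M ^ n, r ^ n * ‖w x‖ ≤ c) → N x ≤ c := by
  set S : X → Set ℝ := fun x => {y | ∃ n, ∃ w ∈ M ^ n, y = r ^ n * ‖w x‖} with hS
  have hne : ∀ x, (S x).Nonempty := fun x => ⟨_, 0, 1, by simp, rfl⟩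
  have hle : ∀ n, ∀ w ∈ M ^ n, ∀ x, r ^ n * ‖w x‖ ≤ C * ‖x‖ := fun n w hw x => by
    calc r ^ n * ‖w x‖ ≤ r ^ n * (‖w‖ * ‖x‖) :=
          mul_le_mul_of_nonneg_left (w.le_opNorm x) (by positivity)
      _ = r ^ n * ‖w‖ * ‖x‖ := by ring
      _ ≤ C * ‖x‖ := mul_le_mul_of_nonneg_right (h n w hw) (norm_nonneg x)
  have hbdd : ∀ x, BddAbove (S x) := fun x => ⟨C * ‖x‖, by
    rintro _ ⟨n, w, hw, rfl⟩
    exact hle n w hw x⟩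
  have hmem : ∀ n, ∀ w ∈ M ^ n, ∀ x, r ^ n * ‖w x‖ ≤ sSup (S x) := fun n w hw x =>
    le_csSup (hbdd x) ⟨n, w, hw, rfl⟩
  have hsup : ∀ x c, (∀ n, ∀ w ∈ M ^ n, r ^ n * ‖w x‖ ≤ c) → sSup (S x) ≤ c := fun x c hc =>
    csSup_le (hne x) (by
      rintro _ ⟨n, w, hw, rfl⟩
      exact hc n w hw)
  refine ⟨Seminorm.ofSMulLE (fun x => sSup (S x)) ?_ ?_ ?_, ?_, hmem, hsup⟩
  · refine le_antisymm (hsup 0 0 fun n w _ => by simp) ?_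
    exact (by simp : (0 : ℝ) ≤ r ^ 0 * ‖(1 : X →L[ℂ] X) 0‖).trans (hmem 0 1 (by simp) 0)
  · intro x y
    refine hsup _ _ fun n w hw => ?_
    have h1 := hmem n w hw x
    have h2 := hmem n w hw y
    have h3 := mul_le_mul_of_nonneg_left (norm_add_le (w x) (w y)) (pow_nonneg hr.le n)
    rw [map_add]
    linarith
  · intro z x
    refine hsup _ _ fun n w hw => ?_
    rw [map_smul, norm_smul, mul_left_comm]
    exact mul_le_mul_of_nonneg_left (hmem n w hw x) (norm_nonneg z)
  · exact fun x => hsup x _ fun n w hw => hle n w hw x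

theorem Seminorm.mul_apply_le_of_adapted {M : Set (X →L[ℂ] X)} {r : ℝ} (hr : 0 < r)
    {N : Seminorm ℂ X} (hmem : ∀ n, ∀ w ∈ M ^ n, ∀ x, r ^ n * ‖w x‖ ≤ N x)
    (hsup : ∀ x c, (∀ n, ∀ w ∈ M ^ n, r ^ n * ‖w x‖ ≤ c) → N x ≤ c)
    {a : X →L[ℂ] X} (ha : a ∈ M) (x : X) : r * N (a x) ≤ N x := by
  rw [← le_div_iff₀' hr]
  refine hsup _ _ fun n w hw => ?_
  rw [le_div_iff₀' hr, ← mul_assoc, ← pow_succ']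
  exact hmem (n + 1) (w * a) (by rw [pow_succ]; exact Set.mul_mem_mul hw ha) x

theorem exists_bound_words {M : Set (X →L[ℂ] X)} (hM : M.Finite) (m : ℕ) :
    ∃ R, ∀ n < m, ∀ w ∈ M ^ n, ‖w‖ ≤ R := by
  have : (⋃ n ∈ Iio m, M ^ n).Finite := (finite_Iio m).biUnion fun n _ => finite_pow hM n
  obtain ⟨R, hR⟩ := this.isCompact.isBounded.exists_norm_le
  exact ⟨R, fun n hn w hw => hR w (mem_biUnion (mem_Iio.2 hn) hw)⟩

theorem exists_invariant_seminorm {M : Set (X →L[ℂ] X)} (hM : M.Finite) {θ : ℝ} (hθ : 0 ≤ θ)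
    (hθ1 : θ < 1) (hdec : ∀ a ∈ M, ScalarAddCompact θ a)
    (hs : ∀ s, 0 < s → s < 1 → ∃ C, ∀ n, ∀ w ∈ M ^ n, s ^ n * ‖w‖ ≤ C)
    (hunb : ∀ C, ∃ n, ∃ w ∈ M ^ n, C < ‖w‖) :
    ∃ v : Seminorm ℂ X, (∀ x, v x ≤ ‖x‖) ∧ (∀ a ∈ M, ∀ x, v (a x) ≤ v x) ∧ (∃ x, 0 < v x) ∧
      ∀ n x, ∃ w ∈ M ^ n, v x ≤ v (w x) := by
  set s : ℕ → ℝ := fun j => 1 - 1 / ((j : ℝ) + 2) with hsdef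
  have hsj : ∀ j, 0 < s j ∧ s j < 1 := by
    intro j
    have h1 : 1 / ((j : ℝ) + 2) < 1 := by
      rw [div_lt_one (by positivity)]
      linarith [(Nat.cast_nonneg j : (0 : ℝ) ≤ j)]
    have h2 : 0 < 1 / ((j : ℝ) + 2) := by positivity
    constructor <;> simp only [hsdef] <;> linarith
  have hslim : Tendsto s atTop (𝓝 1) := by
    have h1 : Tendsto (fun j : ℕ => (j : ℝ) + 2) atTop atTop :=
      tendsto_atTop_add_const_right _ _ tendsto_natCast_atTop_atTop
    have := (h1.inv_tendsto_atTop).const_sub 1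
    simpa [hsdef, one_div, Pi.inv_apply] using this
  set T : ℕ → Set ℝ := fun j => {y | ∃ n, ∃ w ∈ M ^ n, y = s j ^ n * ‖w‖} with hT
  have hTne : ∀ j, (T j).Nonempty := fun j => ⟨_, 0, 1, by simp, rfl⟩
  have hTb : ∀ j, BddAbove (T j) := fun j => by
    obtain ⟨C, hC⟩ := hs (s j) (hsj j).1 (hsj j).2
    exact ⟨C, by rintro _ ⟨n, w, hw, rfl⟩; exact hC n w hw⟩
  set L : ℕ → ℝ := fun j => sSup (T j) with hL
  have hLle : ∀ j n, ∀ w ∈ M ^ n, s j ^ n * ‖w‖ ≤ L j := fun j n w hw =>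
    le_csSup (hTb j) ⟨n, w, hw, rfl⟩
  have hLlim : Tendsto L atTop atTop := by
    refine tendsto_atTop.2 fun R => ?_
    obtain ⟨n, w, hw, hRw⟩ := hunb R
    have h1 : Tendsto (fun j => s j ^ n * ‖w‖) atTop (𝓝 (1 ^ n * ‖w‖)) :=
      (hslim.pow n).mul_const _
    rw [one_pow, one_mul] at h1
    filter_upwards [h1.eventually_const_lt hRw] with j hj
    exact hj.le.trans (hLle j n w hw)
  have hL0 : ∀ j, 0 < L j := by
    intro j
    obtain ⟨n, w, hw, h0⟩ := hunb 0
    exact (mul_pos (pow_pos (hsj j).1 n) h0).trans_le (hLle j n w hw)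
  choose N hNle hNmem hNsup using fun j =>
    exists_adapted_seminorm (M := M) (hsj j).1 (hLle j)
  have hNa : ∀ j, ∀ a ∈ M, ∀ x, s j * N j (a x) ≤ N j x := fun j a ha x =>
    Seminorm.mul_apply_le_of_adapted (hsj j).1 (hNmem j) (hNsup j) ha x
  have hdiv : ∀ j x, N j x / L j ≤ ‖x‖ := fun j x => by
    rw [div_le_iff₀ (hL0 j), mul_comm]
    exact hNle j x
  have hlim : ∀ x, ∃ l, Tendsto (fun j => N j x / L j) (hyperfilter ℕ) (𝓝 l) := by
    intro x
    obtain ⟨l, -, hl⟩ := (isCompact_Icc (a := (0 : ℝ)) (b := ‖x‖)).ultrafilter_le_nhds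
      ((hyperfilter ℕ).map fun j => N j x / L j) (by
        rw [le_principal_iff, Ultrafilter.coe_map, mem_map]
        exact Eventually.of_forall fun j => ⟨div_nonneg (apply_nonneg _ _) (hL0 j).le, hdiv j x⟩)
    exact ⟨l, hl⟩
  choose v hv using hlim
  have hLinv : Tendsto (fun j => (L j)⁻¹) (hyperfilter ℕ) (𝓝 0) :=
    hLlim.inv_tendsto_atTop.mono_left Nat.hyperfilter_le_atTop
  have hv0 : ∀ x, 0 ≤ v x := fun x =>
    ge_of_tendsto' (hv x) fun j => div_nonneg (apply_nonneg _ _) (hL0 j).le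
  have hMne : M.Nonempty := by
    by_contra hne
    rw [not_nonempty_iff_eq_empty] at hne
    obtain ⟨n, w, hw, h1⟩ := hunb ‖(1 : X →L[ℂ] X)‖
    rcases n with - | n
    · rw [pow_zero, Set.mem_one] at hw
      rw [hw] at h1
      exact lt_irrefl _ h1
    · rw [pow_succ, hne, Set.mul_empty] at hw
      exact hw
  have hstep : ∀ x, ∃ a ∈ M, v x ≤ v (a x) := by
    intro x
    have h1 : ∀ᶠ j in (hyperfilter ℕ : Filter ℕ), ∃ a ∈ M,
        N j x / L j ≤ max (‖x‖ * (L j)⁻¹) (N j (a x) / L j) := by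
      refine Eventually.of_forall fun j => ?_
      obtain ⟨a, ha, hmax⟩ := hM.exists_maximalFor (fun a => N j (a x)) M hMne
      have hmax' : ∀ b ∈ M, N j (b x) ≤ N j (a x) := fun b hb => by
        rcases le_total (N j (b x)) (N j (a x)) with h | h
        · exact h
        · exact hmax hb h
      refine ⟨a, ha, ?_⟩
      rw [← div_eq_mul_inv, max_div_div_right (hL0 j).le]
      refine div_le_div_of_nonneg_right (hNsup j x _ fun n w hw => ?_) (hL0 j).le
      rcases n with - | n
      · rw [pow_zero, Set.mem_one] at hw
        rw [hw, pow_zero, one_mul]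
        exact le_max_left _ _
      · rw [pow_succ] at hw
        obtain ⟨w', hw', b, hb, rfl⟩ := Set.mem_mul.1 hw
        refine le_max_of_le_right (le_trans ?_ (hmax' b hb))
        refine le_trans ?_ (hNmem j n w' hw' (b x))
        rw [pow_succ]
        refine mul_le_mul_of_nonneg_right ?_ (norm_nonneg _)
        exact mul_le_of_le_one_right (pow_nonneg (hsj j).1.le n) (hsj j).2.le
    rw [Ultrafilter.eventually_exists_mem_iff hM] at h1
    obtain ⟨a, ha, h1⟩ := h1
    refine ⟨a, ha, ?_⟩
    have h2 := le_of_tendsto_of_tendsto (hv x) ((hLinv.const_mul ‖x‖).max (hv (a x))) h1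
    rwa [mul_zero, max_eq_right (hv0 _)] at h2
  refine ⟨Seminorm.ofSMulLE v ?_ ?_ ?_, ?_, ?_, ?_, ?_⟩
  · refine tendsto_nhds_unique (hv 0) ?_
    simp
  · intro x y
    refine le_of_tendsto_of_tendsto' (hv (x + y)) ((hv x).add (hv y)) fun j => ?_
    rw [← add_div]
    exact div_le_div_of_nonneg_right (map_add_le_add _ _ _) (hL0 j).le
  · intro z x
    refine le_of_tendsto_of_tendsto' (hv (z • x)) ((hv x).const_mul ‖z‖) fun j => ?_
    rw [map_smul_eq_mul, mul_div_assoc]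
  · exact fun x => le_of_tendsto' (hv x) fun j => hdiv j x
  · intro a ha x
    have h1 := ((hslim.mono_left Nat.hyperfilter_le_atTop).mul (hv (a x)))
    rw [one_mul] at h1
    refine le_of_tendsto_of_tendsto' h1 (hv x) fun j => ?_
    rw [← mul_div_assoc]
    exact div_le_div_of_nonneg_right (hNa j a ha x) (hL0 j).le
  · have hw : ∀ j, ∃ n, ∃ w ∈ M ^ n, ∃ x, ‖x‖ ≤ 1 ∧ L j / 4 ≤ s j ^ n * ‖w x‖ := by
      intro j
      obtain ⟨_, ⟨n, w, hw, rfl⟩, hlt⟩ := exists_lt_of_lt_csSup (hTne j) (half_lt_self (hL0 j))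
      have hsn : 0 < s j ^ n := pow_pos (hsj j).1 n
      have hwpos : 0 < ‖w‖ := pos_of_mul_pos_right ((half_pos (hL0 j)).trans hlt) hsn.le
      obtain ⟨x, hx, hwx⟩ := w.exists_lt_apply_of_lt_opNorm (half_lt_self hwpos)
      refine ⟨n, w, hw, x, hx.le, ?_⟩
      have := mul_le_mul_of_nonneg_left hwx.le hsn.le
      change L j / 2 < _ at hlt
      linarith
    choose n w hw x hx hwx using hw
    have hn : ∀ m, ∀ᶠ j in (hyperfilter ℕ : Filter ℕ), m ≤ n j := by
      intro m
      obtain ⟨R, hR⟩ := exists_bound_words hM m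
      filter_upwards [Nat.hyperfilter_le_atTop (hLlim.eventually_gt_atTop (4 * R))] with j hj
      by_contra! hlt
      have h1 := hR _ hlt _ (hw j)
      have h2 := hwx j
      have h3 : s j ^ n j ≤ 1 := pow_le_one₀ (hsj j).1.le (hsj j).2.le
      have h4 : ‖w j (x j)‖ ≤ ‖w j‖ :=
        ((w j).le_opNorm _).trans (mul_le_of_le_one_right (norm_nonneg _) (hx j))
      have h5 := mul_le_of_le_one_left (norm_nonneg (w j (x j))) h3
      linarith
    obtain ⟨m, hm⟩ : ∃ m : ℕ, θ ^ m < 1 / 8 :=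
      ((tendsto_pow_atTop_nhds_zero_of_lt_one hθ hθ1).eventually_lt_const (by norm_num)).exists
    have h1 : ∀ᶠ j in (hyperfilter ℕ : Filter ℕ), ∃ b ∈ M ^ m, L j / 4 ≤ N j (b (x j)) := by
      filter_upwards [hn m] with j hj
      have hwj := hw j
      rw [← Nat.sub_add_cancel hj, pow_add] at hwj
      obtain ⟨u, hu, b, hb, hub⟩ := Set.mem_mul.1 hwj
      refine ⟨b, hb, (hwx j).trans (le_trans ?_ (hNmem j _ u hu (b (x j))))⟩
      rw [← hub]
      exact mul_le_mul_of_nonneg_right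
        (pow_le_pow_of_le_one (hsj j).1.le (hsj j).2.le (Nat.sub_le _ _)) (norm_nonneg _)
    rw [Ultrafilter.eventually_exists_mem_iff (finite_pow hM m)] at h1
    obtain ⟨b, hb, h1⟩ := h1
    obtain ⟨c, hc, hK⟩ := ScalarAddCompact.of_mem_pow hθ hdec b hb
    obtain ⟨y, -, hy⟩ := (IsCompactOperator.isCompact_closure_image_closedBall
      (f := ((b - c • 1 : X →L[ℂ] X) : X →ₗ[ℂ] X)) hK 1).ultrafilter_le_nhds
      ((hyperfilter ℕ).map fun j => (b - c • 1 : X →L[ℂ] X) (x j)) (by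
        rw [le_principal_iff, Ultrafilter.coe_map, mem_map]
        exact Eventually.of_forall fun j => subset_closure
          (mem_image_of_mem _ (by simpa using hx j)))
    refine ⟨y, ?_⟩
    have h2 : Tendsto (fun j => θ ^ m + ‖(b - c • 1 : X →L[ℂ] X) (x j) - y‖ + N j y / L j)
        (hyperfilter ℕ) (𝓝 (θ ^ m + 0 + v y)) :=
      (tendsto_const_nhds.add (tendsto_iff_norm_sub_tendsto_zero.1 hy)).add (hv y)
    have h3 : 1 / 4 ≤ θ ^ m + 0 + v y := by
      refine ge_of_tendsto h2 ?_
      filter_upwards [h1] with j hj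
      have e : b (x j) = c • x j + (((b - c • 1 : X →L[ℂ] X) (x j) - y) + y) := by
        simp
      have h4 : N j (b (x j)) / L j ≤ ‖c • x j‖ + ‖(b - c • 1 : X →L[ℂ] X) (x j) - y‖
          + N j y / L j := by
        have h5 : N j (b (x j)) ≤ N j (c • x j) + (N j ((b - c • 1 : X →L[ℂ] X) (x j) - y)
            + N j y) := by
          conv_lhs => rw [e]
          exact (map_add_le_add _ _ _).trans (add_le_add_right (map_add_le_add _ _ _) _)
        have h6 := div_le_div_of_nonneg_right h5 (hL0 j).le
        rw [add_div, add_div] at h6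
        have h7 := hdiv j (c • x j)
        have h8 := hdiv j ((b - c • 1 : X →L[ℂ] X) (x j) - y)
        linarith
      have h5 : ‖c • x j‖ ≤ θ ^ m := by
        rw [norm_smul]
        exact (mul_le_of_le_one_right (norm_nonneg _) (hx j)).trans hc
      have h6 : 1 / 4 ≤ N j (b (x j)) / L j := by
        rw [le_div_iff₀ (hL0 j)]
        linarith
      linarith
    change 0 < v y
    linarith
  · intro n
    induction n with
    | zero => exact fun x => ⟨1, by simp, le_rfl⟩
    | succ n ih =>
      intro x
      obtain ⟨a, ha, hax⟩ := hstep x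
      obtain ⟨w, hw, hwx⟩ := ih (a x)
      exact ⟨w * a, by rw [pow_succ]; exact Set.mul_mem_mul hw ha, le_trans hax hwx⟩

end Adapted

section Quotient

variable {X : Type*} [NormedAddCommGroup X] [NormedSpace ℂ X] (Z : Submodule ℂ X)

/-- `b` is the operator induced by `a` on the quotient by `Z`. -/
def IsInduced (a : X →L[ℂ] X) (b : X ⧸ Z →L[ℂ] X ⧸ Z) : Prop :=
  ∀ x : X, b (Submodule.Quotient.mk x) = Submodule.Quotient.mk (a x)

variable {Z}

theorem exists_isInduced {a : X →L[ℂ] X} (ha : ∀ x ∈ Z, a x ∈ Z) : ∃ b, IsInduced Z a b := by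
  refine ⟨Z.liftQL (Z.mkQL ∘L a) fun x hx => ?_, fun x => rfl⟩
  change Submodule.Quotient.mk (a x) = (0 : X ⧸ Z)
  exact (Submodule.Quotient.mk_eq_zero Z).2 (ha x hx)

theorem IsInduced.one : IsInduced Z 1 1 := fun _ => rfl

theorem IsInduced.mul {a a' : X →L[ℂ] X} {b b' : X ⧸ Z →L[ℂ] X ⧸ Z} (h : IsInduced Z a b)
    (h' : IsInduced Z a' b') : IsInduced Z (a * a') (b * b') := fun x => by
  rw [mul_apply_eq_comp, mul_apply_eq_comp, h', h]

theorem IsInduced.pow {a : X →L[ℂ] X} {b : X ⧸ Z →L[ℂ] X ⧸ Z} (h : IsInduced Z a b) (n : ℕ) :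
    IsInduced Z (a ^ n) (b ^ n) := by
  induction n with
  | zero => exact IsInduced.one
  | succ n ih => rw [pow_succ, pow_succ]; exact ih.mul h

theorem IsInduced.isCompactOperator {a : X →L[ℂ] X} {b : X ⧸ Z →L[ℂ] X ⧸ Z}
    (h : IsInduced Z a b) (ha : IsCompactOperator a) : IsCompactOperator b := by
  refine (isCompactOperator_iff_image_closedBall_subset_compact (b : X ⧸ Z →ₗ[ℂ] X ⧸ Z)
    one_pos).2 ⟨_, ((IsCompactOperator.isCompact_closure_image_closedBall
      (f := (a : X →ₗ[ℂ] X)) ha 2).image Z.mkQL.continuous), ?_⟩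
  rintro _ ⟨y, hy, rfl⟩
  rw [mem_closedBall_zero_iff] at hy
  obtain ⟨x, rfl, hx⟩ := Submodule.Quotient.norm_mk_lt y one_pos
  refine ⟨a x, subset_closure (mem_image_of_mem _ ?_), (h x).symm⟩
  rw [mem_closedBall_zero_iff]
  linarith

variable [IsClosed (Z : Set X)]

theorem IsInduced.norm_le {a : X →L[ℂ] X} {b : X ⧸ Z →L[ℂ] X ⧸ Z} (h : IsInduced Z a b) :
    ‖b‖ ≤ ‖a‖ := by
  refine b.opNorm_le_bound (norm_nonneg a) fun y => ?_
  refine le_of_forall_pos_le_add fun ε hε => ?_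
  obtain ⟨x, rfl, hx⟩ := Submodule.Quotient.norm_mk_lt y (ε := ε / (‖a‖ + 1)) (by positivity)
  rw [h x]
  have h1 : ‖a‖ * (ε / (‖a‖ + 1)) ≤ ε := by
    rw [← mul_div_assoc, div_le_iff₀ (by positivity)]
    nlinarith
  calc ‖(Submodule.Quotient.mk (a x) : X ⧸ Z)‖ ≤ ‖a x‖ := Submodule.Quotient.norm_mk_le Z _
    _ ≤ ‖a‖ * ‖x‖ := a.le_opNorm x
    _ ≤ ‖a‖ * (‖(Submodule.Quotient.mk x : X ⧸ Z)‖ + ε / (‖a‖ + 1)) :=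
      mul_le_mul_of_nonneg_left hx.le (norm_nonneg a)
    _ ≤ _ := by rw [mul_add]; linarith

theorem IsInduced.scalarAddCompact {a : X →L[ℂ] X} {b : X ⧸ Z →L[ℂ] X ⧸ Z}
    (h : IsInduced Z a b) {θ : ℝ} (ha : ScalarAddCompact θ a) : ScalarAddCompact θ b := by
  obtain ⟨c, hc, hK⟩ := ha
  refine ⟨c, hc, IsInduced.isCompactOperator (fun x => ?_) hK⟩
  change b (Submodule.Quotient.mk x) - c • (Submodule.Quotient.mk x : X ⧸ Z) = _
  rw [h x]
  rfl

theorem IsInduced.specLE [CompleteSpace X] {a : X →L[ℂ] X} {b : X ⧸ Z →L[ℂ] X ⧸ Z}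
    (h : IsInduced Z a b) {c : ℝ} (hc : 0 ≤ c) (ha : SpecLE a c) : SpecLE b c := by
  refine SpecLE.of_forall_gt fun t ht => ?_
  obtain ⟨C, -, hC⟩ := ha.exists_norm_pow_le hc ht
  exact specLE_of_norm_pow_le (hc.trans ht.le) fun n => ((h.pow n).norm_le).trans (hC n)

end Quotient

section BergerWang

variable {X : Type*} [NormedAddCommGroup X] [NormedSpace ℂ X]

theorem exists_bound_words_of_norm_le {M : Set (X →L[ℂ] X)} (hM : M.Finite) {n : ℕ} (hn : n ≠ 0)
    {q : ℝ} (hq : 0 < q) (h : ∀ w ∈ M ^ n, ‖w‖ ≤ q ^ n) :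
    ∃ C, ∀ k, ∀ w ∈ M ^ k, ‖w‖ ≤ C * q ^ k := by
  obtain ⟨R, hR⟩ := exists_bound_words hM n
  set D : ℝ := ∑ j ∈ Finset.range n, |R| / q ^ j with hD
  have hDj : ∀ j < n, |R| ≤ D * q ^ j := fun j hj => by
    rw [← div_le_iff₀ (by positivity)]
    exact Finset.single_le_sum (f := fun j => |R| / q ^ j) (fun _ _ => by positivity)
      (Finset.mem_range.2 hj)
  have key : ∀ i, ∀ j < n, ∀ w ∈ M ^ (n * i + j), ‖w‖ ≤ D * q ^ (n * i + j) := by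
    intro i
    induction i with
    | zero =>
      intro j hj w hw
      rw [mul_zero, zero_add] at hw ⊢
      exact (hR j hj w hw).trans ((le_abs_self R).trans (hDj j hj))
    | succ i ih =>
      intro j hj w hw
      rw [show n * (i + 1) + j = n + (n * i + j) by ring] at hw ⊢
      rw [pow_add] at hw
      obtain ⟨a, ha, b, hb, rfl⟩ := Set.mem_mul.1 hw
      calc ‖a * b‖ ≤ ‖a‖ * ‖b‖ := norm_mul_le _ _
        _ ≤ q ^ n * (D * q ^ (n * i + j)) :=
          mul_le_mul (h a ha) (ih j hj b hb) (norm_nonneg _) (by positivity)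
        _ = _ := by ring
  refine ⟨D, fun k w hw => ?_⟩
  have := key (k / n) (k % n) (Nat.mod_lt k (Nat.pos_of_ne_zero hn))
  rw [Nat.div_add_mod] at this
  exact this w hw

variable [CompleteSpace X]

theorem exists_tendsto_of_unbounded_words {M : Set (X →L[ℂ] X)} (hM : M.Finite) {θ : ℝ}
    (hθ : 0 ≤ θ) (hθ1 : θ < 1) (hdec : ∀ a ∈ M, ScalarAddCompact θ a)
    (hunb : ∀ C : ℝ, ∃ n, ∃ w ∈ M ^ n, C < ‖w‖) :
    ∃ (n : ℕ → ℕ) (w : ℕ → X →L[ℂ] X) (c : ℕ → ℝ) (Q : X →L[ℂ] X), (∀ k, w k ∈ M ^ n k) ∧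
      (∀ k, 0 ≤ c k) ∧ Tendsto c (hyperfilter ℕ) (𝓝 0) ∧
      Tendsto (fun k => (c k : ℂ) • w k) (hyperfilter ℕ) (𝓝 Q) ∧ Q ≠ 0 := by
  have hrec : ∀ k : ℕ, ∃ n, ∃ w ∈ M ^ n, (k : ℝ) < ‖w‖ ∧
      ∀ j ≤ n, ∀ u ∈ M ^ j, ‖u‖ ≤ ‖w‖ := by
    intro k
    classical
    have hex := hunb k
    obtain ⟨w₀, hw₀, hk⟩ := Nat.find_spec hex
    obtain ⟨w, hw, hmax⟩ := (finite_pow hM (Nat.find hex)).exists_maximalFor (fun w => ‖w‖) _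
      ⟨w₀, hw₀⟩
    have hmax' : ∀ u ∈ M ^ Nat.find hex, ‖u‖ ≤ ‖w‖ := fun u hu => by
      rcases le_total ‖u‖ ‖w‖ with h | h
      · exact h
      · exact hmax hu h
    have hkw := hk.trans_le (hmax' w₀ hw₀)
    refine ⟨_, w, hw, hkw, fun j hj u hu => ?_⟩
    rcases hj.lt_or_eq with h | rfl
    · have := Nat.find_min hex h
      push Not at this
      exact (this u hu).trans hkw.le
    · exact hmax' u hu
  choose n w hw hkw hmax using hrec
  have hw0 : ∀ k, 0 < ‖w k‖ := fun k => (Nat.cast_nonneg k).trans_lt (hkw k)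
  have hwlim : Tendsto (fun k => ‖w k‖) (hyperfilter ℕ) atTop :=
    (tendsto_atTop_mono (fun k => (hkw k).le) tendsto_natCast_atTop_atTop).mono_left
      Nat.hyperfilter_le_atTop
  obtain ⟨Q, hQ, -⟩ := exists_tendsto_of_words hM hθ hθ1 hdec (C := 1) (hyperfilter ℕ)
    (w := fun k => (‖w k‖⁻¹ : ℂ) • w k) fun m => by
      obtain ⟨R, hR⟩ := exists_bound_words hM (m + m)
      filter_upwards [hwlim.eventually_gt_atTop R] with k hk
      have hn : m + m ≤ n k := by
        by_contra! hlt
        exact absurd (hR _ hlt _ (hw k)) (not_le.2 hk)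
      have hsc : ∀ j ≤ n k, ∀ u ∈ M ^ j, ‖(‖w k‖⁻¹ : ℂ) • u‖ ≤ 1 := by
        intro j hj u hu
        rw [norm_smul, norm_inv, Complex.norm_real, norm_norm, inv_mul_le_iff₀ (hw0 k), mul_one]
        exact hmax k j hj u hu
      obtain ⟨j, hj⟩ : ∃ j, n k = m + j + m := ⟨n k - (m + m), by omega⟩
      have hwk := hw k
      rw [hj, pow_add] at hwk
      obtain ⟨au, hau, b, hb, hab⟩ := Set.mem_mul.1 hwk
      rw [pow_add] at hau
      obtain ⟨a, ha, u, hu, rfl⟩ := Set.mem_mul.1 hau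
      refine ⟨a, ha, b, hb, (‖w k‖⁻¹ : ℂ) • u, ?_, hsc j (by omega) u hu, ?_, ?_⟩
      · rw [← hab, mul_smul_comm, smul_mul_assoc]
      · rw [mul_smul_comm]
        exact hsc (m + j) (by omega) _ (by rw [pow_add]; exact hau)
      · rw [smul_mul_assoc]
        exact hsc (j + m) (by omega) _ (by rw [pow_add]; exact Set.mul_mem_mul hu hb)
  have hQ1 : ‖Q‖ = 1 := by
    refine tendsto_nhds_unique hQ.norm ?_
    refine tendsto_const_nhds.congr fun k => ?_
    rw [norm_smul, norm_inv, Complex.norm_real, norm_norm, inv_mul_cancel₀ (hw0 k).ne']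
  refine ⟨n, w, fun k => ‖w k‖⁻¹, Q, hw, fun k => by positivity, tendsto_inv_atTop_zero.comp hwlim,
    by simpa only [Complex.ofReal_inv] using hQ, ?_⟩
  rintro rfl
  rw [norm_zero] at hQ1
  exact zero_ne_one hQ1

theorem false_of_words_ge_one {M : Set (X →L[ℂ] X)} (hM : M.Finite) {θ : ℝ} (hθ : 0 ≤ θ)
    (hθ1 : θ < 1) (hdec : ∀ a ∈ M, ScalarAddCompact θ a)
    (hspec : ∀ n, ∀ w ∈ M ^ n, SpecLE w (θ ^ n))
    (hs : ∀ s, 0 < s → s < 1 → ∃ C, ∀ n, ∀ w ∈ M ^ n, s ^ n * ‖w‖ ≤ C)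
    (hlow : ∀ n, ∃ w ∈ M ^ n, 1 ≤ ‖w‖) : False := by
  by_cases hb : ∃ C, ∀ n, ∀ w ∈ M ^ n, ‖w‖ ≤ C
  · obtain ⟨C, hC⟩ := hb
    exact false_of_bounded_words hM hθ hθ1 hdec hspec hC one_pos hlow
  push Not at hb
  obtain ⟨v, hv1, hva, ⟨x₀, hx₀⟩, hvw⟩ := exists_invariant_seminorm hM hθ hθ1 hdec hs hb
  have hvcont : Continuous v := by
    refine Seminorm.continuous_of_le (q := normSeminorm ℂ X) continuous_norm fun x => hv1 x
  let Z : Submodule ℂ X :=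
    { carrier := {x | v x = 0}
      add_mem' := fun {x y} (hx : v x = 0) (hy : v y = 0) =>
        le_antisymm ((map_add_le_add v x y).trans (by rw [hx, hy, add_zero])) (apply_nonneg v _)
      zero_mem' := map_zero v
      smul_mem' := fun c x (hx : v x = 0) => by
        change v (c • x) = 0
        rw [map_smul_eq_mul, hx, mul_zero] }
  have hZ : ∀ x, x ∈ Z ↔ v x = 0 := fun x => Iff.rfl
  have : IsClosed (Z : Set X) := isClosed_singleton.preimage hvcont
  have hmkle : ∀ x, v x ≤ ‖(Submodule.Quotient.mk x : X ⧸ Z)‖ := by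
    intro x
    refine le_of_forall_pos_le_add fun ε hε => ?_
    obtain ⟨x', hx', hlt⟩ := Submodule.Quotient.norm_mk_lt (Submodule.Quotient.mk x : X ⧸ Z) hε
    have h1 : v (x - x') = 0 := (hZ _).1 ((Submodule.Quotient.eq Z).1 hx'.symm)
    have h2 := map_add_le_add v (x - x') x'
    rw [sub_add_cancel, h1, zero_add] at h2
    exact h2.trans ((hv1 x').trans hlt.le)
  have hind : ∀ a ∈ M, ∃ b, IsInduced Z a b := fun a ha => exists_isInduced fun x hx =>
    (hZ _).2 (le_antisymm ((hva a ha x).trans_eq hx) (apply_nonneg v _))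
  choose! F hF using hind
  have hMY : (F '' M).Finite := hM.image F
  have hpull : ∀ n, ∀ b ∈ (F '' M) ^ n, ∃ a ∈ M ^ n, IsInduced Z a b := by
    intro n
    induction n with
    | zero =>
      intro b hb
      rw [pow_zero, Set.mem_one] at hb
      exact ⟨1, by simp, hb ▸ IsInduced.one⟩
    | succ n ih =>
      intro b hb
      rw [pow_succ] at hb
      obtain ⟨b₁, hb₁, _, ⟨a₂, ha₂, rfl⟩, rfl⟩ := Set.mem_mul.1 hb
      obtain ⟨a₁, ha₁, h₁⟩ := ih b₁ hb₁
      exact ⟨a₁ * a₂, by rw [pow_succ]; exact Set.mul_mem_mul ha₁ ha₂, h₁.mul (hF a₂ ha₂)⟩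
  have hpush : ∀ n, ∀ a ∈ M ^ n, ∃ b ∈ (F '' M) ^ n, IsInduced Z a b := by
    intro n
    induction n with
    | zero =>
      intro a ha
      rw [pow_zero, Set.mem_one] at ha
      exact ⟨1, by simp, ha ▸ IsInduced.one⟩
    | succ n ih =>
      intro a ha
      rw [pow_succ] at ha
      obtain ⟨a₁, ha₁, a₂, ha₂, rfl⟩ := Set.mem_mul.1 ha
      obtain ⟨b₁, hb₁, h₁⟩ := ih a₁ ha₁
      exact ⟨b₁ * F a₂, by rw [pow_succ]; exact Set.mul_mem_mul hb₁ (mem_image_of_mem F ha₂),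
        h₁.mul (hF a₂ ha₂)⟩
  have hdecY : ∀ b ∈ F '' M, ScalarAddCompact θ b := by
    rintro _ ⟨a, ha, rfl⟩
    exact (hF a ha).scalarAddCompact (hdec a ha)
  have hvW : ∀ n, ∀ w ∈ M ^ n, ∀ x, v (w x) ≤ v x := by
    intro n
    induction n with
    | zero =>
      intro w hw x
      rw [pow_zero, Set.mem_one] at hw
      rw [hw]
      rfl
    | succ n ih =>
      intro w hw x
      rw [pow_succ] at hw
      obtain ⟨u, hu, a, ha, rfl⟩ := Set.mem_mul.1 hw
      exact (ih u hu (a x)).trans (hva a ha x)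
  obtain ⟨C, hC⟩ : ∃ C, ∀ n, ∀ w ∈ (F '' M) ^ n, ‖w‖ ≤ C := by
    by_contra! hunb
    obtain ⟨n, w, c, Q, hw, hc0, hc, hQ, hQ0⟩ :=
      exists_tendsto_of_unbounded_words hMY hθ hθ1 hdecY hunb
    refine hQ0 ?_
    ext y
    obtain ⟨x, rfl⟩ := Submodule.Quotient.mk_surjective Z y
    obtain ⟨z, hz⟩ := Submodule.Quotient.mk_surjective Z (Q (Submodule.Quotient.mk x))
    rw [zero_apply, ← hz, Submodule.Quotient.mk_eq_zero, hZ]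
    refine le_antisymm ?_ (apply_nonneg v z)
    have hlim1 : Tendsto (fun k => ‖((c k : ℂ) • w k) (Submodule.Quotient.mk x : X ⧸ Z)
        - Q (Submodule.Quotient.mk x)‖) (hyperfilter ℕ) (𝓝 0) :=
      tendsto_iff_norm_sub_tendsto_zero.1
        (((ContinuousLinearMap.apply ℂ _ (Submodule.Quotient.mk x : X ⧸ Z)).continuous.tendsto
          Q).comp hQ)
    have hlim2 : Tendsto (fun k => c k * v x) (hyperfilter ℕ) (𝓝 (0 * v x)) :=
      hc.mul_const _
    have hlim := hlim1.add hlim2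
    rw [zero_mul, add_zero] at hlim
    refine ge_of_tendsto' hlim fun k => ?_
    obtain ⟨a, ha, hai⟩ := hpull _ _ (hw k)
    have h1 : ((c k : ℂ) • w k) (Submodule.Quotient.mk x : X ⧸ Z)
        - Q (Submodule.Quotient.mk x) = Submodule.Quotient.mk ((c k : ℂ) • a x - z) := by
      rw [smul_apply, hai x, ← hz]
      rfl
    have h2 := hmkle ((c k : ℂ) • a x - z)
    have h3 : v ((c k : ℂ) • a x) ≤ c k * v x := by
      rw [map_smul_eq_mul, Complex.norm_real, Real.norm_of_nonneg (hc0 k)]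
      exact mul_le_mul_of_nonneg_left (hvW _ a ha x) (hc0 k)
    have h4 : v z ≤ v ((c k : ℂ) • a x - z) + v ((c k : ℂ) • a x) := by
      have := map_sub_le_add v ((c k : ℂ) • a x) ((c k : ℂ) • a x - z)
      rw [sub_sub_cancel] at this
      linarith
    rw [h1]
    linarith
  have hx₀' : 0 < ‖x₀‖ := hx₀.trans_le (hv1 x₀)
  refine false_of_bounded_words hMY hθ hθ1 hdecY (fun n b hb => ?_) hC (div_pos hx₀ hx₀')
    fun n => ?_
  · obtain ⟨a, ha, hai⟩ := hpull n b hb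
    exact hai.specLE (by positivity) (hspec n a ha)
  · obtain ⟨w, hw, hvw'⟩ := hvw n x₀
    obtain ⟨b, hb, hbi⟩ := hpush n w hw
    refine ⟨b, hb, ?_⟩
    rw [div_le_iff₀ hx₀']
    calc v x₀ ≤ v (w x₀) := hvw'
      _ ≤ ‖(Submodule.Quotient.mk (w x₀) : X ⧸ Z)‖ := hmkle _
      _ = ‖b (Submodule.Quotient.mk x₀)‖ := by rw [hbi x₀]
      _ ≤ ‖b‖ * ‖(Submodule.Quotient.mk x₀ : X ⧸ Z)‖ := b.le_opNorm _
      _ ≤ ‖b‖ * ‖x₀‖ :=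
        mul_le_mul_of_nonneg_left (Submodule.Quotient.norm_mk_le Z x₀) b.opNorm_nonneg

/-- A quantitative form of the Berger-Wang formula. -/
theorem exists_bound_words_of_specLE {M : Set (X →L[ℂ] X)} (hM : M.Finite)
    (hdec : ∀ a ∈ M, ScalarAddCompact 1 a) (hspec : ∀ n, ∀ w ∈ M ^ n, SpecLE w 1)
    {t : ℝ} (ht : 1 < t) : ∃ C, 0 < C ∧ ∀ n, ∀ w ∈ M ^ n, ‖w‖ ≤ C * t ^ n := by
  set V : Set ℝ := {t | 0 < t ∧ ∃ C, ∀ n, ∀ w ∈ M ^ n, ‖w‖ ≤ C * t ^ n} with hV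
  have hVne : V.Nonempty := by
    obtain ⟨R, hR⟩ := exists_bound_words hM 2
    refine ⟨|R| + 1, by positivity, exists_bound_words_of_norm_le hM one_ne_zero
      (by positivity) fun w hw => ?_⟩
    have h1 := hR 1 one_lt_two w hw
    have h2 := le_abs_self R
    rw [pow_one]
    linarith
  have hVb : BddBelow V := ⟨0, fun t ht => ht.1.le⟩
  have hVup : ∀ t ∈ V, ∀ t' ≥ t, t' ∈ V := by
    rintro t ⟨h0, C, hC⟩ t' htt'
    refine ⟨h0.trans_le htt', |C|, fun n w hw => (hC n w hw).trans ?_⟩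
    exact mul_le_mul (le_abs_self C) (pow_le_pow_left₀ h0.le htt' n) (by positivity)
      (abs_nonneg C)
  have hlt : ∀ t, sInf V < t → t ∈ V := fun t ht => by
    obtain ⟨t', ht', hlt⟩ := exists_lt_of_csInf_lt hVne ht
    exact hVup t' ht' t hlt.le
  rcases le_or_gt (sInf V) 1 with h1 | h1
  · obtain ⟨-, C, hC⟩ := hlt t (h1.trans_lt ht)
    refine ⟨|C| + 1, by positivity, fun n w hw => (hC n w hw).trans ?_⟩
    exact mul_le_mul_of_nonneg_right ((le_abs_self C).trans (by linarith)) (by positivity)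
  exfalso
  set ρ := sInf V with hρ
  have hρ0 : 0 < ρ := one_pos.trans h1
  have hρc : (ρ⁻¹ : ℂ) ≠ 0 := inv_ne_zero (by exact_mod_cast hρ0.ne')
  have hnρ : ∀ n, ‖(ρ⁻¹ : ℂ) ^ n‖ = ρ⁻¹ ^ n := fun n => by
    rw [norm_pow, norm_inv, Complex.norm_real, Real.norm_of_nonneg hρ0.le]
  have hmem : ∀ n, ∀ w ∈ ((ρ⁻¹ : ℂ) • M) ^ n, ∃ u ∈ M ^ n, w = (ρ⁻¹ : ℂ) ^ n • u := by
    intro n w hw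
    rw [smul_pow] at hw
    obtain ⟨u, hu, rfl⟩ := Set.mem_smul_set.1 hw
    exact ⟨u, hu, rfl⟩
  have hρ1 : ρ⁻¹ < 1 := inv_lt_one_of_one_lt₀ h1
  refine false_of_words_ge_one (M := (ρ⁻¹ : ℂ) • M) (θ := ρ⁻¹) hM.smul_set (by positivity) hρ1
    ?_ ?_ ?_ ?_
  · intro a ha
    obtain ⟨b, hb, rfl⟩ := Set.mem_smul_set.1 ha
    obtain ⟨c, hc, hK⟩ := hdec b hb
    refine ⟨(ρ⁻¹ : ℂ) * c, ?_, ?_⟩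
    · have := hnρ 1
      rw [pow_one, pow_one] at this
      rw [norm_mul, this]
      exact mul_le_of_le_one_right (by positivity) hc
    · have e : (ρ⁻¹ : ℂ) • b - ((ρ⁻¹ : ℂ) * c) • (1 : X →L[ℂ] X) = (ρ⁻¹ : ℂ) • (b - c • 1) := by
        rw [smul_sub, smul_smul]
      rw [e]
      exact hK.smul (ρ⁻¹ : ℂ)
  · intro n w hw
    obtain ⟨u, hu, rfl⟩ := hmem n w hw
    have := (hspec n u hu).smul ((ρ⁻¹ : ℂ) ^ n)
    rwa [hnρ, mul_one] at this
  · intro s hs0 hs1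
    obtain ⟨-, C, hC⟩ := hlt (ρ / s) (by rw [lt_div_iff₀ hs0]; nlinarith)
    refine ⟨C, fun n w hw => ?_⟩
    obtain ⟨u, hu, rfl⟩ := hmem n w hw
    have := hC n u hu
    rw [norm_smul, hnρ, inv_pow]
    rw [div_pow, ← mul_div_assoc, le_div_iff₀ (by positivity)] at this
    rw [← mul_assoc, mul_comm, ← mul_assoc, ← div_eq_mul_inv, div_le_iff₀ (by positivity)]
    exact this
  · intro n
    by_contra! hsm
    rcases eq_or_ne n 0 with rfl | hn
    · have h2 := hsm 1 (by simp)
      have h3 : ‖(1 : X →L[ℂ] X) * 1‖ ≤ ‖(1 : X →L[ℂ] X)‖ * ‖(1 : X →L[ℂ] X)‖ := norm_mul_le _ _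
      rw [mul_one] at h3
      have h4 : ‖(1 : X →L[ℂ] X)‖ = 0 := by
        nlinarith [norm_nonneg (1 : X →L[ℂ] X)]
      have h5 : ∀ w : X →L[ℂ] X, ‖w‖ = 0 := fun w => by
        have := norm_mul_le w 1
        rw [mul_one, h4, mul_zero] at this
        exact le_antisymm this (norm_nonneg _)
      have h6 : (1 / 2 : ℝ) ∈ V := ⟨by norm_num, 0, fun n w _ => by rw [h5 w, zero_mul]⟩
      have := csInf_le hVb h6
      linarith
    have hfin := finite_pow (hM.smul_set (a := (ρ⁻¹ : ℂ))) n
    obtain ⟨q, hq0, hq1, hq⟩ : ∃ q : ℝ, 0 < q ∧ q < 1 ∧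
        ∀ w ∈ ((ρ⁻¹ : ℂ) • M) ^ n, ‖w‖ ≤ q ^ n := by
      have h2 : ∀ᶠ q in 𝓝[<] (1 : ℝ), ∀ w ∈ ((ρ⁻¹ : ℂ) • M) ^ n, ‖w‖ ≤ q ^ n := by
        refine (eventually_all_finite hfin).2 fun w hw => ?_
        have h3 : Tendsto (fun q : ℝ => q ^ n) (𝓝[<] 1) (𝓝 (1 ^ n)) :=
          ((continuous_pow n).tendsto 1).mono_left nhdsWithin_le_nhds
        rw [one_pow] at h3
        exact h3.eventually_const_le (hsm w hw)
      obtain ⟨q, ⟨hq, hq'⟩, hq''⟩ := ((h2.and (eventually_nhdsWithin_of_eventually_nhds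
        (lt_mem_nhds (zero_lt_one (α := ℝ))))).and self_mem_nhdsWithin).exists
      exact ⟨q, hq', hq'', hq⟩
    obtain ⟨C, hC⟩ := exists_bound_words_of_norm_le hM hn (q := ρ * q) (by positivity)
      fun u hu => by
        have h3 : (ρ⁻¹ : ℂ) ^ n • u ∈ ((ρ⁻¹ : ℂ) • M) ^ n := by
          rw [smul_pow]
          exact Set.smul_mem_smul_set hu
        have h4 := hq _ h3
        rw [norm_smul, hnρ, inv_pow, inv_mul_le_iff₀ (by positivity)] at h4
        rw [mul_pow]
        exact h4
    have h5 : ρ * q ∈ V := ⟨by positivity, C, hC⟩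
    have := csInf_le hVb h5
    nlinarith

end BergerWang

section Exponential

open NormedSpace

variable {𝔸 : Type*} [NormedRing 𝔸] [NormedAlgebra ℂ 𝔸] [CompleteSpace 𝔸]

theorem norm_exp_sub_one_sub_self_le (a : 𝔸) :
    ‖exp a - 1 - a‖ ≤ Real.exp ‖a‖ - 1 - ‖a‖ := by
  have h1 := (hasSum_nat_add_iff' 2).2 (exp_series_hasSum_exp' (𝕂 := ℂ) a)
  have h2 := (hasSum_nat_add_iff' 2).2 (exp_series_hasSum_exp' (𝕂 := ℝ) ‖a‖)
  simp only [Finset.sum_range_succ, Finset.sum_range_zero, Nat.factorial_zero, Nat.cast_one,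
    inv_one, pow_zero, one_smul, zero_add, Nat.factorial_one, pow_one, ← sub_sub,
    ← Real.exp_eq_exp_ℝ] at h1 h2
  rw [← h1.tsum_eq]
  refine tsum_of_norm_bounded h2 fun n => ?_
  rw [norm_smul, norm_inv, Complex.norm_natCast, smul_eq_mul]
  exact mul_le_mul_of_nonneg_left (norm_pow_le' a (by omega)) (by positivity)

theorem norm_exp_sub_one_le_exp_norm (a : 𝔸) : ‖exp a - 1‖ ≤ Real.exp ‖a‖ - 1 := by
  have := norm_add_le (exp a - 1 - a) a
  rw [sub_add_cancel] at this
  linarith [norm_exp_sub_one_sub_self_le a]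

theorem norm_exp_mul_le (a b : 𝔸) : ‖exp a * b‖ ≤ Real.exp ‖a‖ * ‖b‖ := by
  have h := norm_add_le ((exp a - 1) * b) b
  rw [sub_mul, one_mul, sub_add_cancel, ← one_mul b, ← mul_assoc, mul_one, ← sub_mul] at h
  rw [one_mul] at h
  nlinarith [norm_mul_le (exp a - 1) b,
    mul_le_mul_of_nonneg_right (norm_exp_sub_one_le_exp_norm a) (norm_nonneg b)]

theorem norm_mul_exp_le (a b : 𝔸) : ‖b * exp a‖ ≤ ‖b‖ * Real.exp ‖a‖ := by
  have h := norm_add_le (b * (exp a - 1)) b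
  rw [show b * (exp a - 1) + b = b * exp a by rw [mul_sub, mul_one, sub_add_cancel]] at h
  nlinarith [norm_mul_le b (exp a - 1),
    mul_le_mul_of_nonneg_left (norm_exp_sub_one_le_exp_norm a) (norm_nonneg b)]

variable {Y : Type*} [NormedAddCommGroup Y] [NormedSpace ℂ Y] [CompleteSpace Y]

theorem hasSum_exp_apply (D : Y →L[ℂ] Y) (y : Y) : HasSum (fun n => ((n.factorial : ℂ)⁻¹) • (D ^ n) y) (exp D y) := by
  simpa using (exp_series_hasSum_exp' (𝕂 := ℂ) D).mapL (ContinuousLinearMap.apply ℂ Y y)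

theorem exp_inner_mul_exp (ι : Y →L[ℂ] 𝔸) {D : Y →L[ℂ] Y} {c : 𝔸}
    (hD : ∀ y, ι (D y) = c * ι y - ι y * c) (y : Y) :
    ι (exp D y) * exp c = exp c * ι y := by
  let +nondep : NormedAlgebra ℚ (𝔸 →L[ℂ] 𝔸) := .restrictScalars ℚ ℂ _
  set E : 𝔸 →L[ℂ] 𝔸 := ContinuousLinearMap.mul ℂ 𝔸 c - (ContinuousLinearMap.mul ℂ 𝔸).flip c with hE
  set R : 𝔸 →L[ℂ] 𝔸 := (ContinuousLinearMap.mul ℂ 𝔸).flip c with hR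
  have hLpow : ∀ n y, (ContinuousLinearMap.mul ℂ 𝔸 c ^ n) y = c ^ n * y := fun n => by
    induction n with
    | zero => intro y; simp
    | succ n ih => intro y; rw [pow_succ, mul_apply_eq_comp, ih, pow_succ, mul_assoc]; rfl
  have hRpow : ∀ n y, (R ^ n) y = y * c ^ n := fun n => by
    induction n with
    | zero => intro y; simp
    | succ n ih => intro y; rw [pow_succ, mul_apply_eq_comp, ih, pow_succ', ← mul_assoc]; rfl
  have hL : ∀ y, exp (ContinuousLinearMap.mul ℂ 𝔸 c) y = exp c * y := fun y => by
    refine (hasSum_exp_apply _ y).unique ?_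
    simpa [hLpow] using (exp_series_hasSum_exp' (𝕂 := ℂ) c).mul_right y
  have hRe : ∀ y, exp R y = y * exp c := fun y => by
    refine (hasSum_exp_apply _ y).unique ?_
    simpa [hRpow] using (exp_series_hasSum_exp' (𝕂 := ℂ) c).mul_left y
  have hcomm : Commute R E := by
    ext y
    change (c * y - y * c) * c = c * (y * c) - y * c * c
    noncomm_ring
  have hpow : ∀ n y, ι ((D ^ n) y) = (E ^ n) (ι y) := fun n => by
    induction n with
    | zero => intro y; simp
    | succ n ih => intro y; rw [pow_succ, mul_apply_eq_comp, ih, hD, pow_succ, mul_apply_eq_comp]; rfl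
  have hx : ι (exp D y) = exp E (ι y) := by
    refine HasSum.unique ?_ (hasSum_exp_apply _ _)
    simpa only [map_smul, hpow] using (hasSum_exp_apply D y).mapL ι
  rw [hx, ← hRe, ← mul_apply_eq_comp, ← exp_add_of_commute hcomm, ← hL]
  congr 2
  rw [hE]
  abel

theorem exists_integral_exp_apply_eq {D : Y →L[ℂ] Y} (hD : ‖D‖ ≤ 1 / 4) (y : Y) :
    ∃ x, ‖x‖ ≤ 2 * ‖y‖ ∧ ∫ s in (0 : ℝ)..1, exp (s • D) x = y := by
  let +nondep : NormedAlgebra ℚ (Y →L[ℂ] Y) := .restrictScalars ℚ ℂ _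
  have hcont : Continuous fun s : ℝ => exp (s • D) := exp_continuous.comp (by fun_prop)
  set Θ : Y →L[ℂ] Y := ∫ s in (0 : ℝ)..1, exp (s • D) with hΘ
  have hΘ1 : ‖1 - Θ‖ ≤ 1 / 2 := by
    have h1 : 1 - Θ = -∫ s in (0 : ℝ)..1, (exp (s • D) - 1) := by
      rw [intervalIntegral.integral_sub (hcont.intervalIntegrable _ _)
        (continuous_const.intervalIntegrable _ _)]
      simp [hΘ]
    rw [h1, norm_neg]
    refine (intervalIntegral.norm_integral_le_of_norm_le_const (C := 1 / 2) fun s hs => ?_).trans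
      (by norm_num)
    rw [uIoc_of_le zero_le_one] at hs
    refine (norm_exp_sub_one_le_exp_norm _).trans ?_
    have h2 : ‖s • D‖ ≤ 1 / 4 := by
      rw [norm_smul, Real.norm_of_nonneg hs.1.le]
      nlinarith [norm_nonneg D, hs.1, hs.2]
    have h3 := Real.abs_exp_sub_one_le (x := ‖s • D‖) (by rw [abs_norm]; linarith)
    rw [abs_norm] at h3
    linarith [le_abs_self (Real.exp ‖s • D‖ - 1)]
  obtain ⟨u, hu⟩ : IsUnit Θ := by
    have := isUnit_one_sub_of_norm_lt_one (x := 1 - Θ) (by linarith)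
    rwa [sub_sub_cancel] at this
  have hx : Θ ((↑u⁻¹ : Y →L[ℂ] Y) y) = y := by
    rw [← hu, ← mul_apply_eq_comp, Units.mul_inv, one_apply_eq_self]
  refine ⟨(↑u⁻¹ : Y →L[ℂ] Y) y, ?_, ?_⟩
  · set x := (↑u⁻¹ : Y →L[ℂ] Y) y
    have h1 := norm_add_le (Θ x) ((1 - Θ) x)
    rw [← add_apply, add_sub_cancel, one_apply_eq_self, hx] at h1
    have h2 := (1 - Θ).le_opNorm x
    nlinarith [norm_nonneg x]
  · have h := ContinuousLinearMap.intervalIntegral_apply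
      (hcont.intervalIntegrable (μ := MeasureTheory.volume) 0 1) ((↑u⁻¹ : Y →L[ℂ] Y) y)
    rw [← hΘ, hx] at h
    exact h.symm

theorem norm_exp_add_sub_exp_mul_exp_le (ι : Y →ₗᵢ[ℂ] 𝔸) {D : Y →L[ℂ] Y} {c : 𝔸}
    (hD : ∀ y, ι (D y) = c * ι y - ι y * c) (hc : ‖c‖ ≤ 1) {x y : Y} (hx : ‖x‖ ≤ 2)
    (hxy : ∫ s in (0 : ℝ)..1, exp (s • D) x = y) (hy : ‖y‖ ≤ 1) :
    ‖exp (c + ι x) - exp (ι y) * exp c‖ ≤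
      Real.exp 1 * (Real.exp 6 * ‖x‖ ^ 2 + ‖y‖ ^ 2) := by
  let +nondep : NormedAlgebra ℚ 𝔸 := .restrictScalars ℚ ℂ _
  have hexp : ∀ s ∈ Icc (0 : ℝ) 1, ∀ (a b : 𝔸) (r : ℝ), ‖a‖ ≤ r →
      ‖exp (s • a) * b‖ ≤ Real.exp r * ‖b‖ := fun s hs a b r hr => by
    refine (norm_exp_mul_le _ _).trans (mul_le_mul_of_nonneg_right (Real.exp_le_exp.2 ?_)
      (norm_nonneg _))
    rw [norm_smul, Real.norm_of_nonneg hs.1]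
    nlinarith [norm_nonneg a, hs.2]
  have hexp' : ∀ s ∈ Icc (0 : ℝ) 1, ∀ (b : 𝔸), ‖b * exp (-(s • c))‖ ≤ ‖b‖ * Real.exp 1 :=
    fun s hs b => by
    refine (norm_mul_exp_le _ _).trans (mul_le_mul_of_nonneg_left (Real.exp_le_exp.2 ?_)
      (norm_nonneg _))
    rw [norm_neg, norm_smul, Real.norm_of_nonneg hs.1]
    nlinarith [norm_nonneg c, hs.2]
  have hinv : ∀ s : ℝ, exp (-(s • c)) * exp (s • c) = 1 := fun s => by
    rw [← exp_add_of_commute (Commute.neg_left (Commute.refl _)), neg_add_cancel, exp_zero]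
  have hinv' : ∀ s : ℝ, exp (s • c) * exp (-(s • c)) = 1 := fun s => by
    rw [← exp_add_of_commute (Commute.neg_right (Commute.refl _)), add_neg_cancel, exp_zero]
  have hcx : ‖c + ι x‖ ≤ 3 := (norm_add_le _ _).trans (by rw [ι.norm_map]; linarith)
  set h : ℝ → 𝔸 := fun s => exp (s • (c + ι x)) * exp (-(s • c)) with hh
  have hder : ∀ s, HasDerivAt h (exp (s • (c + ι x)) * ι x * exp (-(s • c))) s := fun s => by
    have h1 := (hasDerivAt_exp_smul_const (𝕂 := ℝ) (c + ι x) s).mul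
      (hasDerivAt_exp_smul_const' (𝕂 := ℝ) (-c) s)
    simp only [smul_neg] at h1
    exact h1.congr_deriv (by noncomm_ring)
  have hbd : ∀ s ∈ Icc (0 : ℝ) 1,
      ‖exp (s • (c + ι x)) * ι x * exp (-(s • c))‖ ≤ Real.exp 4 * ‖x‖ := fun s hs => by
    refine (hexp' s hs _).trans ?_
    have := hexp s hs (c + ι x) (ι x) 3 hcx
    rw [ι.norm_map] at this
    calc _ ≤ Real.exp 3 * ‖x‖ * Real.exp 1 :=
          mul_le_mul_of_nonneg_right this (Real.exp_pos _).le
      _ = Real.exp (3 + 1) * ‖x‖ := by rw [Real.exp_add]; ring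
      _ = _ := by norm_num
  have hh0 : h 0 = 1 := by simp [hh]
  have hh1 : ∀ s ∈ Icc (0 : ℝ) 1, ‖h s - 1‖ ≤ Real.exp 4 * ‖x‖ := fun s hs => by
    have := norm_image_sub_le_of_norm_deriv_le_segment' (a := 0) (b := 1)
      (fun t _ => (hder t).hasDerivWithinAt) (fun t ht => hbd t (Ico_subset_Icc_self ht)) s hs
    rw [hh0, sub_zero] at this
    refine this.trans (mul_le_of_le_one_right (by positivity) hs.2)
  have hu : ∀ s : ℝ, ι (exp (s • D) x) = exp (s • c) * ι x * exp (-(s • c)) := fun s => by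
    have hsm : ∀ y, ι (s • y) = s • ι y := fun y => by
      rw [← Complex.coe_smul, ι.map_smul, Complex.coe_smul]
    have := exp_inner_mul_exp ι.toContinuousLinearMap (D := s • D) (c := s • c) (fun y => by
      change ι (s • D y) = s • c * ι y - ι y * s • c
      rw [hsm, hD, smul_sub, smul_mul_assoc, mul_smul_comm]) x
    rw [← mul_one (ι (exp (s • D) x)), ← hinv' s, ← mul_assoc]
    exact congrArg (· * _) this
  have hcont : Continuous fun s : ℝ => exp (s • D) x := by
    let +nondep : NormedAlgebra ℚ (Y →L[ℂ] Y) := .restrictScalars ℚ ℂ _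
    exact (ContinuousLinearMap.apply ℂ Y x).continuous.comp (exp_continuous.comp (by fun_prop))
  have hw : ∀ s, HasDerivAt (fun s => ι (∫ r in (0 : ℝ)..s, exp (r • D) x)) (ι (exp (s • D) x)) s :=
    fun s => (ι.toContinuousLinearMap.restrictScalars ℝ).hasFDerivAt.comp_hasDerivAt s
      (hcont.integral_hasStrictDerivAt 0 s).hasDerivAt
  have hg := norm_image_sub_le_of_norm_deriv_le_segment_01' (C := Real.exp 6 * ‖x‖ ^ 2)
    (fun s _ => ((hder s).sub (hw s)).hasDerivWithinAt) fun s hs => by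
      have hs' := Ico_subset_Icc_self hs
      have h1 : exp (s • (c + ι x)) * ι x * exp (-(s • c)) - ι (exp (s • D) x) =
          (h s - 1) * (exp (s • c) * ι x * exp (-(s • c))) := by
        rw [hu, sub_mul, one_mul, hh]
        simp only [mul_assoc]
        rw [← mul_assoc (exp (-(s • c))) (exp (s • c)), hinv, one_mul]
      rw [h1]
      have h2 : ‖exp (s • c) * ι x * exp (-(s • c))‖ ≤ Real.exp 2 * ‖x‖ := by
        refine (hexp' s hs' _).trans ?_
        have := hexp s hs' c (ι x) 1 hc
        rw [ι.norm_map] at this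
        calc _ ≤ Real.exp 1 * ‖x‖ * Real.exp 1 :=
              mul_le_mul_of_nonneg_right this (Real.exp_pos _).le
          _ = Real.exp (1 + 1) * ‖x‖ := by rw [Real.exp_add]; ring
          _ = _ := by norm_num
      calc _ ≤ ‖h s - 1‖ * ‖exp (s • c) * ι x * exp (-(s • c))‖ := norm_mul_le _ _
        _ ≤ Real.exp 4 * ‖x‖ * (Real.exp 2 * ‖x‖) :=
          mul_le_mul (hh1 s hs') h2 (norm_nonneg _) (by positivity)
        _ = Real.exp (4 + 2) * ‖x‖ ^ 2 := by rw [Real.exp_add]; ring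
        _ = _ := by norm_num
  have h0 : (h - fun s => ι (∫ r in (0 : ℝ)..s, exp (r • D) x)) 0 = 1 := by
    simp [hh0]
  have h1 : (h - fun s => ι (∫ r in (0 : ℝ)..s, exp (r • D) x)) 1 = h 1 - ι y := by
    simp [hxy]
  rw [h0, h1] at hg
  have hy2 : ‖exp (ι y) - 1 - ι y‖ ≤ ‖y‖ ^ 2 := by
    refine (norm_exp_sub_one_sub_self_le _).trans ?_
    have := Real.norm_exp_sub_one_sub_id_le (x := ‖ι y‖) (by rw [norm_norm, ι.norm_map]; exact hy)
    rw [norm_norm, ι.norm_map] at this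
    rw [ι.norm_map]
    exact (le_abs_self _).trans this
  have key : exp (c + ι x) - exp (ι y) * exp c =
      (h 1 - ι y - 1 - (exp (ι y) - 1 - ι y)) * exp c := by
    have : h 1 * exp c = exp (c + ι x) := by
      have h3 := hinv 1
      rw [one_smul] at h3
      simp only [hh, one_smul]
      rw [mul_assoc, h3, mul_one]
    rw [← this]
    noncomm_ring
  rw [key]
  refine (norm_mul_exp_le _ _).trans ?_
  rw [mul_comm]
  refine mul_le_mul (Real.exp_le_exp.2 hc) ((norm_sub_le _ _).trans (add_le_add hg hy2))
    (norm_nonneg _) (Real.exp_pos _).le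

end Exponential

section LocalProducts

open NormedSpace

variable {𝔸 : Type*} [NormedRing 𝔸] [NormedAlgebra ℂ 𝔸]
  {Y : Type*} [NormedAddCommGroup Y] [NormedSpace ℂ Y]

theorem exists_inner_derivation (ι : Y →ₗᵢ[ℂ] 𝔸) {b : 𝔸}
    (hι : ∀ y, ∃ w, ι w = b * ι y - ι y * b) :
    ∃ D : Y →L[ℂ] Y, ‖D‖ ≤ 2 * ‖b‖ ∧ ∀ y, ι (D y) = b * ι y - ι y * b := by
  choose f hf using hι
  refine ⟨LinearMap.mkContinuous
    { toFun := f
      map_add' := fun y z => ι.injective ?_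
      map_smul' := fun k y => ι.injective ?_ } (2 * ‖b‖) fun y => ?_,
    LinearMap.mkContinuous_norm_le _ (by positivity) _, hf⟩
  · rw [hf, map_add, map_add, hf, hf]
    noncomm_ring
  · rw [hf, map_smul, RingHom.id_apply, map_smul, hf, mul_smul_comm, smul_mul_assoc, smul_sub]
  · change ‖f y‖ ≤ _
    rw [← ι.norm_map, hf]
    refine (norm_sub_le _ _).trans ?_
    have h1 := norm_mul_le b (ι y)
    have h2 := norm_mul_le (ι y) b
    rw [ι.norm_map] at h1 h2
    linarith

variable [CompleteSpace 𝔸] [CompleteSpace Y]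

theorem exists_norm_exp_add_sub_exp_mul_exp_le (ι : Y →ₗᵢ[ℂ] 𝔸)
    (hι : ∀ y z, ∃ w, ι w = ι y * ι z - ι z * ι y) {c y : Y} (hc : ‖c‖ ≤ 1 / 8) (hy : ‖y‖ ≤ 1) :
    ∃ c', ‖c'‖ ≤ ‖c‖ + 2 * ‖y‖ ∧ ‖exp (ι c') - exp (ι y) * exp (ι c)‖ ≤
      Real.exp 1 * (4 * Real.exp 6 + 1) * ‖y‖ ^ 2 := by
  obtain ⟨D, hD, hD'⟩ := exists_inner_derivation ι (hι c)
  rw [ι.norm_map] at hD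
  obtain ⟨x, hx, hxy⟩ := exists_integral_exp_apply_eq (D := D) (by linarith) y
  refine ⟨c + x, (norm_add_le _ _).trans (by linarith), ?_⟩
  have := norm_exp_add_sub_exp_mul_exp_le ι hD' (by rw [ι.norm_map]; linarith)
    (by linarith) hxy hy
  rw [map_add]
  refine this.trans ?_
  have h1 : ‖x‖ ^ 2 ≤ (2 * ‖y‖) ^ 2 := by gcongr
  have h2 := Real.exp_pos 6
  have h3 : Real.exp 6 * ‖x‖ ^ 2 ≤ Real.exp 6 * (2 * ‖y‖) ^ 2 := by gcongr
  rw [mul_assoc]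
  gcongr
  linarith

theorem exists_norm_exp_sub_exp_nsmul_mul_exp_le (ι : Y →ₗᵢ[ℂ] 𝔸)
    (hι : ∀ y z, ∃ w, ι w = ι y * ι z - ι z * ι y) {c y : Y} (k : ℕ)
    (hk : ‖c‖ + 2 * k * ‖y‖ ≤ 1 / 8) :
    ∃ c', ‖c'‖ ≤ ‖c‖ + 2 * k * ‖y‖ ∧ ‖exp (ι c') - exp (k • ι y) * exp (ι c)‖ ≤
      k * Real.exp (k * ‖y‖) * (Real.exp 1 * (4 * Real.exp 6 + 1) * ‖y‖ ^ 2) := by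
  let +nondep : NormedAlgebra ℚ 𝔸 := .restrictScalars ℚ ℂ _
  induction k with
  | zero => exact ⟨c, by simp, by simp⟩
  | succ k ih =>
    push_cast at hk
    have hy := norm_nonneg y
    have hc := norm_nonneg c
    have hky : 0 ≤ k * ‖y‖ := by positivity
    obtain ⟨c₁, h1, h2⟩ := ih (by linarith)
    obtain ⟨c₂, h3, h4⟩ := exists_norm_exp_add_sub_exp_mul_exp_le ι hι (c := c₁) (y := y)
      (by linarith) (by linarith)
    refine ⟨c₂, by push_cast; linarith, ?_⟩
    have hs : exp ((k + 1) • ι y) = exp (ι y) * exp (k • ι y) := by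
      rw [← exp_add_of_commute ((Commute.refl (ι y)).smul_right k), succ_nsmul']
    have key : exp (ι c₂) - exp ((k + 1) • ι y) * exp (ι c) =
        (exp (ι c₂) - exp (ι y) * exp (ι c₁)) +
          exp (ι y) * (exp (ι c₁) - exp (k • ι y) * exp (ι c)) := by
      rw [hs]
      noncomm_ring
    set K := Real.exp 1 * (4 * Real.exp 6 + 1) * ‖y‖ ^ 2 with hK
    have hK0 : 0 ≤ K := by positivity
    have h5 := (norm_exp_mul_le (ι y) (exp (ι c₁) - exp (k • ι y) * exp (ι c))).trans
      (mul_le_mul_of_nonneg_left h2 (Real.exp_pos _).le)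
    rw [ι.norm_map] at h5
    rw [key]
    refine (norm_add_le _ _).trans ((add_le_add h4 h5).trans ?_)
    have h6 : Real.exp ((↑(k + 1) : ℝ) * ‖y‖) = Real.exp ‖y‖ * Real.exp (k * ‖y‖) := by
      rw [← Real.exp_add]
      push_cast
      ring_nf
    rw [h6]
    have h7 : 1 ≤ Real.exp ‖y‖ * Real.exp (k * ‖y‖) := by
      rw [← Real.exp_add]
      exact Real.one_le_exp (by positivity)
    push_cast
    nlinarith

theorem exp_mul_exp_mem_closure (ι : Y →ₗᵢ[ℂ] 𝔸)
    (hι : ∀ y z, ∃ w, ι w = ι y * ι z - ι z * ι y) {c y : Y} {r : ℝ}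
    (h : ‖c‖ + 2 * ‖y‖ ≤ r) (hr : r ≤ 1 / 8) :
    exp (ι y) * exp (ι c) ∈ closure {w | ∃ c', ‖c'‖ ≤ r ∧ exp (ι c') = w} := by
  have hN : ∀ N : ℕ, ∃ c', ‖c'‖ ≤ r ∧ ‖exp (ι c') - exp (ι y) * exp (ι c)‖ ≤
      Real.exp ‖y‖ * (Real.exp 1 * (4 * Real.exp 6 + 1) * ‖y‖ ^ 2) * (1 / ((N : ℝ) + 1)) := by
    intro N
    have hN0 : ((N : ℝ) + 1) ≠ 0 := by positivity
    have hnorm : (↑(N + 1) : ℝ) * ‖((N + 1 : ℂ)⁻¹) • y‖ = ‖y‖ := by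
      have h1 : ‖(N + 1 : ℂ)‖ = (N : ℝ) + 1 := by
        have := Complex.norm_natCast (N + 1)
        push_cast at this
        exact this
      rw [norm_smul, norm_inv, h1]
      push_cast
      field_simp
    obtain ⟨c', h1, h2⟩ := exists_norm_exp_sub_exp_nsmul_mul_exp_le ι hι (c := c)
      (y := ((N + 1 : ℂ)⁻¹) • y) (N + 1) (by rw [mul_assoc, hnorm]; linarith)
    have hsm : (N + 1) • ι (((N + 1 : ℂ)⁻¹) • y) = ι y := by
      rw [← Nat.cast_smul_eq_nsmul ℂ, ← map_smul, smul_smul]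
      push_cast
      rw [mul_inv_cancel₀ (by exact_mod_cast Nat.succ_ne_zero N), one_smul]
    rw [mul_assoc, hnorm] at h1
    rw [hsm, hnorm] at h2
    refine ⟨c', h1.trans h, h2.trans (le_of_eq ?_)⟩
    have h3 : ‖((N + 1 : ℂ)⁻¹) • y‖ = ‖y‖ / (N + 1) := by
      rw [eq_div_iff hN0, mul_comm]
      exact_mod_cast hnorm
    rw [h3]
    push_cast
    field_simp
  choose c' h1 h2 using hN
  refine mem_closure_of_tendsto (f := fun N => exp (ι (c' N))) (b := atTop) ?_
    (Eventually.of_forall fun N => ⟨c' N, h1 N, rfl⟩)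
  rw [tendsto_iff_norm_sub_tendsto_zero]
  refine squeeze_zero (fun _ => norm_nonneg _) h2 ?_
  simpa using (tendsto_one_div_add_atTop_nhds_zero_nat (𝕜 := ℝ)).const_mul
    (Real.exp ‖y‖ * (Real.exp 1 * (4 * Real.exp 6 + 1) * ‖y‖ ^ 2))

theorem prod_exp_mem_closure (ι : Y →ₗᵢ[ℂ] 𝔸)
    (hι : ∀ y z, ∃ w, ι w = ι y * ι z - ι z * ι y) (l : List Y)
    (hl : 2 * (l.map norm).sum ≤ 1 / 8) :
    (l.map fun y => exp (ι y)).prod ∈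
      closure {w | ∃ c', ‖c'‖ ≤ 2 * (l.map norm).sum ∧ exp (ι c') = w} := by
  induction l with
  | nil => exact subset_closure ⟨0, by simp, by simp⟩
  | cons y l ih =>
    rw [List.map_cons, List.sum_cons] at hl
    simp only [List.map_cons, List.sum_cons, List.prod_cons]
    have hm : Continuous fun w : 𝔸 => exp (ι y) * w := continuous_const.mul continuous_id
    refine closure_minimal ?_ isClosed_closure
      (map_mem_closure hm (ih (by linarith [norm_nonneg y])) (mapsTo_image _ _))
    rintro _ ⟨_, ⟨c, hc, rfl⟩, rfl⟩
    exact exp_mul_exp_mem_closure ι hι (by linarith) hl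

end LocalProducts

section ExpProducts

open NormedSpace

variable {𝔸 : Type*} [NormedRing 𝔸] [NormedAlgebra ℂ 𝔸] [CompleteSpace 𝔸]

theorem exists_exp_sub_one_eq_mul (a : 𝔸) : ∃ h : 𝔸, exp a - 1 = a * h ∧ Commute a h := by
  have hs : Summable fun n : ℕ => (((n + 1).factorial : ℂ)⁻¹) • a ^ n := by
    refine Summable.of_norm_bounded (norm_expSeries_summable' (𝕂 := ℂ) a) fun n => ?_
    rw [norm_smul, norm_smul, norm_inv, norm_inv, Complex.norm_natCast, Complex.norm_natCast]
    gcongr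
    omega
  refine ⟨∑' n : ℕ, (((n + 1).factorial : ℂ)⁻¹) • a ^ n, ?_, ?_⟩
  · have h1 := (hasSum_nat_add_iff' 1).2 (exp_series_hasSum_exp' (𝕂 := ℂ) a)
    simp only [Finset.sum_range_one, Nat.factorial_zero, Nat.cast_one, inv_one, pow_zero,
      one_smul] at h1
    rw [← h1.tsum_eq, ← hs.tsum_mul_left]
    simp only [mul_smul_comm, pow_succ']
  · exact Commute.tsum_right a fun n => ((Commute.refl a).pow_right n).smul_right _

theorem SpecLE.mul_of_commute {a h : 𝔸} (ha : SpecLE a 0) (hc : Commute a h) :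
    SpecLE (a * h) 0 := by
  refine SpecLE.of_forall_gt fun d hd => ?_
  have hd' : 0 < d / (‖h‖ + 1) := by positivity
  obtain ⟨C, hC, hn⟩ := ha.exists_norm_pow_le le_rfl hd'
  refine specLE_of_norm_pow_le (C := C * (1 + ‖(1 : 𝔸)‖)) hd.le fun n => ?_
  rw [hc.mul_pow]
  have h1 : ‖h ^ n‖ ≤ (1 + ‖(1 : 𝔸)‖) * (‖h‖ + 1) ^ n := by
    rcases Nat.eq_zero_or_pos n with rfl | hn0
    · simp
    · calc ‖h ^ n‖ ≤ ‖h‖ ^ n := norm_pow_le' _ hn0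
        _ ≤ (‖h‖ + 1) ^ n := by gcongr; linarith
        _ ≤ _ := le_mul_of_one_le_left (by positivity) (by linarith [norm_nonneg (1 : 𝔸)])
  calc _ ≤ ‖a ^ n‖ * ‖h ^ n‖ := norm_mul_le _ _
    _ ≤ C * (d / (‖h‖ + 1)) ^ n * ((1 + ‖(1 : 𝔸)‖) * (‖h‖ + 1) ^ n) :=
      mul_le_mul (hn n) h1 (norm_nonneg _) (by positivity)
    _ = _ := by
      rw [div_pow]
      field_simp

theorem SpecLE.exp_sub_one {a : 𝔸} (ha : SpecLE a 0) : SpecLE (exp a - 1) 0 := by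
  obtain ⟨h, h1, h2⟩ := exists_exp_sub_one_eq_mul a
  exact h1 ▸ ha.mul_of_commute h2

theorem specLE_norm (a : 𝔸) : SpecLE a ‖a‖ :=
  specLE_of_norm_pow_le_pow (norm_nonneg _) one_ne_zero (by simp)

theorem differentiable_prod_exp_smul (l : List 𝔸) :
    Differentiable ℂ fun z : ℂ => (l.map fun a => exp (z • a)).prod := by
  induction l with
  | nil => simp
  | cons a l ih =>
    simp only [List.map_cons, List.prod_cons]
    exact Differentiable.mul (fun z => (hasDerivAt_exp_smul_const (𝕂 := ℂ) a z).differentiableAt) ih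

/-- An entire function whose values near the origin are quasinilpotent has only quasinilpotent
values. -/
theorem specLE_zero_of_entire {f : ℂ → 𝔸} (hf : Differentiable ℂ f) {δ : ℝ} (hδ : 0 < δ)
    (h : ∀ z, ‖z‖ ≤ δ → SpecLE (f z) 0) (z : ℂ) : SpecLE (f z) 0 := by
  rcases le_or_gt ‖z‖ δ with hz | hz
  · exact h z hz
  have hz0 : 0 < ‖z‖ := hδ.trans hz
  set R := 2 * ‖z‖ with hR
  obtain ⟨C, hC⟩ := (isCompact_sphere (0 : ℂ) R).exists_bound_of_continuousOn
    hf.continuous.continuousOn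
  have hC' : 0 ≤ max C 0 := le_max_right _ _
  have key : ∀ N : ℕ, SpecLE (f z) (max C 0 * (1 / 2) ^ N) := fun N => by
    set U : Set ℂ := ball 0 R \ closedBall 0 δ with hU
    have hUo : IsOpen U := isOpen_ball.sdiff isClosed_closedBall
    have hfr : ∀ ζ ∈ closure U, δ ≤ ‖ζ‖ ∧ ‖ζ‖ ≤ R := by
      have : closure U ⊆ {ζ | δ ≤ ‖ζ‖ ∧ ‖ζ‖ ≤ R} := by
        refine closure_minimal (fun ζ hζ => ?_) ((isClosed_le continuous_const continuous_norm).inter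
          (isClosed_le continuous_norm continuous_const))
        simp only [hU, Set.mem_sdiff, mem_ball_zero_iff, mem_closedBall_zero_iff, not_le] at hζ
        exact ⟨hζ.2.le, hζ.1.le⟩
      exact this
    have hg : DiffContOnCl ℂ (fun ζ : ℂ => (ζ ^ N)⁻¹ • f ζ) U := by
      refine DifferentiableOn.diffContOnCl fun ζ hζ => DifferentiableAt.differentiableWithinAt ?_
      have hζ0 : ζ ≠ 0 := norm_pos_iff.1 (hδ.trans_le (hfr ζ hζ).1)
      exact ((differentiableAt_id.pow N).inv (pow_ne_zero _ hζ0)).smul (hf ζ)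
    have := specLE_of_frontier (c := (R ^ N)⁻¹ * max C 0)
      (isBounded_ball.subset sdiff_subset) hg (by positivity) (fun ζ hζ => ?_)
      (z := z) ⟨by simp [hR]; linarith, by simpa using hz⟩
    · have h1 := this.smul (z ^ N)
      rw [smul_smul, mul_inv_cancel₀ (pow_ne_zero _ (norm_pos_iff.1 hz0)), one_smul] at h1
      refine h1.mono (le_of_eq ?_)
      rw [norm_pow, hR, mul_pow, one_div, inv_pow]
      field_simp
    · have h1 := hfr ζ (frontier_subset_closure hζ)
      rcases h1.1.eq_or_lt with h2 | h2
      · have := (h ζ h2.ge).smul (ζ ^ N)⁻¹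
        rw [mul_zero] at this
        exact this.mono (by positivity)
      · rcases h1.2.eq_or_lt with h3 | h3
        · have := ((specLE_norm (f ζ)).mono
            ((hC ζ (by simpa using h3)).trans (le_max_left C 0))).smul (ζ ^ N)⁻¹
          rwa [norm_inv, norm_pow, h3] at this
        · refine absurd (hUo.frontier_eq ▸ hζ : ζ ∈ closure U \ U).2 (not_not.2 ⟨?_, ?_⟩)
          · simpa using h3
          · simpa using h2
  refine SpecLE.of_forall_gt fun d hd => ?_
  have ht : Tendsto (fun N : ℕ => max C 0 * (1 / 2 : ℝ) ^ N) atTop (𝓝 (max C 0 * 0)) :=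
    (tendsto_pow_atTop_nhds_zero_of_lt_one (by norm_num) (by norm_num)).const_mul _
  rw [mul_zero] at ht
  obtain ⟨N, hN⟩ := (ht.eventually_lt_const hd).exists
  exact (key N).mono hN.le

end ExpProducts

section VolterraProducts

open NormedSpace

theorem prod_exp_mem_closure_image {𝔸 : Type*} [NormedRing 𝔸] [NormedAlgebra ℂ 𝔸]
    [CompleteSpace 𝔸] {J : Submodule ℂ 𝔸} (hJ : IsClosed (J : Set 𝔸))
    (hLie : ∀ A ∈ J, ∀ B ∈ J, A * B - B * A ∈ J) {l : List 𝔸} (hl : ∀ A ∈ l, A ∈ J)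
    (hsum : (l.map norm).sum ≤ 1 / 16) :
    (l.map fun A => exp A).prod ∈ closure (exp '' (J : Set 𝔸)) := by
  have : CompleteSpace J := hJ.completeSpace_coe
  have hι : ∀ y z : J, ∃ w : J, J.subtypeₗᵢ w = J.subtypeₗᵢ y * J.subtypeₗᵢ z -
      J.subtypeₗᵢ z * J.subtypeₗᵢ y := fun y z => ⟨⟨_, hLie _ y.2 _ z.2⟩, rfl⟩
  lift l to List J using hl
  have hn : ((l.map Subtype.val).map norm).sum = (l.map norm).sum := by
    rw [List.map_map]; rfl
  have h := prod_exp_mem_closure J.subtypeₗᵢ hι l (by linarith)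
  rw [List.map_map]
  refine closure_mono ?_ h
  rintro _ ⟨c, -, rfl⟩
  exact ⟨c, c.2, rfl⟩

variable {X : Type*} [NormedAddCommGroup X] [NormedSpace ℂ X]

theorem isClosed_setOf_sub_one_compact [CompleteSpace X] :
    IsClosed {w : X →L[ℂ] X | IsCompactOperator (w - 1 : X →L[ℂ] X)} := by
  have hcl : IsClosed {f : X →L[ℂ] X | IsCompactOperator f} := isClosed_setOfPred_isCompactOperator
  exact hcl.preimage (continuous_id.sub continuous_const)

variable [CompleteSpace X]

theorem isCompactOperator_exp_sub_one {A : X →L[ℂ] X} (hA : IsCompactOperator A) :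
    IsCompactOperator (exp A - 1 : X →L[ℂ] X) := by
  obtain ⟨h, h1, -⟩ := exists_exp_sub_one_eq_mul A
  exact h1 ▸ isCompactOperator_mul_right hA h

/-- A product of exponentials of elements of a closed Lie algebra of compact quasinilpotent
operators is a quasinilpotent perturbation of the identity. -/
theorem specLE_prod_exp_sub_one {J : Submodule ℂ (X →L[ℂ] X)}
    (hJ : IsClosed (J : Set (X →L[ℂ] X))) (hLie : ∀ A ∈ J, ∀ B ∈ J, A * B - B * A ∈ J)
    (hcomp : ∀ A ∈ J, IsCompactOperator A) (hspec : ∀ A ∈ J, SpecLE A 0)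
    {l : List (X →L[ℂ] X)} (hl : ∀ A ∈ l, A ∈ J) :
    SpecLE ((l.map fun A => exp A).prod - 1) 0 := by
  have hs : 0 ≤ (l.map norm).sum := List.sum_nonneg (by simp +contextual)
  have h := specLE_zero_of_entire (f := fun z : ℂ => (l.map fun A => exp (z • A)).prod - 1)
    ((differentiable_prod_exp_smul l).sub_const 1) (δ := 1 / (16 * ((l.map norm).sum + 1)))
    (by positivity) (fun z hz => ?_) 1
  · simpa using h
  have hmem := prod_exp_mem_closure_image hJ hLie (l := l.map fun A => z • A)
    (by simpa using fun A hA => J.smul_mem z (hl A hA)) ?_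
  · rw [List.map_map] at hmem
    change (l.map fun A => exp (z • A)).prod ∈ _ at hmem
    obtain ⟨w, hw, hw'⟩ := mem_closure_iff_seq_limit.1 hmem
    have hc : IsCompactOperator ((l.map fun A => exp (z • A)).prod - 1 : X →L[ℂ] X) := by
      refine closure_minimal ?_ isClosed_setOf_sub_one_compact hmem
      rintro _ ⟨A, hA, rfl⟩
      exact isCompactOperator_exp_sub_one (hcomp A hA)
    refine specLE_of_tendsto (countable_spectrum _ hc) (hw'.sub_const 1)
      (Eventually.of_forall fun n => ?_)
    obtain ⟨A, hA, hA'⟩ := hw n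
    rw [← hA']
    exact (hspec A hA).exp_sub_one
  · rw [List.map_map]
    have : (norm ∘ fun A : X →L[ℂ] X => z • A) = fun A => ‖z‖ * ‖A‖ := by
      ext A; simp [norm_smul]
    rw [this, List.sum_map_mul_left]
    calc ‖z‖ * (l.map norm).sum ≤ 1 / (16 * ((l.map norm).sum + 1)) * ((l.map norm).sum + 1) := by
          gcongr
          linarith
      _ = 1 / 16 := by field_simp

theorem exists_bound_words_exp {J : Submodule ℂ (X →L[ℂ] X)}
    (hJ : IsClosed (J : Set (X →L[ℂ] X))) (hLie : ∀ A ∈ J, ∀ B ∈ J, A * B - B * A ∈ J)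
    (hcomp : ∀ A ∈ J, IsCompactOperator A) (hspec : ∀ A ∈ J, SpecLE A 0)
    {M : Set (X →L[ℂ] X)} (hM : M.Finite) (hMJ : M ⊆ J) :
    ∃ C, 0 < C ∧ ∀ n, ∀ w ∈ (exp '' M) ^ n, ‖w‖ ≤ C * 2 ^ n := by
  refine exists_bound_words_of_specLE (hM.image _) ?_ (fun n w hw => ?_) one_lt_two
  · rintro _ ⟨A, hA, rfl⟩
    exact ⟨1, by simp, by rw [one_smul]; exact isCompactOperator_exp_sub_one (hcomp A (hMJ hA))⟩
  · have : ∃ l : List (X →L[ℂ] X), (∀ A ∈ l, A ∈ J) ∧ (l.map fun A => exp A).prod = w := by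
      induction n generalizing w with
      | zero => exact ⟨[], by simp, by simpa using hw.symm⟩
      | succ n ih =>
        rw [pow_succ'] at hw
        obtain ⟨_, ⟨A, hA, rfl⟩, v, hv, rfl⟩ := hw
        obtain ⟨l, hl, rfl⟩ := ih v hv
        exact ⟨A :: l, by simpa using ⟨hMJ hA, hl⟩, by simp⟩
    obtain ⟨l, hl, rfl⟩ := this
    have h := specLE_prod_exp_sub_one hJ hLie hcomp hspec hl
    intro μ hμ
    have h1 := spectrum.sub_singleton_eq (R := ℂ) ((l.map fun A => exp A).prod) 1
    have h2 : μ - 1 ∈ spectrum ℂ ((l.map fun A => exp A).prod - 1) := by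
      rw [map_one] at h1
      rw [← h1]
      exact ⟨μ, hμ, 1, rfl, rfl⟩
    have h3 : μ = 1 := sub_eq_zero.1 (norm_le_zero_iff.1 (h _ h2))
    simp [h3]

end VolterraProducts

section VolterraAlgebra

open NormedSpace

variable {X : Type*} [NormedAddCommGroup X] [NormedSpace ℂ X]

theorem isCompactOperator_of_mem_adjoin {J : Submodule ℂ (X →L[ℂ] X)}
    (hcomp : ∀ A ∈ J, IsCompactOperator A) {a : X →L[ℂ] X}
    (ha : a ∈ NonUnitalAlgebra.adjoin ℂ (J : Set (X →L[ℂ] X))) : IsCompactOperator a := by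
  induction ha using NonUnitalAlgebra.adjoin_induction with
  | mem A hA => exact hcomp A hA
  | add a b _ _ ha hb => exact ha.add hb
  | zero => exact isCompactOperator_zero
  | mul a b _ _ ha hb => exact isCompactOperator_mul_right ha b
  | smul r a _ ha => exact ha.smul r

variable [CompleteSpace X]

theorem exists_entire_of_mem_adjoin {J : Submodule ℂ (X →L[ℂ] X)} {a : X →L[ℂ] X}
    (ha : a ∈ NonUnitalAlgebra.adjoin ℂ (J : Set (X →L[ℂ] X))) :
    ∃ M : Set (X →L[ℂ] X), M.Finite ∧ M ⊆ J ∧ ∃ k : ℂ → X →L[ℂ] X, Differentiable ℂ k ∧ k 0 = a ∧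
      ∃ K, 0 ≤ K ∧ ∀ z : ℂ, 1 ≤ ‖z‖ → ∀ N : Seminorm ℂ X,
        (∀ A ∈ M, ∀ x, N (exp (z • A) x) ≤ 2 * N x) → ∀ x, N (k z x) ≤ K / ‖z‖ * N x := by
  induction ha using NonUnitalAlgebra.adjoin_induction with
  | mem A hA =>
    refine ⟨{A}, finite_singleton _, singleton_subset_iff.2 hA,
      dslope (fun z : ℂ => exp (z • A)) 0, ?_, ?_, 3, by norm_num, fun z hz N hN x => ?_⟩
    · rw [← differentiableOn_univ, Complex.differentiableOn_dslope univ_mem]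
      exact fun z _ => (hasDerivAt_exp_smul_const (𝕂 := ℂ) A z).differentiableAt.differentiableWithinAt
    · rw [dslope_same, (hasDerivAt_exp_smul_const (𝕂 := ℂ) A 0).deriv]
      simp
    · have hz0 : z ≠ 0 := norm_pos_iff.1 (zero_lt_one.trans_le hz)
      rw [dslope_of_ne _ hz0, slope_def_module, zero_smul, exp_zero, sub_zero, smul_apply,
        sub_apply, one_apply_eq_self, map_smul_eq_mul, norm_inv]
      have h1 := map_sub_le_add N (exp (z • A) x) x
      have h2 := hN A rfl x
      rw [div_eq_inv_mul, mul_assoc]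
      gcongr
      linarith
  | add a b _ _ ha hb =>
    obtain ⟨M₁, hM₁, hJ₁, k₁, hk₁, rfl, K₁, hK₁, h₁⟩ := ha
    obtain ⟨M₂, hM₂, hJ₂, k₂, hk₂, rfl, K₂, hK₂, h₂⟩ := hb
    refine ⟨M₁ ∪ M₂, hM₁.union hM₂, union_subset hJ₁ hJ₂, fun z => k₁ z + k₂ z, hk₁.add hk₂, rfl,
      K₁ + K₂, add_nonneg hK₁ hK₂, fun z hz N hN x => ?_⟩
    refine (map_add_le_add N _ _).trans ((add_le_add
      (h₁ z hz N (fun A hA => hN A (Or.inl hA)) x)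
      (h₂ z hz N (fun A hA => hN A (Or.inr hA)) x)).trans (le_of_eq ?_))
    ring
  | zero => exact ⟨∅, finite_empty, empty_subset _, 0, differentiable_const 0, rfl, 0, le_rfl, by simp⟩
  | mul a b _ _ ha hb =>
    obtain ⟨M₁, hM₁, hJ₁, k₁, hk₁, rfl, K₁, hK₁, h₁⟩ := ha
    obtain ⟨M₂, hM₂, hJ₂, k₂, hk₂, rfl, K₂, hK₂, h₂⟩ := hb
    refine ⟨M₁ ∪ M₂, hM₁.union hM₂, union_subset hJ₁ hJ₂, fun z => k₁ z * k₂ z, hk₁.mul hk₂, rfl,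
      K₁ * K₂, mul_nonneg hK₁ hK₂, fun z hz N hN x => ?_⟩
    have hz0 : 0 < ‖z‖ := zero_lt_one.trans_le hz
    calc N (k₁ z (k₂ z x)) ≤ K₁ / ‖z‖ * N (k₂ z x) := h₁ z hz N (fun A hA => hN A (Or.inl hA)) _
      _ ≤ K₁ / ‖z‖ * (K₂ / ‖z‖ * N x) := by
        gcongr
        exact h₂ z hz N (fun A hA => hN A (Or.inr hA)) x
      _ ≤ K₁ / 1 * (K₂ / ‖z‖ * N x) := by
        have := apply_nonneg N x
        gcongr
      _ = _ := by ring
  | smul r a _ ha =>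
    obtain ⟨M, hM, hJ, k, hk, rfl, K, hK, h⟩ := ha
    refine ⟨M, hM, hJ, fun z => r • k z, hk.const_smul r, rfl, ‖r‖ * K, by positivity,
      fun z hz N hN x => ?_⟩
    rw [smul_apply, map_smul_eq_mul, mul_div_assoc, mul_assoc]
    gcongr
    exact h z hz N hN x

theorem exists_seminorm_exp_le {J : Submodule ℂ (X →L[ℂ] X)}
    (hJ : IsClosed (J : Set (X →L[ℂ] X))) (hLie : ∀ A ∈ J, ∀ B ∈ J, A * B - B * A ∈ J)
    (hcomp : ∀ A ∈ J, IsCompactOperator A) (hspec : ∀ A ∈ J, SpecLE A 0)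
    {M : Set (X →L[ℂ] X)} (hM : M.Finite) (hMJ : M ⊆ J) :
    ∃ (N : Seminorm ℂ X) (C : ℝ), 0 < C ∧ (∀ x, N x ≤ C * ‖x‖) ∧ (∀ x, ‖x‖ ≤ N x) ∧
      ∀ A ∈ M, ∀ x, N (exp A x) ≤ 2 * N x := by
  obtain ⟨C, hC, hw⟩ := exists_bound_words_exp hJ hLie hcomp hspec hM hMJ
  have hr : (0 : ℝ) < 1 / 2 := by norm_num
  obtain ⟨N, h1, h2, h3⟩ := exists_adapted_seminorm (M := exp '' M) (C := C) hr
    fun n w hwn => by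
      have := hw n w hwn
      rw [one_div, inv_pow, inv_mul_le_iff₀ (by positivity)]
      linarith
  refine ⟨N, C, hC, h1, fun x => by simpa using h2 0 1 (by simp) x, fun A hA x => ?_⟩
  have := Seminorm.mul_apply_le_of_adapted hr h2 h3 (mem_image_of_mem _ hA) x
  linarith

theorem specLE_zero_of_mem_adjoin {J : Submodule ℂ (X →L[ℂ] X)}
    (hJ : IsClosed (J : Set (X →L[ℂ] X))) (hLie : ∀ A ∈ J, ∀ B ∈ J, A * B - B * A ∈ J)
    (hcomp : ∀ A ∈ J, IsCompactOperator A) (hspec : ∀ A ∈ J, SpecLE A 0) {a : X →L[ℂ] X}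
    (ha : a ∈ NonUnitalAlgebra.adjoin ℂ (J : Set (X →L[ℂ] X))) : SpecLE a 0 := by
  obtain ⟨M, hM, hMJ, k, hk, rfl, K, hK, h⟩ := exists_entire_of_mem_adjoin ha
  have key : ∀ z : ℂ, 1 ≤ ‖z‖ → SpecLE (k z) (K / ‖z‖) := fun z hz => by
    obtain ⟨N, C, hC, h1, h2, h3⟩ := exists_seminorm_exp_le hJ hLie hcomp hspec
      (hM.image (z • ·)) (by rintro _ ⟨A, hA, rfl⟩; exact J.smul_mem z (hMJ hA))
    have h4 := h z hz N fun A hA => h3 _ (mem_image_of_mem _ hA)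
    have hKz : 0 ≤ K / ‖z‖ := by positivity
    refine specLE_of_norm_pow_le (C := C) hKz fun n => ?_
    refine ContinuousLinearMap.opNorm_le_bound _ (by positivity) fun x => ?_
    have h5 : N ((k z ^ n) x) ≤ (K / ‖z‖) ^ n * N x := by
      induction n with
      | zero => simp
      | succ n ih =>
        rw [pow_succ', mul_apply_eq_comp]
        refine (h4 _).trans ?_
        rw [pow_succ', mul_assoc]
        gcongr
    refine (h2 _).trans (h5.trans ?_)
    rw [mul_comm C, mul_assoc]
    gcongr
    exact h1 x
  refine SpecLE.of_forall_gt fun d hd => ?_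
  set R := max 1 (K / d) with hR
  have hR1 : 1 ≤ R := le_max_left _ _
  refine (specLE_of_frontier (U := ball 0 R) isBounded_ball hk.diffContOnCl (c := K / R)
    (by positivity) (fun ζ hζ => ?_) (z := 0) (by simp; linarith)).mono ?_
  · rw [frontier_ball _ (by positivity), mem_sphere_zero_iff_norm] at hζ
    have := key ζ (by rw [hζ]; exact hR1)
    rwa [hζ] at this
  · rw [div_le_iff₀ (by positivity), ← div_le_iff₀' hd]
    exact le_max_right _ _

end VolterraAlgebra

section VolterraReducible

variable {X : Type*} [NormedAddCommGroup X] [NormedSpace ℂ X]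

theorem exists_word_apply_mem_closedBall {𝒜 : NonUnitalSubalgebra ℂ (X →L[ℂ] X)}
    {K : X →L[ℂ] X} (hK : K ∈ 𝒜) (hKc : IsCompactOperator K) {x₀ : X} (hx₀ : ‖K‖ < ‖K x₀‖)
    (hdense : ∀ x ≠ 0, ∃ a ∈ 𝒜, ‖a x - x₀‖ < 1) :
    ∃ M : Set (X →L[ℂ] X), M.Finite ∧ M ⊆ 𝒜 ∧
      ∀ n : ℕ, ∃ w ∈ M ^ n, ∃ y ∈ closedBall x₀ 1, w x₀ = (4 : ℂ) ^ n • y := by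
  have hcomp : IsCompact (closure (K '' closedBall x₀ 1)) :=
    hKc.isCompact_closure_image_of_isVonNBounded
      (NormedSpace.isVonNBounded_of_isBounded ℂ isBounded_closedBall)
  have hne : ∀ y ∈ closure (K '' closedBall x₀ 1), y ≠ 0 := by
    have : closure (K '' closedBall x₀ 1) ⊆ {y | ‖K x₀‖ - ‖K‖ ≤ ‖y‖} := by
      refine closure_minimal ?_ (isClosed_le continuous_const continuous_norm)
      rintro _ ⟨x, hx, rfl⟩
      rw [mem_closedBall, dist_eq_norm] at hx
      have h1 : ‖K x₀ - K x‖ ≤ ‖K‖ := by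
        rw [← map_sub]
        exact (K.le_opNorm _).trans (mul_le_of_le_one_right (norm_nonneg _)
          (by rwa [norm_sub_rev]))
      have h2 := norm_sub_norm_le (K x₀) (K x)
      change ‖K x₀‖ - ‖K‖ ≤ ‖K x‖
      linarith
    rintro y hy rfl
    have := this hy
    rw [Set.mem_ofPred_eq, norm_zero] at this
    linarith
  obtain ⟨t, ht⟩ := hcomp.elim_finite_subcover (fun a : 𝒜 => {y | ‖(a : X →L[ℂ] X) y - x₀‖ < 1})
    (fun a => isOpen_lt ((a.1.continuous.sub continuous_const).norm) continuous_const)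
    fun y hy => by
      obtain ⟨a, ha, h⟩ := hdense y (hne y hy)
      exact mem_iUnion.2 ⟨⟨a, ha⟩, h⟩
  refine ⟨(fun a : 𝒜 => (4 : ℂ) • (a * K : X →L[ℂ] X)) '' (t : Set 𝒜), t.finite_toSet.image _, ?_,
    fun n => ?_⟩
  · rintro _ ⟨a, -, rfl⟩
    exact 𝒜.smul_mem' 4 (mul_mem a.2 hK)
  · induction n with
    | zero => exact ⟨1, by simp, x₀, by simp, by simp⟩
    | succ n ih =>
      obtain ⟨w, hw, y, hy, hwy⟩ := ih
      obtain ⟨a, ha, h⟩ := mem_iUnion₂.1 (ht (subset_closure (mem_image_of_mem K hy)))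
      refine ⟨(4 : ℂ) • (a * K : X →L[ℂ] X) * w, ?_, a.1 (K y), ?_, ?_⟩
      · rw [pow_succ']
        exact Set.mul_mem_mul (mem_image_of_mem _ ha) hw
      · rw [mem_closedBall, dist_eq_norm]
        exact le_of_lt h
      · rw [mul_apply_eq_comp, smul_apply, mul_apply_eq_comp, hwy, map_smul, map_smul, smul_smul,
          pow_succ']

theorem exists_invariant_of_mem {𝒜 : NonUnitalSubalgebra ℂ (X →L[ℂ] X)} {x : X} (hx : x ≠ 0)
    {K : X →L[ℂ] X} (hK : K ∈ 𝒜) (hK0 : K ≠ 0) {y : X} (hy : ∃ r > 0, ∀ a ∈ 𝒜, r ≤ ‖a x - y‖) :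
    ∃ M : Submodule ℂ X, IsClosed (M : Set X) ∧ M ≠ ⊥ ∧ M ≠ ⊤ ∧ ∀ A ∈ 𝒜, ∀ x ∈ M, A x ∈ M := by
  by_cases h : ∀ a ∈ 𝒜, a x = 0
  · refine ⟨⨅ a : 𝒜, LinearMap.ker (a : X →L[ℂ] X).toLinearMap, ?_, ?_, ?_, ?_⟩
    · rw [Submodule.coe_iInf]
      exact isClosed_iInter fun a => a.1.isClosed_ker
    · refine (Submodule.ne_bot_iff _).2 ⟨x, ?_, hx⟩
      simpa using h
    · intro htop
      refine hK0 (ContinuousLinearMap.ext fun z => ?_)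
      have hz : z ∈ (⊤ : Submodule ℂ X) := trivial
      rw [← htop] at hz
      simpa using (Submodule.mem_iInf _).1 hz ⟨K, hK⟩
    · intro A hA z hz
      have : A z = 0 := by simpa using (Submodule.mem_iInf _).1 hz ⟨A, hA⟩
      rw [this]
      exact zero_mem _
  · push Not at h
    obtain ⟨a, ha, hax⟩ := h
    set M := 𝒜.toSubmodule.map (ContinuousLinearMap.apply ℂ X x).toLinearMap with hM
    have hmem : ∀ z, z ∈ M ↔ ∃ b ∈ 𝒜, b x = z := fun z => Iff.rfl
    refine ⟨M.topologicalClosure, M.isClosed_topologicalClosure, ?_, ?_, ?_⟩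
    · exact (Submodule.ne_bot_iff _).2 ⟨a x, M.le_topologicalClosure ((hmem _).2 ⟨a, ha, rfl⟩), hax⟩
    · intro htop
      have hyM : y ∈ closure (M : Set X) := by
        rw [← Submodule.topologicalClosure_coe, htop]
        trivial
      obtain ⟨r, hr, hr'⟩ := hy
      obtain ⟨z, hz, hzy⟩ := Metric.mem_closure_iff.1 hyM r hr
      obtain ⟨b, hb, rfl⟩ := (hmem _).1 hz
      rw [dist_comm, dist_eq_norm] at hzy
      exact absurd hzy (not_lt.2 (hr' b hb))
    · intro A hA z hz
      refine map_mem_closure A.continuous hz fun u hu => ?_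
      obtain ⟨b, hb, rfl⟩ := (hmem _).1 hu
      exact (hmem _).2 ⟨A * b, mul_mem hA hb, rfl⟩

variable [CompleteSpace X]

theorem norm_apply_le_of_volterra {𝒜 : NonUnitalSubalgebra ℂ (X →L[ℂ] X)}
    (hcomp : ∀ a ∈ 𝒜, IsCompactOperator a) (hspec : ∀ a ∈ 𝒜, SpecLE a 0)
    {K : X →L[ℂ] X} (hK : K ∈ 𝒜) {x₀ : X} (hdense : ∀ x ≠ 0, ∃ a ∈ 𝒜, ‖a x - x₀‖ < 1) :
    ‖K x₀‖ ≤ ‖K‖ := by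
  by_contra! hlt
  obtain ⟨M, hM, hMA, hw⟩ := exists_word_apply_mem_closedBall hK (hcomp K hK) hlt hdense
  have hpow : ∀ n, ∀ w ∈ M ^ (n + 1), w ∈ 𝒜 := fun n => by
    induction n with
    | zero => simpa using fun w hw => hMA hw
    | succ n ih =>
      intro w hw
      rw [pow_succ] at hw
      obtain ⟨u, hu, v, hv, rfl⟩ := hw
      exact mul_mem (ih u hu) (hMA hv)
  obtain ⟨C, hC, hbd⟩ := exists_bound_words_of_specLE hM
    (fun a ha => ⟨0, by simp, by simpa using hcomp a (hMA ha)⟩) (fun n w hw => by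
      cases n with
      | zero =>
        rw [pow_zero, Set.mem_one] at hw
        rw [hw]
        intro μ hμ
        rcases subsingleton_or_nontrivial (X →L[ℂ] X)
        · simp [spectrum.of_subsingleton] at hμ
        · rw [spectrum.one_eq] at hμ
          simp_all
      | succ n => exact (hspec w (hpow n w hw)).mono zero_le_one) one_lt_two
  have hx₀ : 1 < ‖x₀‖ := by
    have h1 := hlt.trans_le (K.le_opNorm x₀)
    by_contra! h
    exact absurd h1 (not_lt.2 (mul_le_of_le_one_right (norm_nonneg _) h))
  have key : ∀ n : ℕ, ‖x₀‖ - 1 ≤ C * ‖x₀‖ * (1 / 2) ^ n := fun n => by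
    obtain ⟨w, hwn, y, hy, hwy⟩ := hw n
    rw [mem_closedBall, dist_eq_norm] at hy
    have h1 := (w.le_opNorm x₀).trans (mul_le_mul_of_nonneg_right (hbd n w hwn) (norm_nonneg _))
    rw [hwy, norm_smul, norm_pow, Complex.norm_ofNat] at h1
    have h2 := norm_sub_norm_le x₀ y
    rw [norm_sub_rev] at h2
    have h3 : (4 : ℝ) ^ n * (‖x₀‖ - 1) ≤ C * 2 ^ n * ‖x₀‖ := by
      refine le_trans ?_ h1
      gcongr
      linarith
    rw [show (4 : ℝ) = 2 * 2 by norm_num, mul_pow] at h3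
    have h4 : (0 : ℝ) < 2 ^ n := by positivity
    rw [one_div, inv_pow, ← div_eq_mul_inv, le_div_iff₀ h4]
    nlinarith
  have ht : Tendsto (fun n : ℕ => C * ‖x₀‖ * (1 / 2 : ℝ) ^ n) atTop (𝓝 (C * ‖x₀‖ * 0)) :=
    (tendsto_pow_atTop_nhds_zero_of_lt_one (by norm_num) (by norm_num)).const_mul _
  have := ge_of_tendsto' ht key
  linarith

theorem exists_invariant_of_volterra {𝒜 : NonUnitalSubalgebra ℂ (X →L[ℂ] X)}
    (hcomp : ∀ a ∈ 𝒜, IsCompactOperator a) (hspec : ∀ a ∈ 𝒜, SpecLE a 0)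
    {K : X →L[ℂ] X} (hK : K ∈ 𝒜) (hK0 : K ≠ 0) :
    ∃ M : Submodule ℂ X, IsClosed (M : Set X) ∧ M ≠ ⊥ ∧ M ≠ ⊤ ∧ ∀ A ∈ 𝒜, ∀ x ∈ M, A x ∈ M := by
  obtain ⟨x₁, hx₁⟩ : ∃ x, K x ≠ 0 := by
    by_contra! h
    exact hK0 (ContinuousLinearMap.ext h)
  have hpos : 0 < ‖K x₁‖ := norm_pos_iff.2 hx₁
  set x₀ := (((‖K‖ + 1) / ‖K x₁‖ : ℝ) : ℂ) • x₁ with hx₀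
  have h : ‖K‖ < ‖K x₀‖ := by
    rw [hx₀, map_smul, norm_smul, Complex.norm_real, Real.norm_of_nonneg (by positivity),
      div_mul_cancel₀ _ hpos.ne']
    linarith
  by_contra hcon
  refine absurd h (not_lt.2 (norm_apply_le_of_volterra hcomp hspec hK fun x hx => ?_))
  by_contra! hr
  exact hcon (exists_invariant_of_mem hx hK hK0 ⟨1, one_pos, hr⟩)

/-- A closed Lie algebra of compact quasinilpotent operators is reducible. -/
theorem exists_invariant_of_forall_specLE_zero {J : Submodule ℂ (X →L[ℂ] X)}
    (hJ : IsClosed (J : Set (X →L[ℂ] X))) (hLie : ∀ A ∈ J, ∀ B ∈ J, A * B - B * A ∈ J)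
    (hcomp : ∀ A ∈ J, IsCompactOperator A) (hspec : ∀ A ∈ J, SpecLE A 0)
    {K : X →L[ℂ] X} (hK : K ∈ J) (hK0 : K ≠ 0) :
    ∃ M : Submodule ℂ X, IsClosed (M : Set X) ∧ M ≠ ⊥ ∧ M ≠ ⊤ ∧ ∀ A ∈ J, ∀ x ∈ M, A x ∈ M := by
  obtain ⟨M, h1, h2, h3, h4⟩ := exists_invariant_of_volterra
    (𝒜 := NonUnitalAlgebra.adjoin ℂ (J : Set (X →L[ℂ] X)))
    (fun a ha => isCompactOperator_of_mem_adjoin hcomp ha)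
    (fun a ha => specLE_zero_of_mem_adjoin hJ hLie hcomp hspec ha)
    (NonUnitalAlgebra.subset_adjoin ℂ hK) hK0
  exact ⟨M, h1, h2, h3, fun A hA => h4 A (NonUnitalAlgebra.subset_adjoin ℂ hA)⟩

end VolterraReducible

section StableIdeal

open NormedSpace

section Algebra

variable {𝔸 : Type*} [NormedRing 𝔸] [NormedAlgebra ℂ 𝔸] [CompleteSpace 𝔸]

theorem exp_mul_exp_neg (a : 𝔸) : exp a * exp (-a) = 1 := by
  let +nondep : NormedAlgebra ℚ 𝔸 := .restrictScalars ℚ ℂ _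
  rw [← exp_add_of_commute (Commute.neg_right (Commute.refl _)), add_neg_cancel, exp_zero]

theorem SpecLE.exp_conj {a : 𝔸} {c : ℝ} (h : SpecLE a c) (b : 𝔸) :
    SpecLE (exp b * a * exp (-b)) c := by
  have h1 := exp_mul_exp_neg (-b)
  rw [neg_neg] at h1
  let u : 𝔸ˣ := ⟨exp b, exp (-b), exp_mul_exp_neg b, h1⟩
  intro μ hμ
  exact h μ (spectrum.units_conjugate (R := ℂ) (a := a) (u := u) ▸ hμ)

theorem exists_exp_conj {Y : Type*} [NormedAddCommGroup Y] [NormedSpace ℂ Y] [CompleteSpace Y]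
    (ι : Y →ₗᵢ[ℂ] 𝔸) (hι : ∀ y z, ∃ w, ι w = ι y * ι z - ι z * ι y) (c y : Y) :
    ∃ w, ι w = exp (ι c) * ι y * exp (-ι c) := by
  obtain ⟨D, -, hD⟩ := exists_inner_derivation ι (hι c)
  refine ⟨exp D y, ?_⟩
  have h : ι (exp D y) * exp (ι c) = exp (ι c) * ι y :=
    exp_inner_mul_exp ι.toContinuousLinearMap hD y
  rw [← h, mul_assoc, exp_mul_exp_neg, mul_one]

theorem exp_conj_mem {J : Submodule ℂ 𝔸} (hJ : IsClosed (J : Set 𝔸))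
    (hLie : ∀ A ∈ J, ∀ B ∈ J, A * B - B * A ∈ J) {B T : 𝔸} (hB : B ∈ J) (hT : T ∈ J) :
    exp B * T * exp (-B) ∈ J := by
  have : CompleteSpace J := hJ.completeSpace_coe
  have hι : ∀ y z : J, ∃ w : J, J.subtypeₗᵢ w = J.subtypeₗᵢ y * J.subtypeₗᵢ z -
      J.subtypeₗᵢ z * J.subtypeₗᵢ y := fun y z => ⟨⟨_, hLie _ y.2 _ z.2⟩, rfl⟩
  obtain ⟨w, hw⟩ := exists_exp_conj J.subtypeₗᵢ hι ⟨B, hB⟩ ⟨T, hT⟩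
  exact hw ▸ w.2

theorem commutator_mem_of_exp_conj_mem {I : Submodule ℂ 𝔸} (hI : IsClosed (I : Set 𝔸)) {B T : 𝔸}
    (h : ∀ z : ℂ, exp (z • B) * T * exp (-(z • B)) ∈ I) : B * T - T * B ∈ I := by
  have hT : T ∈ I := by simpa using h 0
  have hd : HasDerivAt (fun z : ℂ => exp (z • B) * T * exp (-(z • B))) (B * T - T * B) 0 := by
    have h1 := ((hasDerivAt_exp_smul_const (𝕂 := ℂ) B 0).mul_const T).mul
      (hasDerivAt_exp_smul_const (𝕂 := ℂ) (-B) 0)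
    simp only [smul_neg, zero_smul, neg_zero, exp_zero, one_mul, mul_one] at h1
    exact h1.congr_deriv (by noncomm_ring)
  refine hI.mem_of_tendsto hd.tendsto_slope (Eventually.of_forall fun z => ?_)
  rw [slope_def_module]
  exact I.smul_mem _ (I.sub_mem (h z) (h 0))

end Algebra

variable {X : Type*} [NormedAddCommGroup X] [NormedSpace ℂ X]

/-- The elements `T` of `J` such that all elements of `J` have `T`-stable spectrum. -/
def stableSubmodule (J : Submodule ℂ (X →L[ℂ] X)) : Submodule ℂ (X →L[ℂ] X) where
  carrier := {T | T ∈ J ∧ ∀ A ∈ J, ∀ lam : ℂ, ∀ c : ℝ, 0 ≤ c → SpecLE A c → SpecLE (A + lam • T) c}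
  add_mem' := by
    rintro S T ⟨hS, hS'⟩ ⟨hT, hT'⟩
    refine ⟨J.add_mem hS hT, fun A hA lam c hc h => ?_⟩
    rw [smul_add, ← add_assoc]
    exact hT' _ (J.add_mem hA (J.smul_mem lam hS)) lam c hc (hS' A hA lam c hc h)
  zero_mem' := ⟨J.zero_mem, fun A _ lam c _ h => by simpa using h⟩
  smul_mem' := by
    rintro z T ⟨hT, hT'⟩
    refine ⟨J.smul_mem z hT, fun A hA lam c hc h => ?_⟩
    rw [smul_smul]
    exact hT' A hA _ c hc h

theorem specLE_zero_of_mem_stableSubmodule {J : Submodule ℂ (X →L[ℂ] X)} {T : X →L[ℂ] X}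
    (hT : T ∈ stableSubmodule J) : SpecLE T 0 := by
  simpa using hT.2 0 J.zero_mem 1 0 le_rfl (specLE_zero 0 le_rfl)

theorem specLE_iff_spectralRadius_le {a : X →L[ℂ] X} {c : ℝ} (hc : 0 ≤ c) :
    SpecLE a c ↔ spectralRadius ℂ a ≤ ENNReal.ofReal c := by
  rw [spectralRadius, iSup₂_le_iff]
  refine forall₂_congr fun μ _ => ?_
  rw [← enorm_eq_nnnorm, ← ofReal_norm, ENNReal.ofReal_le_ofReal_iff hc]

theorem commutator_mem_topologicalClosure {L : Submodule ℂ (X →L[ℂ] X)}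
    (hLie : ∀ A ∈ L, ∀ B ∈ L, A * B - B * A ∈ L) {A B : X →L[ℂ] X}
    (hA : A ∈ L.topologicalClosure) (hB : B ∈ L.topologicalClosure) :
    A * B - B * A ∈ L.topologicalClosure :=
  map_mem_closure₂ (f := fun A B : X →L[ℂ] X => A * B - B * A)
    ((continuous_fst.mul continuous_snd).sub (continuous_snd.mul continuous_fst)) hA hB hLie

variable [CompleteSpace X]

theorem isClosed_stableSubmodule {J : Submodule ℂ (X →L[ℂ] X)}
    (hJ : IsClosed (J : Set (X →L[ℂ] X))) (hcomp : ∀ A ∈ J, IsCompactOperator A) :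
    IsClosed (stableSubmodule J : Set (X →L[ℂ] X)) := by
  refine IsSeqClosed.isClosed fun S T hS hST => ?_
  have hT : T ∈ J := hJ.mem_of_tendsto hST (Eventually.of_forall fun n => (hS n).1)
  refine ⟨hT, fun A hA lam c hc h => ?_⟩
  refine specLE_of_tendsto (countable_spectrum _ ((hcomp A hA).add ((hcomp T hT).smul lam)))
    ((hST.const_smul lam).const_add A) (Eventually.of_forall fun n => (hS n).2 A hA lam c hc h)

theorem commutator_mem_stableSubmodule {J : Submodule ℂ (X →L[ℂ] X)}
    (hJ : IsClosed (J : Set (X →L[ℂ] X))) (hLie : ∀ A ∈ J, ∀ B ∈ J, A * B - B * A ∈ J)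
    (hcomp : ∀ A ∈ J, IsCompactOperator A) {B T : X →L[ℂ] X} (hB : B ∈ J)
    (hT : T ∈ stableSubmodule J) : B * T - T * B ∈ stableSubmodule J := by
  refine commutator_mem_of_exp_conj_mem (isClosed_stableSubmodule hJ hcomp) fun z => ?_
  have hz := J.smul_mem z hB
  refine ⟨exp_conj_mem hJ hLie hz hT.1, fun A hA lam c hc h => ?_⟩
  have h1 := hT.2 _ (exp_conj_mem hJ hLie (J.neg_mem hz) hA) lam c hc (h.exp_conj _)
  have h2 := h1.exp_conj (z • B)
  rw [neg_neg] at h2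
  have e1 := exp_mul_exp_neg (z • B)
  convert h2 using 1
  rw [mul_add, add_mul, mul_smul_comm, smul_mul_assoc]
  congr 1
  rw [mul_assoc (exp (-(z • B))) A, ← mul_assoc (exp (z • B)) (exp (-(z • B))), e1, one_mul,
    mul_assoc, e1, mul_one]

theorem mem_stableSubmodule_closure {L : Submodule ℂ (X →L[ℂ] X)}
    (hcomp : ∀ A ∈ L.topologicalClosure, IsCompactOperator A) {T : X →L[ℂ] X} (hT : T ∈ L)
    (hstable : ∀ A ∈ L, ∀ lam : ℂ, spectralRadius ℂ (A + lam • T) ≤ spectralRadius ℂ A) :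
    T ∈ stableSubmodule L.topologicalClosure := by
  have hT' := L.le_topologicalClosure hT
  refine ⟨hT', fun A hA lam c hc h => SpecLE.of_forall_gt fun d hd => ?_⟩
  obtain ⟨w, hw, hwA⟩ := mem_closure_iff_seq_limit.1 hA
  refine specLE_of_tendsto (countable_spectrum _ ((hcomp A hA).add ((hcomp T hT').smul lam)))
    (hwA.add_const (lam • T)) ?_
  filter_upwards [h.eventually_of_tendsto hc hd hwA] with n hn
  have hd0 : 0 ≤ d := hc.trans (le_of_lt hd)
  rw [specLE_iff_spectralRadius_le hd0] at hn ⊢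
  exact (hstable _ (hw n) lam).trans hn

theorem isCompactOperator_of_mem_topologicalClosure {L : Submodule ℂ (X →L[ℂ] X)}
    (hcomp : ∀ A ∈ L, IsCompactOperator A) {A : X →L[ℂ] X} (hA : A ∈ L.topologicalClosure) :
    IsCompactOperator A := by
  have hcl : IsClosed {f : X →L[ℂ] X | IsCompactOperator f} := isClosed_setOfPred_isCompactOperator
  exact closure_minimal (fun B hB => hcomp B hB) hcl hA

end StableIdeal

section RieszSplitting

variable {𝔸 : Type*} [NormedRing 𝔸] [NormedAlgebra ℂ 𝔸]

theorem commute_resolvent (a : 𝔸) (z : ℂ) : Commute a (resolvent a z) := by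
  by_cases hz : IsUnit (algebraMap ℂ 𝔸 z - a)
  · obtain ⟨u, hu⟩ := hz
    have h : Commute a (u : 𝔸) :=
      hu ▸ Commute.sub_right (Algebra.commutes z a).symm (Commute.refl a)
    rw [resolvent, ← hu, Ring.inverse_unit]
    exact h.units_inv_right
  · rw [resolvent, Ring.inverse_non_unit _ hz]
    exact Commute.zero_right a

variable [CompleteSpace 𝔸]

theorem apply_circleIntegral {E F : Type*} [NormedAddCommGroup E] [NormedSpace ℂ E]
    [CompleteSpace E] [NormedAddCommGroup F] [NormedSpace ℂ F] [CompleteSpace F] (φ : E →L[ℂ] F)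
    {f : ℂ → E} {c : ℂ} {R : ℝ} (hf : CircleIntegrable f c R) :
    φ (∮ z in C(c, R), f z) = ∮ z in C(c, R), φ (f z) := by
  rw [circleIntegral, circleIntegral, ← φ.intervalIntegral_comp_comm hf.out]
  simp only [map_smul]

/-- The coefficient of `z ^ (-m - 1)` in the Laurent expansion of the resolvent of `a` near the
circle of radius `ρ`. -/
noncomputable def resolventMoment (a : 𝔸) (ρ : ℝ) (m : ℤ) : 𝔸 :=
  (2 * Real.pi * Complex.I : ℂ)⁻¹ • ∮ z in C(0, ρ), z ^ m • resolvent a z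

theorem continuousOn_zpow_smul_resolvent {a : 𝔸} {S : Set ℂ} (hS : S ⊆ resolventSet ℂ a)
    (h0 : (0 : ℂ) ∉ S) (m : ℤ) : ContinuousOn (fun z : ℂ => z ^ m • resolvent a z) S := fun z hz =>
  ((continuousAt_zpow₀ z m (Or.inl (ne_of_mem_of_not_mem hz h0))).smul
    (spectrum.hasDerivAt_resolvent_const_left (hS hz)).continuousAt).continuousWithinAt

theorem circleIntegrable_zpow_smul_resolvent {a : 𝔸} {ρ : ℝ} (hρ : 0 < ρ)
    (hS : sphere 0 ρ ⊆ resolventSet ℂ a) (m : ℤ) :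
    CircleIntegrable (fun z : ℂ => z ^ m • resolvent a z) 0 ρ :=
  (continuousOn_zpow_smul_resolvent hS (by simp [hρ.ne]) m).circleIntegrable hρ.le

theorem resolventMoment_eq {a : 𝔸} {s₁ s₂ : ℝ} (h₁ : 0 < s₁) (h₁₂ : s₁ ≤ s₂)
    (hS : ∀ z : ℂ, s₁ ≤ ‖z‖ → ‖z‖ ≤ s₂ → z ∈ resolventSet ℂ a) (m : ℤ) :
    resolventMoment a s₂ m = resolventMoment a s₁ m := by
  rw [resolventMoment, resolventMoment]
  have hsub : closedBall (0 : ℂ) s₂ \ ball 0 s₁ ⊆ resolventSet ℂ a := fun z hz =>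
    hS z (by simpa using hz.2) (by simpa using hz.1)
  have h0 : (0 : ℂ) ∉ closedBall (0 : ℂ) s₂ \ ball 0 s₁ := fun h => h.2 (by simpa using h₁)
  rw [Complex.circleIntegral_eq_of_differentiable_on_annulus_off_countable h₁ h₁₂ countable_empty
    (continuousOn_zpow_smul_resolvent hsub h0 m) fun z hz => ?_]
  have hz1 : s₁ < ‖z‖ := by simpa using hz.1.2
  have hz2 : ‖z‖ < s₂ := by simpa using hz.1.1
  have hz0 : z ≠ 0 := norm_pos_iff.1 (h₁.trans hz1)
  exact (differentiableAt_zpow.2 (Or.inl hz0)).smul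
    (spectrum.hasDerivAt_resolvent_const_left (hS z hz1.le hz2.le)).differentiableAt

theorem commute_resolventMoment {a : 𝔸} {ρ : ℝ} (hρ : 0 < ρ)
    (hS : sphere 0 ρ ⊆ resolventSet ℂ a) (m : ℤ) : Commute a (resolventMoment a ρ m) := by
  have hi := circleIntegrable_zpow_smul_resolvent hρ hS m
  have h1 := apply_circleIntegral (ContinuousLinearMap.mul ℂ 𝔸 a) hi
  have h2 := apply_circleIntegral ((ContinuousLinearMap.mul ℂ 𝔸).flip a) hi
  simp only [ContinuousLinearMap.mul_apply', ContinuousLinearMap.flip_apply] at h1 h2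
  refine Commute.smul_right ?_ _
  rw [Commute, SemiconjBy, h1, h2]
  refine circleIntegral.integral_congr hρ.le fun z _ => ?_
  exact ((commute_resolvent a z).smul_right _).eq

theorem mul_resolventMoment {a : 𝔸} {ρ : ℝ} (hρ : 0 < ρ)
    (hS : sphere 0 ρ ⊆ resolventSet ℂ a) (m : ℤ) :
    a * resolventMoment a ρ m = resolventMoment a ρ (m + 1) - if m = -1 then 1 else 0 := by
  have hi := circleIntegrable_zpow_smul_resolvent hρ hS m
  have h1 := apply_circleIntegral (ContinuousLinearMap.mul ℂ 𝔸 a) hi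
  simp only [ContinuousLinearMap.mul_apply'] at h1
  have h0 : (0 : ℂ) ∉ sphere (0 : ℂ) ρ := by simp [hρ.ne]
  have h2 : (∮ z in C(0, ρ), a * (z ^ m • resolvent a z)) =
      ∮ z in C(0, ρ), z ^ (m + 1) • resolvent a z - z ^ m • (1 : 𝔸) := by
    refine circleIntegral.integral_congr hρ.le fun z hz => ?_
    have hz0 : z ≠ 0 := ne_of_mem_of_not_mem hz h0
    have h3 : (algebraMap ℂ 𝔸 z - a) * resolvent a z = 1 := Ring.mul_inverse_cancel _ (hS hz)
    rw [sub_mul, Algebra.algebraMap_eq_smul_one, smul_mul_assoc, one_mul] at h3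
    change a * (z ^ m • resolvent a z) = z ^ (m + 1) • resolvent a z - z ^ m • (1 : 𝔸)
    rw [← h3, mul_smul_comm, zpow_add_one₀ hz0, mul_smul, smul_sub, sub_sub_cancel]
  have h4 : CircleIntegrable (fun z : ℂ => z ^ m • (1 : 𝔸)) 0 ρ := by
    refine ContinuousOn.circleIntegrable hρ.le fun z hz => ?_
    exact ((continuousAt_zpow₀ z m (Or.inl (ne_of_mem_of_not_mem hz h0))).smul
      continuousAt_const).continuousWithinAt
  rw [resolventMoment, mul_smul_comm, h1, h2,
    circleIntegral.integral_sub (circleIntegrable_zpow_smul_resolvent hρ hS (m + 1)) h4, smul_sub,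
    ← resolventMoment, circleIntegral.integral_smul_const]
  congr 1
  split_ifs with hm
  · have h5 := circleIntegral.integral_sub_center_inv 0 hρ.ne'
    simp only [sub_zero] at h5
    simp only [hm, zpow_neg_one, h5]
    rw [smul_smul, inv_mul_cancel₀ Complex.two_pi_I_ne_zero, one_smul]
  · have h5 := circleIntegral.integral_sub_zpow_of_ne hm 0 0 ρ
    simp only [sub_zero] at h5
    rw [h5, zero_smul, smul_zero]

theorem exists_norm_resolventMoment_le {a : 𝔸} {ρ : ℝ} (hρ : 0 < ρ)
    (hS : sphere 0 ρ ⊆ resolventSet ℂ a) :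
    ∃ C, 0 ≤ C ∧ ∀ m : ℤ, ‖resolventMoment a ρ m‖ ≤ C * ρ ^ m := by
  obtain ⟨C, hC⟩ := (isCompact_sphere (0 : ℂ) ρ).exists_bound_of_continuousOn
    (continuousOn_zpow_smul_resolvent hS (by simp [hρ.ne]) 0)
  refine ⟨ρ * max C 0, by positivity, fun m => ?_⟩
  refine (circleIntegral.norm_two_pi_i_inv_smul_integral_le_of_norm_le_const (C := ρ ^ m * max C 0)
    hρ.le fun z hz => ?_).trans (le_of_eq (by ring))
  have := hC z hz
  rw [zpow_zero, one_smul] at this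
  rw [norm_smul, norm_zpow, mem_sphere_zero_iff_norm.1 hz]
  gcongr
  exact this.trans (le_max_left _ _)

theorem exists_annulus_subset_resolventSet {a : 𝔸} {s : ℝ} (hs : 0 < s)
    (ha : ∀ μ ∈ spectrum ℂ a, ‖μ‖ ≠ s) :
    ∃ s₁ s₂, 0 < s₁ ∧ s₁ < s ∧ s < s₂ ∧
      ∀ z : ℂ, s₁ ≤ ‖z‖ → ‖z‖ ≤ s₂ → z ∈ resolventSet ℂ a := by
  have hcl : IsClosed (norm '' spectrum ℂ a) := ((spectrum.isCompact a).image continuous_norm).isClosed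
  have hmem : (norm '' spectrum ℂ a)ᶜ ∈ 𝓝 s := hcl.isOpen_compl.mem_nhds (by
    rintro ⟨μ, hμ, h⟩
    exact ha μ hμ h)
  obtain ⟨ε, hε, h⟩ := Metric.mem_nhds_iff.1 hmem
  refine ⟨max (s / 2) (s - ε / 2), s + ε / 2, by positivity, max_lt (by linarith) (by linarith),
    by linarith, fun z h1 h2 => ?_⟩
  by_contra hz
  refine h (a := ‖z‖) ?_ ⟨z, hz, rfl⟩
  have := (le_max_right _ _).trans h1
  rw [Metric.mem_ball, Real.dist_eq, abs_lt]
  constructor <;> linarith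

/-- The Riesz decomposition of a Banach algebra element with respect to a circle which does not
meet its spectrum. -/
theorem exists_riesz_splitting {a : 𝔸} {s : ℝ} (hs : 0 < s)
    (ha : ∀ μ ∈ spectrum ℂ a, ‖μ‖ ≠ s) :
    ∃ (s₁ s₂ C : ℝ) (q : 𝔸) (v : ℕ → 𝔸), 0 < s₁ ∧ s₁ < s ∧ s < s₂ ∧ 0 < C ∧ Commute a q ∧
      (∀ n, Commute a (v n)) ∧ (∀ n, ‖a ^ n * q‖ ≤ C * s₁ ^ n) ∧
      (∀ n, 1 - q = a ^ (n + 1) * v n) ∧ (∀ n, ‖v n‖ ≤ C * (s₂ ^ n)⁻¹) ∧ q * q = q := by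
  obtain ⟨s₁, s₂, h0, h1, h2, hS⟩ := exists_annulus_subset_resolventSet hs ha
  have h02 : 0 < s₂ := hs.trans h2
  have hS₁ : sphere 0 s₁ ⊆ resolventSet ℂ a := fun z hz => by
    rw [mem_sphere_zero_iff_norm] at hz
    exact hS z hz.ge (hz.le.trans (h1.trans h2).le)
  have hS₂ : sphere 0 s₂ ⊆ resolventSet ℂ a := fun z hz => by
    rw [mem_sphere_zero_iff_norm] at hz
    exact hS z ((h1.trans h2).le.trans hz.ge) hz.le
  obtain ⟨C₁, hC₁, hb₁⟩ := exists_norm_resolventMoment_le h0 hS₁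
  obtain ⟨C₂, hC₂, hb₂⟩ := exists_norm_resolventMoment_le h02 hS₂
  have heq := resolventMoment_eq h0 (h1.trans h2).le hS
  set q := resolventMoment a s₁ 0 with hq
  set v : ℕ → 𝔸 := fun n => -resolventMoment a s₂ (-(n + 1 : ℕ)) with hv
  set C := C₁ + C₂ * s₂⁻¹ + 1 with hC
  have hCpos : 0 < C := by positivity
  have hCq : Commute a q := commute_resolventMoment h0 hS₁ 0
  have hCv : ∀ n, Commute a (v n) := fun n => (commute_resolventMoment h02 hS₂ _).neg_right
  have hn₁ : ∀ n : ℕ, a ^ n * q = resolventMoment a s₁ n := fun n => by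
    induction n with
    | zero => simp [hq]
    | succ n ih =>
      rw [pow_succ', mul_assoc, ih, mul_resolventMoment h0 hS₁, if_neg (by omega), sub_zero]
      push_cast
      rfl
  have hbq : ∀ n, ‖a ^ n * q‖ ≤ C * s₁ ^ n := fun n => by
    rw [hn₁]
    refine (hb₁ n).trans ?_
    rw [zpow_natCast]
    gcongr
    have : 0 ≤ C₂ * s₂⁻¹ := by positivity
    linarith
  have hpv : ∀ n, 1 - q = a ^ (n + 1) * v n := fun n => by
    induction n with
    | zero =>
      have := mul_resolventMoment h02 hS₂ (-1)
      rw [if_pos rfl, neg_add_cancel, heq 0] at this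
      simp only [hv]
      rw [zero_add, pow_one, mul_neg, Nat.cast_one, this, neg_sub]
    | succ n ih =>
      have := mul_resolventMoment h02 hS₂ (-((n + 1 + 1 : ℕ) : ℤ))
      rw [if_neg (by push_cast; omega), sub_zero] at this
      rw [ih, pow_succ a (n + 1), mul_assoc]
      congr 1
      simp only [hv]
      rw [mul_neg, this]
      congr 2
  have hbv : ∀ n, ‖v n‖ ≤ C * (s₂ ^ n)⁻¹ := fun n => by
    simp only [hv, norm_neg]
    refine (hb₂ _).trans ?_
    rw [zpow_neg, zpow_natCast, pow_succ', mul_inv, ← mul_assoc]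
    gcongr
    linarith
  refine ⟨s₁, s₂, C, q, v, h0, h1, h2, hCpos, hCq, hCv, hbq, hpv, hbv, ?_⟩
  have hle : ∀ n : ℕ, ‖q - q * q‖ ≤ C * s₁ * C * (s₁ / s₂) ^ n := fun n => by
    have : q - q * q = a ^ (n + 1) * q * v n := by
      rw [(hCq.pow_left (n + 1)).eq, mul_assoc, ← hpv n, mul_sub, mul_one]
    rw [this]
    calc _ ≤ ‖a ^ (n + 1) * q‖ * ‖v n‖ := norm_mul_le _ _
      _ ≤ C * s₁ ^ (n + 1) * (C * (s₂ ^ n)⁻¹) :=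
        mul_le_mul (hbq _) (hbv n) (norm_nonneg _) (by positivity)
      _ = _ := by
        rw [div_pow, pow_succ]
        ring
  have ht : Tendsto (fun n : ℕ => C * s₁ * C * (s₁ / s₂) ^ n) atTop (𝓝 (C * s₁ * C * 0)) :=
    (tendsto_pow_atTop_nhds_zero_of_lt_one (by positivity)
      ((div_lt_one h02).2 (h1.trans h2))).const_mul _
  have h3 := ge_of_tendsto' ht hle
  rw [mul_zero, norm_le_zero_iff, sub_eq_zero] at h3
  exact h3.symm

end RieszSplitting

section SpectrumCommute

theorem exists_of_mem_spectrum_sub {𝔹 : Type*} [NormedCommRing 𝔹] [NormedAlgebra ℂ 𝔹]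
    [CompleteSpace 𝔹] {a b : 𝔹} {z : ℂ} (hz : z ∈ spectrum ℂ (a - b)) :
    ∃ x ∈ spectrum ℂ a, ∃ y ∈ spectrum ℂ b, x - y = z := by
  obtain ⟨f, rfl⟩ := WeakDual.CharacterSpace.mem_spectrum_iff_exists.1 hz
  exact ⟨f a, AlgHom.apply_mem_spectrum f a, f b, AlgHom.apply_mem_spectrum f b,
    (map_sub f a b).symm⟩

variable {𝔸 : Type*} [NormedRing 𝔸] [NormedAlgebra ℂ 𝔸]

theorem spectrum_mul_left_subset (a : 𝔸) :
    spectrum ℂ (ContinuousLinearMap.mul ℂ 𝔸 a) ⊆ spectrum ℂ a := by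
  intro z hz
  by_contra h
  obtain ⟨u, hu⟩ := spectrum.notMem_iff.1 h
  refine hz ⟨⟨ContinuousLinearMap.mul ℂ 𝔸 u, ContinuousLinearMap.mul ℂ 𝔸 ↑u⁻¹, ?_, ?_⟩, ?_⟩
  · ext x; simp [← mul_assoc]
  · ext x; simp [← mul_assoc]
  · ext x; simp [hu, Algebra.algebraMap_eq_smul_one]

theorem spectrum_mul_right_subset (a : 𝔸) :
    spectrum ℂ ((ContinuousLinearMap.mul ℂ 𝔸).flip a) ⊆ spectrum ℂ a := by
  intro z hz
  by_contra h
  obtain ⟨u, hu⟩ := spectrum.notMem_iff.1 h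
  refine hz ⟨⟨(ContinuousLinearMap.mul ℂ 𝔸).flip u, (ContinuousLinearMap.mul ℂ 𝔸).flip ↑u⁻¹,
    ?_, ?_⟩, ?_⟩
  · ext x; simp [mul_assoc]
  · ext x; simp [mul_assoc]
  · ext x; simp [hu, Algebra.algebraMap_eq_smul_one]

variable [CompleteSpace 𝔸]

theorem spectrum_eq_of_countable (S : Subalgebra ℂ 𝔸) (hS : IsClosed (S : Set 𝔸)) (x : S)
    (hx : (spectrum ℂ (x : 𝔸)).Countable) : spectrum ℂ x = spectrum ℂ (x : 𝔸) :=
  have : IsClosed (S : Set 𝔸) := hS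
  Subalgebra.spectrum_eq_of_isPreconnected_compl S x
    (hx.isConnected_compl_of_one_lt_rank (by simp [Complex.rank_real_complex])).isPreconnected

theorem exists_of_mem_spectrum_sub_of_subalgebra (S : Subalgebra ℂ 𝔸) (hS : IsClosed (S : Set 𝔸))
    (hcomm : ∀ x ∈ S, ∀ y ∈ S, x * y = y * x) (a b : S) {z : ℂ}
    (hz : z ∈ spectrum ℂ ((a : 𝔸) - b)) :
    ∃ x ∈ spectrum ℂ a, ∃ y ∈ spectrum ℂ b, x - y = z := by
  let : NormedCommRing S :=
    { (inferInstance : NormedRing S) with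
      mul_comm := fun x y => Subtype.ext (hcomm x x.2 y y.2) }
  have : CompleteSpace S := hS.completeSpace_coe
  exact exists_of_mem_spectrum_sub (spectrum.subset_subalgebra (a - b) hz)

theorem Commute.countable_spectrum_sub {a b : 𝔸} (hab : Commute a b)
    (ha : (spectrum ℂ a).Countable) (hb : (spectrum ℂ b).Countable) :
    (spectrum ℂ (a - b)).Countable := by
  obtain ⟨S, hS, hcomm, haS, hbS⟩ : ∃ S : Subalgebra ℂ 𝔸, IsClosed (S : Set 𝔸) ∧
      (∀ x ∈ S, ∀ y ∈ S, x * y = y * x) ∧ a ∈ S ∧ b ∈ S :=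
    ⟨Subalgebra.centralizer ℂ (Set.centralizer {a, b}), Set.isClosed_centralizer _,
      Set.centralizer_centralizer_comm_of_comm (by
        rintro x (rfl | rfl) y (rfl | rfl)
        exacts [rfl, hab.eq, hab.eq.symm, rfl]),
      Set.subset_centralizer_centralizer (mem_insert a _),
      Set.subset_centralizer_centralizer (mem_insert_of_mem a rfl)⟩
  refine (ha.image2 hb (· - ·)).mono fun z hz => ?_
  obtain ⟨x, hx, y, hy, rfl⟩ :=
    exists_of_mem_spectrum_sub_of_subalgebra S hS hcomm ⟨a, haS⟩ ⟨b, hbS⟩ hz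
  have h1 := spectrum_eq_of_countable S hS ⟨a, haS⟩ ha
  have h2 := spectrum_eq_of_countable S hS ⟨b, hbS⟩ hb
  exact ⟨x, h1 ▸ hx, y, h2 ▸ hy, rfl⟩

/-- The inner derivation by an element with countable spectrum, restricted to a closed invariant
subspace, has countable spectrum. -/
theorem countable_spectrum_inner {Y : Type*} [NormedAddCommGroup Y] [NormedSpace ℂ Y]
    [CompleteSpace Y] (ι : Y →ₗᵢ[ℂ] 𝔸) {b : 𝔸} (hb : (spectrum ℂ b).Countable) {D : Y →L[ℂ] Y}
    (hD : ∀ y, ι (D y) = b * ι y - ι y * b) : (spectrum ℂ D).Countable := by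
  set Δ : 𝔸 →L[ℂ] 𝔸 := ContinuousLinearMap.mul ℂ 𝔸 b - (ContinuousLinearMap.mul ℂ 𝔸).flip b with hΔ
  have hΔc : (spectrum ℂ Δ).Countable := Commute.countable_spectrum_sub
    (by ext x; simp [mul_assoc]) (hb.mono (spectrum_mul_left_subset b))
    (hb.mono (spectrum_mul_right_subset b))
  have hιΔ : ∀ y, Δ (ι y) = ι (D y) := fun y => by simp [hΔ, hD]
  have hcl : IsClosed (range ι) := ι.isometry.isClosedEmbedding.isClosed_range
  let S : Subalgebra ℂ (𝔸 →L[ℂ] 𝔸) :=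
    { carrier := {Φ | ∀ y, Φ (ι y) ∈ range ι}
      mul_mem' := fun {Φ Ψ} hΦ hΨ y => by
        obtain ⟨w, hw⟩ := hΨ y
        change Φ (Ψ (ι y)) ∈ _
        rw [← hw]
        exact hΦ w
      add_mem' := fun {Φ Ψ} hΦ hΨ y => by
        obtain ⟨w, hw⟩ := hΨ y
        obtain ⟨w', hw'⟩ := hΦ y
        exact ⟨w' + w, by simp [hw, hw']⟩
      algebraMap_mem' := fun c y => ⟨c • y, by simp [Algebra.algebraMap_eq_smul_one]⟩ }
  have hS : IsClosed (S : Set (𝔸 →L[ℂ] 𝔸)) := by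
    have : (S : Set (𝔸 →L[ℂ] 𝔸)) =
        ⋂ y, (fun Φ : 𝔸 →L[ℂ] 𝔸 => Φ (ι y)) ⁻¹' range ι := by
      ext Φ
      simp only [mem_iInter]
      rfl
    rw [this]
    exact isClosed_iInter fun y =>
      hcl.preimage (ContinuousLinearMap.apply ℂ 𝔸 (ι y)).continuous
  have hΔS : Δ ∈ S := fun y => ⟨D y, (hιΔ y).symm⟩
  refine hΔc.mono fun z hz => ?_
  rw [← spectrum_eq_of_countable S hS ⟨Δ, hΔS⟩ hΔc]
  by_contra h
  obtain ⟨u, hu⟩ := spectrum.notMem_iff.1 h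
  have hu' : ((u : S) : 𝔸 →L[ℂ] 𝔸) = algebraMap ℂ _ z - Δ := by rw [hu]; rfl
  have hl : ∀ x, ((u⁻¹ : Sˣ) : S).1 (z • x - Δ x) = x := fun x => by
    have := congrArg (fun Φ : S => Φ.1 x) u.inv_mul
    change ((u⁻¹ : Sˣ) : S).1 (((u : S) : 𝔸 →L[ℂ] 𝔸) x) = x at this
    rwa [hu'] at this
  have hr : ∀ x, z • ((u⁻¹ : Sˣ) : S).1 x - Δ (((u⁻¹ : Sˣ) : S).1 x) = x := fun x => by
    have := congrArg (fun Φ : S => Φ.1 x) u.mul_inv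
    change ((u : S) : 𝔸 →L[ℂ] 𝔸) (((u⁻¹ : Sˣ) : S).1 x) = x at this
    rwa [hu'] at this
  refine hz (ContinuousLinearMap.isUnit_iff_bijective.2 ⟨fun x y hxy => ?_, fun y => ?_⟩)
  · have hxy' : z • x - D x = z • y - D y := by
      simpa [Algebra.algebraMap_eq_smul_one] using hxy
    apply ι.injective
    rw [← hl (ι x), ← hl (ι y), hιΔ, hιΔ, ← map_smul, ← map_smul, ← map_sub, ← map_sub, hxy']
  · obtain ⟨w, hw⟩ := ((u⁻¹ : Sˣ) : S).2 y
    refine ⟨w, ι.injective ?_⟩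
    have := hr (ι y)
    rw [← hw, hιΔ, ← map_smul, ← map_sub] at this
    rw [← this]
    simp [Algebra.algebraMap_eq_smul_one]

end SpectrumCommute

section LinearAlgebra

variable {E : Type*} [AddCommGroup E] [Module ℂ E] [FiniteDimensional ℂ E]

theorem isNilpotent_of_forall_hasEigenvalue {f : Module.End ℂ E}
    (hf : ∀ μ, f.HasEigenvalue μ → μ = 0) : IsNilpotent f := by
  have h : f.charpoly.roots = Multiset.replicate (Multiset.card f.charpoly.roots) 0 :=
    Multiset.eq_replicate.2 ⟨rfl, fun μ hμ =>
      hf μ ((Module.End.hasEigenvalue_iff_isRoot_charpoly f μ).2 (Polynomial.isRoot_of_mem_roots hμ))⟩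
  have h1 := (IsAlgClosed.splits f.charpoly).eq_prod_roots_of_monic f.charpoly_monic
  rw [h, Multiset.map_replicate, Multiset.prod_replicate, map_zero, sub_zero] at h1
  refine ⟨Multiset.card f.charpoly.roots, ?_⟩
  have h2 := f.aeval_self_charpoly
  rwa [h1, map_pow, Polynomial.aeval_X] at h2

/-- Engel's theorem for a Lie algebra of endomorphisms without nonzero eigenvalues. -/
theorem exists_common_null_vector [Nontrivial E] (I : Submodule ℂ (Module.End ℂ E))
    (hI : ∀ f ∈ I, ∀ g ∈ I, f * g - g * f ∈ I)
    (hnil : ∀ f ∈ I, ∀ μ, f.HasEigenvalue μ → μ = 0) :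
    ∃ x : E, x ≠ 0 ∧ ∀ f ∈ I, f x = 0 := by
  let : LieRing (Module.End ℂ E) := LieRing.ofAssociativeRing
  let K : LieSubalgebra ℂ (Module.End ℂ E) :=
    { I with lie_mem' := fun {f g} hf hg => hI f hf g hg }
  have : LieModule.IsNilpotent K E := (LieModule.isNilpotent_iff_forall' (R := ℂ)).2 fun f => by
    have := isNilpotent_of_forall_hasEigenvalue (hnil f.1 f.2)
    exact this
  have := LieModule.nontrivial_max_triv_of_isNilpotent ℂ K E
  obtain ⟨x, hx⟩ := exists_ne (0 : LieModule.maxTrivSubmodule ℂ K E)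
  exact ⟨x, fun h => hx (Subtype.ext h), fun f hf =>
    (LieModule.mem_maxTrivSubmodule (R := ℂ) (L := K) (M := E) x.1).1 x.2 ⟨f, hf⟩⟩

open Polynomial in
/-- An endomorphism with a nonzero fixed vector has a positive power with nonzero trace. -/
theorem eq_zero_of_trace_pow_eq_zero {f : Module.End ℂ E}
    (htr : ∀ n : ℕ, LinearMap.trace ℂ E (f ^ (n + 1)) = 0) {x : E} (hx : f x = x) : x = 0 := by
  have htr' : ∀ g : ℂ[X], LinearMap.trace ℂ E (aeval f (g * X)) = 0 := fun g => by
    induction g using Polynomial.induction_on' with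
    | add p q hp hq => rw [add_mul, map_add, map_add, hp, hq, add_zero]
    | monomial n c =>
      rw [monomial_mul_X, aeval_monomial, ← Algebra.smul_def, map_smul, htr, smul_zero]
  obtain ⟨h, hh, hroot⟩ := exists_eq_pow_rootMultiplicity_mul_and_not_dvd f.charpoly
    f.charpoly_monic.ne_zero 1
  set m := rootMultiplicity 1 f.charpoly with hm
  have hcop : IsCoprime ((X - C (1 : ℂ)) ^ m) (h * X) := by
    refine IsCoprime.pow_left ?_
    rw [(prime_X_sub_C (1 : ℂ)).irreducible.coprime_iff_not_dvd, dvd_iff_isRoot, IsRoot.def,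
      eval_mul, eval_X, mul_one, ← IsRoot.def, ← dvd_iff_isRoot]
    exact hroot
  obtain ⟨u, w, huw⟩ := hcop
  set e := aeval f (w * (h * X)) with he
  have he1 : e * (1 - e) = 0 := by
    have : w * (h * X) * (1 - w * (h * X)) = w * u * X * f.charpoly := by
      rw [← huw, hh]
      ring
    have h2 := congrArg (aeval f) this
    rwa [map_mul, map_mul _ _ f.charpoly, LinearMap.aeval_self_charpoly, mul_zero, map_sub,
      map_one] at h2
  have he2 : IsIdempotentElem e := by
    rw [mul_sub, mul_one, sub_eq_zero] at he1
    exact he1.symm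
  have he0 : e = 0 := LinearMap.IsIdempotentElem.eq_zero_of_trace_eq_zero he2 (by
    rw [he, ← mul_assoc]
    exact htr' _)
  by_contra hx0
  have hroot1 : f.charpoly.IsRoot 1 := (Module.End.hasEigenvalue_iff_isRoot_charpoly f 1).1
    (Module.End.hasEigenvalue_of_hasEigenvector (x := x)
      ⟨Module.End.mem_eigenspace_iff.2 (by rw [hx, one_smul]), hx0⟩)
  have hm0 : 0 < m := (rootMultiplicity_pos f.charpoly_monic.ne_zero).2 hroot1
  have h3 : e x = (1 : ℂ) • x := by
    have hev : ∀ p : ℂ[X], aeval f p x = p.eval 1 • x := fun p => by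
      induction p using Polynomial.induction_on' with
      | add p q hp hq => simp [hp, hq, add_smul]
      | monomial n c =>
        have : (f ^ n) x = x := by
          induction n with
          | zero => simp
          | succ n ih => rw [pow_succ, Module.End.mul_apply, hx, ih]
        simp [aeval_monomial, this]
    rw [he, hev]
    have := congrArg (eval 1) huw
    simp only [eval_add, eval_mul, eval_pow, eval_sub, eval_X, eval_C, sub_self, zero_pow hm0.ne',
      mul_zero, zero_add, eval_one] at this
    simp only [eval_mul, eval_X, this]
  rw [he0, one_smul] at h3
  exact hx0 h3.symm

end LinearAlgebra

section AdjointRiesz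

variable {𝔸 : Type*} [NormedRing 𝔸]

theorem norm_mul_commutator_iterate_mul_le {b q : 𝔸} {C s : ℝ} (hbq : Commute b q) (hs : 0 ≤ s)
    (hC : 0 ≤ C) (hq : ∀ n, ‖b ^ n * q‖ ≤ C * s ^ n) (n : ℕ) (w : 𝔸) (i j : ℕ) :
    ‖q * b ^ i * (fun x => b * x - x * b)^[n] w * (b ^ j * q)‖ ≤
      C ^ 2 * s ^ (i + j) * (2 * s) ^ n * ‖w‖ := by
  induction n generalizing i j with
  | zero =>
    rw [Function.iterate_zero_apply, ← (hbq.pow_left i).eq]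
    calc _ ≤ ‖b ^ i * q‖ * ‖w‖ * ‖b ^ j * q‖ := norm_mul₃_le
      _ ≤ C * s ^ i * ‖w‖ * (C * s ^ j) := by
        gcongr
        exacts [hq i, hq j]
      _ = _ := by ring
  | succ n ih =>
    rw [Function.iterate_succ_apply']
    set u := (fun x => b * x - x * b)^[n] w
    have : q * b ^ i * (b * u - u * b) * (b ^ j * q) =
        q * b ^ (i + 1) * u * (b ^ j * q) - q * b ^ i * u * (b ^ (j + 1) * q) := by
      rw [pow_succ b i, pow_succ' b j]
      noncomm_ring
    rw [this]
    refine (norm_sub_le _ _).trans ((add_le_add (ih (i + 1) j) (ih i (j + 1))).trans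
      (le_of_eq ?_))
    ring

/-- Compressing an element in the outer spectral subspace of the inner derivation by `b` to an inner
spectral subspace of `b` of less than half the radius yields zero. -/
theorem mul_mul_eq_zero_of_commutator_iterate {b q r : 𝔸} {C s c K : ℝ} (hbq : Commute b q)
    (hs : 0 ≤ s) (hC : 0 ≤ C) (hq : ∀ n, ‖b ^ n * q‖ ≤ C * s ^ n) (hsc : 2 * s < c) {w : ℕ → 𝔸}
    (hr : ∀ n, r = (fun x => b * x - x * b)^[n + 1] (w n)) (hw : ∀ n, ‖w n‖ ≤ K * (c ^ n)⁻¹) :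
    q * r * q = 0 := by
  have hc : 0 < c := by linarith
  have hle : ∀ n : ℕ, ‖q * r * q‖ ≤ C ^ 2 * (2 * s) * K * (2 * s / c) ^ n := fun n => by
    have := norm_mul_commutator_iterate_mul_le hbq hs hC hq (n + 1) (w n) 0 0
    simp only [pow_zero, mul_one, one_mul, add_zero, ← hr n] at this
    refine this.trans ?_
    calc _ ≤ C ^ 2 * (2 * s) ^ (n + 1) * (K * (c ^ n)⁻¹) := by
          gcongr
          exact hw n
      _ = _ := by
        rw [div_pow, pow_succ]
        ring
  have ht : Tendsto (fun n : ℕ => C ^ 2 * (2 * s) * K * (2 * s / c) ^ n) atTop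
      (𝓝 (C ^ 2 * (2 * s) * K * 0)) :=
    (tendsto_pow_atTop_nhds_zero_of_lt_one (by positivity) ((div_lt_one hc).2 hsc)).const_mul _
  have := ge_of_tendsto' ht hle
  rwa [mul_zero, norm_le_zero_iff] at this

theorem norm_mul_commutator_iterate_mul_pow_le {b q x : 𝔸} {C s C' c : ℝ} (hbq : Commute b q)
    (hs : 0 ≤ s) (hC : 0 ≤ C) (hq : ∀ n, ‖b ^ n * q‖ ≤ C * s ^ n)
    (hx : ∀ k, ‖(fun x => b * x - x * b)^[k] x‖ ≤ C' * c ^ k) (n i k : ℕ) (y : 𝔸) :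
    ‖q * b ^ i * (fun x => b * x - x * b)^[k] x * (b ^ n * y)‖ ≤
      C * s ^ i * (C' * c ^ k) * (s + c) ^ n * ‖y‖ := by
  induction n generalizing i k with
  | zero =>
    rw [pow_zero, one_mul, pow_zero, mul_one, ← (hbq.pow_left i).eq]
    calc _ ≤ ‖b ^ i * q‖ * ‖(fun x => b * x - x * b)^[k] x‖ * ‖y‖ := norm_mul₃_le
      _ ≤ _ := by
        gcongr
        exacts [hq i, hx k]
  | succ n ih =>
    have h1 := ih (i + 1) k
    have h2 := ih i (k + 1)
    rw [Function.iterate_succ_apply'] at h2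
    set u := (fun x => b * x - x * b)^[k] x
    have : q * b ^ i * u * (b ^ (n + 1) * y) = q * b ^ (i + 1) * u * (b ^ n * y) -
        q * b ^ i * (b * u - u * b) * (b ^ n * y) := by
      rw [pow_succ b i, pow_succ' b n]
      noncomm_ring
    rw [this]
    refine (norm_sub_le _ _).trans ((add_le_add h1 h2).trans (le_of_eq ?_))
    ring

/-- If the iterated commutators of `b` with `x` grow slowly, then `x` maps the outer spectral
subspace of `b` into itself. -/
theorem mul_mul_one_sub_eq_zero {b q x : 𝔸} {C s C' c s₂ : ℝ} {v : ℕ → 𝔸} (hbq : Commute b q)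
    (hs : 0 ≤ s) (hC : 0 ≤ C) (hc : 0 ≤ c) (hC' : 0 ≤ C') (hq : ∀ n, ‖b ^ n * q‖ ≤ C * s ^ n)
    (hx : ∀ k, ‖(fun x => b * x - x * b)^[k] x‖ ≤ C' * c ^ k) (hcs : s + c < s₂)
    (hp : ∀ n, 1 - q = b ^ (n + 1) * v n) (hv : ∀ n, ‖v n‖ ≤ C * (s₂ ^ n)⁻¹) :
    q * x * (1 - q) = 0 := by
  have hs₂ : 0 < s₂ := by linarith
  have hle : ∀ n : ℕ, ‖q * x * (1 - q)‖ ≤ C * C' * (s + c) * C * ((s + c) / s₂) ^ n := fun n => by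
    have := norm_mul_commutator_iterate_mul_pow_le hbq hs hC hq hx (n + 1) 0 0 (v n)
    simp only [pow_zero, mul_one, Function.iterate_zero_apply, ← hp n] at this
    refine this.trans ?_
    calc _ ≤ C * C' * (s + c) ^ (n + 1) * (C * (s₂ ^ n)⁻¹) := by
          gcongr
          exact hv n
      _ = _ := by
        rw [div_pow, pow_succ]
        ring
  have ht : Tendsto (fun n : ℕ => C * C' * (s + c) * C * ((s + c) / s₂) ^ n) atTop
      (𝓝 (C * C' * (s + c) * C * 0)) :=
    (tendsto_pow_atTop_nhds_zero_of_lt_one (by positivity) ((div_lt_one hs₂).2 hcs)).const_mul _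
  have := ge_of_tendsto' ht hle
  rwa [mul_zero, norm_le_zero_iff] at this

end AdjointRiesz

section NonVolterra

theorem exists_radius_spectrum {𝔸 : Type*} [NormedRing 𝔸] [NormedAlgebra ℂ 𝔸] {a : 𝔸}
    (ha : (spectrum ℂ a).Countable) {s t : ℝ} (hst : s < t) :
    ∃ r, s < r ∧ r < t ∧ ∀ μ ∈ spectrum ℂ a, ‖μ‖ ≠ r := by
  obtain ⟨r, h1, h2, h⟩ := exists_radius_avoiding ha 0 hst
  exact ⟨r, h1, h2, by simpa using h⟩

/-- The Riesz decomposition of the restriction of an inner derivation to a closed invariant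
subspace. -/
theorem exists_riesz_splitting_inner {𝔸 Y : Type*} [NormedRing 𝔸] [NormedAlgebra ℂ 𝔸]
    [CompleteSpace 𝔸] [NormedAddCommGroup Y] [NormedSpace ℂ Y] [CompleteSpace Y] (ι : Y →ₗᵢ[ℂ] 𝔸)
    {b : 𝔸} (hb : (spectrum ℂ b).Countable) (hι : ∀ y, ∃ w, ι w = b * ι y - ι y * b) {c : ℝ}
    (hc : 0 < c) :
    ∃ c₁ c₂, 0 < c₁ ∧ c₁ < c ∧ 0 < c₂ ∧ ∀ y, ∃ (r : Y) (C : ℝ) (w : ℕ → 𝔸), 0 ≤ C ∧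
      (∀ n, ι r = (fun x => b * x - x * b)^[n + 1] (w n)) ∧ (∀ n, ‖w n‖ ≤ C * (c₂ ^ n)⁻¹) ∧
      (r = 0 → ∀ k, ‖(fun x => b * x - x * b)^[k] (ι y)‖ ≤ C * c₁ ^ k) := by
  obtain ⟨D, -, hD⟩ := exists_inner_derivation ι hι
  have hDc : (spectrum ℂ D).Countable := countable_spectrum_inner ι hb hD
  have hiter : ∀ k y, (fun x => b * x - x * b)^[k] (ι y) = ι ((D ^ k) y) := by
    intro k
    induction k with
    | zero => intro y; rfl
    | succ k ih =>
      intro y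
      rw [Function.iterate_succ_apply, pow_succ]
      exact (congrArg _ (hD y).symm).trans (ih (D y))
  obtain ⟨c₀, h0, h1, hc₀⟩ := exists_radius_spectrum hDc hc
  obtain ⟨d₁, d₂, C, q, v, hd0, hd1, hd2, hC, -, -, hq, hp, hv, -⟩ :=
    exists_riesz_splitting h0 hc₀
  refine ⟨d₁, d₂, hd0, hd1.trans h1, h0.trans hd2, fun y => ⟨(1 - q) y,
    C * ‖y‖, fun n => ι (v n y), by positivity, fun n => ?_, fun n => ?_, fun h k => ?_⟩⟩
  · rw [hiter, hp n]
    rfl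
  · rw [ι.norm_map]
    refine ((v n).le_opNorm y).trans ?_
    calc _ ≤ C * (d₂ ^ n)⁻¹ * ‖y‖ := by
          gcongr
          exact hv n
      _ = _ := by ring
  · have hqy : q y = y := (sub_eq_zero.1 h).symm
    have h2 : (D ^ k) y = (D ^ k * q) y := congrArg (D ^ k) hqy.symm
    rw [hiter, ι.norm_map, h2]
    refine ((D ^ k * q).le_opNorm y).trans ?_
    calc _ ≤ C * d₁ ^ k * ‖y‖ := by
          gcongr
          exact hq k
      _ = _ := by ring

theorem exists_riesz_splitting_of_commutator_mem {𝔸 : Type*} [NormedRing 𝔸] [NormedAlgebra ℂ 𝔸]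
    [CompleteSpace 𝔸] {I : Submodule ℂ 𝔸} (hI : IsClosed (I : Set 𝔸)) {b : 𝔸}
    (hb : (spectrum ℂ b).Countable) (hbI : ∀ y ∈ I, b * y - y * b ∈ I) {c : ℝ} (hc : 0 < c) :
    ∃ c₁ c₂, 0 < c₁ ∧ c₁ < c ∧ 0 < c₂ ∧ ∀ y ∈ I, ∃ r ∈ I, ∃ (C : ℝ) (w : ℕ → 𝔸), 0 ≤ C ∧
      (∀ n, r = (fun x => b * x - x * b)^[n + 1] (w n)) ∧ (∀ n, ‖w n‖ ≤ C * (c₂ ^ n)⁻¹) ∧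
      (r = 0 → ∀ k, ‖(fun x => b * x - x * b)^[k] y‖ ≤ C * c₁ ^ k) := by
  have : CompleteSpace I := hI.completeSpace_coe
  obtain ⟨c₁, c₂, h0, h1, h2, h⟩ := exists_riesz_splitting_inner I.subtypeₗᵢ hb
    (fun y => ⟨⟨_, hbI y y.2⟩, rfl⟩) hc
  refine ⟨c₁, c₂, h0, h1, h2, fun y hy => ?_⟩
  obtain ⟨r, C, w, hC, hr, hw, hk⟩ := h ⟨y, hy⟩
  exact ⟨r, r.2, C, w, hC, hr, hw, fun hr0 => hk (Subtype.ext hr0)⟩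

variable {X : Type*} [NormedAddCommGroup X] [NormedSpace ℂ X]

theorem finiteDimensional_range_of_isIdempotentElem {p : X →L[ℂ] X} (hp : p * p = p)
    (hc : IsCompactOperator p) : FiniteDimensional ℂ (LinearMap.range (p : X →ₗ[ℂ] X)) := by
  have hfix : ∀ x ∈ LinearMap.range (p : X →ₗ[ℂ] X), p x = x := by
    rintro _ ⟨x, rfl⟩
    exact congrArg (fun f : X →L[ℂ] X => f x) hp
  have hcl : IsClosed (LinearMap.range (p : X →ₗ[ℂ] X) : Set X) := by
    have : (LinearMap.range (p : X →ₗ[ℂ] X) : Set X) = {x | p x = x} :=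
      Subset.antisymm hfix fun x hx => ⟨x, hx⟩
    rw [this]
    exact isClosed_eq p.continuous continuous_id
  have hV : ∀ x ∈ LinearMap.range (p : X →ₗ[ℂ] X), (p : X →ₗ[ℂ] X) x ∈
      LinearMap.range (p : X →ₗ[ℂ] X) := fun x _ => ⟨x, rfl⟩
  have hr := IsCompactOperator.restrict (f := (p : X →ₗ[ℂ] X)) hc hV hcl
  refine FiniteDimensional.of_isCompactOperator_id (𝕜 := ℂ) ?_
  convert! hr using 1
  ext x
  exact (hfix x x.2).symm

theorem finiteDimensional_range_of_mul_mul_eq_zero {q r : X →L[ℂ] X}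
    [FiniteDimensional ℂ (LinearMap.range ((1 - q : X →L[ℂ] X) : X →ₗ[ℂ] X))]
    (h : q * r * q = 0) : FiniteDimensional ℂ (LinearMap.range (r : X →ₗ[ℂ] X)) := by
  refine Submodule.finiteDimensional_of_le
    (S₂ := LinearMap.range ((1 - q : X →L[ℂ] X) : X →ₗ[ℂ] X) ⊔
      (LinearMap.range ((1 - q : X →L[ℂ] X) : X →ₗ[ℂ] X)).map ((q * r : X →L[ℂ] X) : X →ₗ[ℂ] X)) ?_
  rintro _ ⟨x, rfl⟩
  have h1 : r = (1 - q) * r + q * r * (1 - q) := by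
    rw [mul_sub, h]
    noncomm_ring
  have h2 : r x = (1 - q) (r x) + (q * r) ((1 - q) x) := congrArg (fun f : X →L[ℂ] X => f x) h1
  exact Submodule.mem_sup.2 ⟨_, ⟨r x, rfl⟩, _, ⟨_, ⟨x, rfl⟩, rfl⟩, h2.symm⟩

variable [CompleteSpace X]

theorem exists_norm_commutator_iterate_le {I : Submodule ℂ (X →L[ℂ] X)}
    (hI : IsClosed (I : Set (X →L[ℂ] X))) {b : X →L[ℂ] X} (hb : IsCompactOperator b)
    (hbI : ∀ S ∈ I, b * S - S * b ∈ I)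
    (hfin : ∀ S ∈ I, FiniteDimensional ℂ (LinearMap.range (S : X →ₗ[ℂ] X)) → S = 0)
    {c : ℝ} (hc : 0 < c) :
    ∃ c', 0 < c' ∧ c' < c ∧ ∀ S ∈ I, ∃ C, 0 ≤ C ∧
      ∀ k, ‖(fun x => b * x - x * b)^[k] S‖ ≤ C * c' ^ k := by
  have hbc := countable_spectrum b hb
  obtain ⟨c₁, c₂, h0, h1, h2, h⟩ := exists_riesz_splitting_of_commutator_mem hI hbc hbI hc
  obtain ⟨s, hs0, hs1, hs⟩ := exists_radius_spectrum hbc (half_pos h2)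
  obtain ⟨s₁, s₂, C', q, v, hs10, hs11, -, hC', hbq, hbv, hq, hp, -, hqq⟩ :=
    exists_riesz_splitting hs0 hs
  have hpc : IsCompactOperator (1 - q : X →L[ℂ] X) := by
    rw [hp 0, zero_add, pow_one]
    exact isCompactOperator_mul_right hb _
  have := finiteDimensional_range_of_isIdempotentElem (p := 1 - q) (by
    rw [sub_mul, mul_sub, mul_sub, hqq]
    noncomm_ring) hpc
  refine ⟨c₁, h0, h1, fun S hS => ?_⟩
  obtain ⟨R, hR, C, w, hC, hRw, hw, hk⟩ := h S hS
  exact ⟨C, hC, hk (hfin R hR (finiteDimensional_range_of_mul_mul_eq_zero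
    (mul_mul_eq_zero_of_commutator_iterate hbq hs10.le hC'.le hq (by linarith) hRw hw)))⟩

theorem eq_zero_of_hasEigenvalue_restrict {S : X →L[ℂ] X} (hS : SpecLE S 0) {E : Submodule ℂ X}
    {f : Module.End ℂ E} (hf : ∀ x : E, (f x : X) = S x) {μ : ℂ} (hμ : f.HasEigenvalue μ) :
    μ = 0 := by
  obtain ⟨x, hx⟩ := hμ.exists_hasEigenvector
  have hmem : μ ∈ spectrum ℂ S := fun h => by
    have hinj := (ContinuousLinearMap.isUnit_iff_bijective.1 h).1
    have : (x : X) = 0 := hinj (by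
      have : S x = μ • (x : X) := by rw [← hf, hx.apply_eq_smul]; rfl
      simp [Algebra.algebraMap_eq_smul_one, this])
    exact hx.2 (Subtype.ext this)
  simpa using hS μ hmem

/-- If `J` contains an operator which is not quasinilpotent, and the ideal `I` of `J` consists of
quasinilpotent operators, then `I` contains a nonzero operator of finite rank or `J` is
reducible. -/
theorem exists_finiteDimensional_range_or_invariant {J I : Submodule ℂ (X →L[ℂ] X)}
    (hI : IsClosed (I : Set (X →L[ℂ] X))) (hIJ : I ≤ J) (hideal : ∀ A ∈ J, ∀ S ∈ I, A * S - S * A ∈ I)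
    (hspec : ∀ S ∈ I, SpecLE S 0) {b : X →L[ℂ] X} (hbJ : b ∈ J) (hb : IsCompactOperator b)
    (hb0 : ¬ SpecLE b 0) {T : X →L[ℂ] X} (hT : T ∈ I) (hT0 : T ≠ 0) :
    (∃ S ∈ I, S ≠ 0 ∧ FiniteDimensional ℂ (LinearMap.range (S : X →ₗ[ℂ] X))) ∨
    ∃ M : Submodule ℂ X, IsClosed (M : Set X) ∧ M ≠ ⊥ ∧ M ≠ ⊤ ∧ ∀ A ∈ J, ∀ x ∈ M, A x ∈ M := by
  by_cases hfin : ∃ S ∈ I, S ≠ 0 ∧ FiniteDimensional ℂ (LinearMap.range (S : X →ₗ[ℂ] X))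
  · exact Or.inl hfin
  refine Or.inr ?_
  have hfin' : ∀ S ∈ I, FiniteDimensional ℂ (LinearMap.range (S : X →ₗ[ℂ] X)) → S = 0 :=
    fun S hS h => by_contra fun h0 => hfin ⟨S, hS, h0, h⟩
  obtain ⟨μ, hμ, hμ0⟩ : ∃ μ ∈ spectrum ℂ b, 0 < ‖μ‖ := by
    simpa [SpecLE] using hb0
  obtain ⟨s, hs0, hs1, hs⟩ := exists_radius_spectrum (countable_spectrum b hb) hμ0
  obtain ⟨s₁, s₂, C, q, v, hs10, hs11, hs2, hC, hbq, hbv, hq, hp, hv, hqq⟩ :=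
    exists_riesz_splitting hs0 hs
  obtain ⟨c, hc0, hc1, hc⟩ := exists_norm_commutator_iterate_le hI hb (hideal b hbJ) hfin'
    (c := s₂ - s₁) (by linarith)
  have hpc : IsCompactOperator (1 - q : X →L[ℂ] X) := by
    rw [hp 0, zero_add, pow_one]
    exact isCompactOperator_mul_right hb _
  have hE := finiteDimensional_range_of_isIdempotentElem (p := 1 - q) (by
    rw [sub_mul, mul_sub, mul_sub, hqq]
    noncomm_ring) hpc
  set E := LinearMap.range ((1 - q : X →L[ℂ] X) : X →ₗ[ℂ] X) with hEdef
  have hp0 : (1 - q : X →L[ℂ] X) ≠ 0 := fun h => by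
    rw [sub_eq_zero] at h
    have : SpecLE b s₁ := specLE_of_norm_pow_le hs10.le (C := C) fun n => by
      have := hq n
      rwa [← h, mul_one] at this
    exact absurd (this μ hμ) (by linarith)
  have : Nontrivial E := by
    rw [Submodule.nontrivial_iff_ne_bot]
    intro h
    exact hp0 (ContinuousLinearMap.coe_injective (LinearMap.range_eq_bot.1 h))
  have hSE : ∀ S ∈ I, ∀ x ∈ E, S x ∈ E := by
    rintro S hS _ ⟨x, rfl⟩
    obtain ⟨C', hC', hS'⟩ := hc S hS
    have h := mul_mul_one_sub_eq_zero hbq hs10.le hC.le hc0.le hC' hq hS' (by linarith) hp hv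
    have h1 : q (S ((1 - q) x)) = 0 := congrArg (fun f : X →L[ℂ] X => f x) h
    exact ⟨S ((1 - q) x), by
      change S ((1 - q) x) - q (S ((1 - q) x)) = _
      rw [h1, sub_zero]
      rfl⟩
  let K : Submodule ℂ (Module.End ℂ E) :=
    { carrier := {f | ∃ S ∈ I, ∀ x : E, (f x : X) = S x}
      zero_mem' := ⟨0, I.zero_mem, fun x => rfl⟩
      add_mem' := by
        rintro f g ⟨S, hS, hf⟩ ⟨S', hS', hg⟩
        exact ⟨S + S', I.add_mem hS hS', fun x => by simp [hf, hg]⟩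
      smul_mem' := by
        rintro z f ⟨S, hS, hf⟩
        exact ⟨z • S, I.smul_mem z hS, fun x => by simp [hf]⟩ }
  obtain ⟨x, hx, hKx⟩ := exists_common_null_vector K (by
    rintro f ⟨S, hS, hf⟩ g ⟨S', hS', hg⟩
    exact ⟨S * S' - S' * S, hideal S (hIJ hS) S' hS', fun x => by simp [hf, hg]⟩) (by
    rintro f ⟨S, hS, hf⟩ μ hμ
    exact eq_zero_of_hasEigenvalue_restrict (hspec S hS) hf hμ)
  let N : Submodule ℂ X := ⨅ S : I, LinearMap.ker ((S : X →L[ℂ] X) : X →ₗ[ℂ] X)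
  have hN : ∀ x, x ∈ N ↔ ∀ S ∈ I, S x = 0 := fun x => by
    simp [N, Submodule.mem_iInf]
  refine ⟨N, ?_, ?_, ?_, ?_⟩
  · have : (N : Set X) = ⋂ S : I, {x | (S : X →L[ℂ] X) x = 0} := by
      ext x
      simp [hN]
    rw [this]
    exact isClosed_iInter fun S => isClosed_eq S.1.continuous continuous_const
  · intro h
    have : (x : X) ∈ N := (hN _).2 fun S hS => by
      have := hKx ((S : X →ₗ[ℂ] X).restrict (hSE S hS)) ⟨S, hS, fun y => rfl⟩
      exact congrArg Subtype.val this
    rw [h, Submodule.mem_bot] at this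
    exact hx (Subtype.ext this)
  · intro h
    exact hT0 (ContinuousLinearMap.ext fun y => (hN y).1 (h ▸ Submodule.mem_top) T hT)
  · intro A hA y hy
    rw [hN] at hy ⊢
    intro S hS
    have h1 : A (S y) - S (A y) = 0 := hy _ (hideal A hA S hS)
    rwa [hy S hS, map_zero, zero_sub, neg_eq_zero] at h1

end NonVolterra

section TraceFunctional

variable {𝔸 : Type*} [NormedRing 𝔸] [NormedAlgebra ℂ 𝔸] [CompleteSpace 𝔸]

theorem map_pow_eq_zero_of_map_tsum {φ : 𝔸 →L[ℂ] ℂ} {A : 𝔸}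
    (h : ∀ z : ℂ, ‖z • A‖ < 1 → φ (∑' n : ℕ, (z • A) ^ n) = 0) (n : ℕ) : φ (A ^ n) = 0 := by
  have hp : HasFPowerSeriesAt (0 : ℂ → ℂ)
      (FormalMultilinearSeries.ofScalars ℂ fun n => φ (A ^ n)) 0 := by
    rw [hasFPowerSeriesAt_iff]
    have hc : Continuous fun z : ℂ => ‖z • A‖ := by fun_prop
    have hlt : ∀ᶠ z : ℂ in 𝓝 0, ‖z • A‖ < 1 :=
      hc.continuousAt.eventually_lt continuousAt_const (by simp)
    filter_upwards [hlt] with z hz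
    have := ((summable_geometric_of_norm_lt_one hz).hasSum).mapL φ
    rw [h z hz] at this
    simpa [smul_pow] using this
  rw [← FormalMultilinearSeries.coeff_ofScalars (p := fun n => φ (A ^ n)), hp.eq_zero]
  rfl

open NormedSpace

theorem map_exp_eq_zero_of_map_pow {φ : 𝔸 →L[ℂ] ℂ} {A : 𝔸} (h : ∀ n : ℕ, φ (A ^ n) = 0) :
    φ (exp A) = 0 := by
  have := (exp_series_hasSum_exp' (𝕂 := ℂ) A).mapL φ
  simp only [map_smul, h, smul_zero] at this
  exact this.unique hasSum_zero

theorem map_list_prod_eq_zero {φ : 𝔸 →L[ℂ] ℂ} {J : Submodule ℂ 𝔸}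
    (h : ∀ l : List 𝔸, (∀ A ∈ l, A ∈ J) → (l.map norm).sum ≤ 1 / 16 →
      φ (l.map fun A => exp A).prod = 0) {l : List 𝔸} (hl : ∀ A ∈ l, A ∈ J) : φ l.prod = 0 := by
  have key : ∀ l : List 𝔸, (∀ A ∈ l, A ∈ J) → ∀ m : List 𝔸, (∀ A ∈ m, A ∈ J) →
      (m.map norm).sum < 1 / 16 → φ (l.prod * (m.map fun A => exp A).prod) = 0 := by
    intro l
    induction l using List.reverseRecOn with
    | nil =>
      intro _ m hm hs
      simpa using h m hm hs.le
    | append_singleton l A ih =>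
      intro hl m hm hs
      have hA : A ∈ J := hl A (by simp)
      have hc : Continuous fun z : ℂ => ‖z • A‖ + (m.map norm).sum := by fun_prop
      have hlt : ∀ᶠ z : ℂ in 𝓝 0, ‖z • A‖ + (m.map norm).sum < 1 / 16 :=
        hc.continuousAt.eventually_lt continuousAt_const (by simpa using hs)
      have hz : (fun z : ℂ => φ (l.prod * (exp (z • A) * (m.map fun A => exp A).prod))) =ᶠ[𝓝 0]
          fun _ => 0 := by
        filter_upwards [hlt] with z hz
        have := ih (fun B hB => hl B (by simp [hB])) (z • A :: m)
          (by simpa using ⟨J.smul_mem z hA, hm⟩) (by simpa using hz)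
        simpa using this
      have hd := ((hasDerivAt_exp_smul_const (𝕂 := ℂ) A (0 : ℂ)).mul_const
        (m.map fun A => exp A).prod).const_mul l.prod
      have hd' := (φ.hasFDerivAt.comp_hasDerivAt (0 : ℂ) hd).unique
        ((hasDerivAt_const (0 : ℂ) (0 : ℂ)).congr_of_eventuallyEq hz)
      simpa [mul_assoc] using hd'
  simpa using key l hl [] (by simp) (by simp)

theorem map_eq_zero_of_mem_adjoin {φ : 𝔸 →L[ℂ] ℂ} {J : Submodule ℂ 𝔸}
    (hJ : IsClosed (J : Set 𝔸)) (hLie : ∀ A ∈ J, ∀ B ∈ J, A * B - B * A ∈ J)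
    (h : ∀ A ∈ J, ‖A‖ < 1 → φ (∑' n : ℕ, A ^ n) = 0) {a : 𝔸}
    (ha : a ∈ Algebra.adjoin ℂ (J : Set 𝔸)) : φ a = 0 := by
  have hexp : exp '' (J : Set 𝔸) ⊆ φ ⁻¹' {0} := by
    rintro _ ⟨A, hA, rfl⟩
    exact map_exp_eq_zero_of_map_pow
      (map_pow_eq_zero_of_map_tsum fun z hz => h _ (J.smul_mem z hA) hz)
  have hcl := closure_minimal hexp (isClosed_singleton.preimage φ.continuous)
  have ha' : a ∈ Submodule.span ℂ (Submonoid.closure (J : Set 𝔸) : Set 𝔸) := by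
    rw [← Algebra.adjoin_eq_span]
    exact ha
  suffices Submodule.span ℂ (Submonoid.closure (J : Set 𝔸) : Set 𝔸) ≤
      LinearMap.ker (φ : 𝔸 →ₗ[ℂ] ℂ) from this ha'
  refine Submodule.span_le.2 fun b hb => ?_
  obtain ⟨l, hl, rfl⟩ := Submonoid.exists_list_of_mem_closure hb
  exact map_list_prod_eq_zero
    (fun l hl hs => hcl (prod_exp_mem_closure_image hJ hLie hl hs)) hl

end TraceFunctional

section FiniteRank

variable {X : Type*} [NormedAddCommGroup X] [NormedSpace ℂ X]

/-- The compression `T a|_E` of an operator `a` to the range `E` of `T`. -/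
def rangeCompression (T : X →L[ℂ] X) :
    (X →L[ℂ] X) →ₗ[ℂ] Module.End ℂ (LinearMap.range (T : X →ₗ[ℂ] X)) where
  toFun a := (T : X →ₗ[ℂ] X).rangeRestrict ∘ₗ (a : X →ₗ[ℂ] X) ∘ₗ Submodule.subtype _
  map_add' a b := by ext x; simp
  map_smul' c a := by ext x; simp

theorem coe_rangeCompression_apply (T a : X →L[ℂ] X) (x : LinearMap.range (T : X →ₗ[ℂ] X)) :
    (rangeCompression T a x : X) = T (a x) := rfl

theorem exists_trace_rangeCompression (T : X →L[ℂ] X)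
    [FiniteDimensional ℂ (LinearMap.range (T : X →ₗ[ℂ] X))] :
    ∃ φ : (X →L[ℂ] X) →L[ℂ] ℂ, ∀ a, φ a = LinearMap.trace ℂ _ (rangeCompression T a) := by
  set E := LinearMap.range (T : X →ₗ[ℂ] X) with hE
  let R : X →L[ℂ] E := T.codRestrict E fun x => ⟨x, rfl⟩
  let Ψ : (X →L[ℂ] X) →L[ℂ] (E →L[ℂ] E) :=
    (ContinuousLinearMap.compL ℂ E X E R).comp
      ((ContinuousLinearMap.compL ℂ E X X).flip E.subtypeL)
  let θ : (E →L[ℂ] E) →ₗ[ℂ] ℂ := LinearMap.trace ℂ E ∘ₗ ContinuousLinearMap.coeLM ℂ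
  refine ⟨(LinearMap.toContinuousLinearMap θ).comp Ψ, fun a => ?_⟩
  change LinearMap.trace ℂ E _ = LinearMap.trace ℂ E _
  rfl

theorem rangeCompression_pow (T a : X →L[ℂ] X) (n : ℕ) :
    rangeCompression T a ^ (n + 1) = rangeCompression T (a * (T * a) ^ n) := by
  ext x
  induction n with
  | zero => simp
  | succ n ih =>
    rw [pow_succ', Module.End.mul_apply, coe_rangeCompression_apply, ih,
      coe_rangeCompression_apply, coe_rangeCompression_apply, pow_succ']
    rfl

variable [CompleteSpace X]

theorem trace_rangeCompression_tsum_eq_zero {J : Submodule ℂ (X →L[ℂ] X)} {T : X →L[ℂ] X}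
    (hT : T ∈ stableSubmodule J) [FiniteDimensional ℂ (LinearMap.range (T : X →ₗ[ℂ] X))]
    {A : X →L[ℂ] X} (hA : A ∈ J) (h1 : ‖A‖ < 1) :
    LinearMap.trace ℂ _ (rangeCompression T (∑' n : ℕ, A ^ n)) = 0 := by
  refine (LinearMap.isNilpotent_trace_of_isNilpotent
    (isNilpotent_of_forall_hasEigenvalue fun μ hμ => ?_)).eq_zero
  by_contra hμ0
  obtain ⟨x, hx⟩ := hμ.exists_hasEigenvector
  set S := ∑' n : ℕ, A ^ n with hS
  have hAS : (1 - A) * S = 1 := mul_neg_geom_series A h1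
  have hu : IsUnit (algebraMap ℂ (X →L[ℂ] X) 1 - (A + μ⁻¹ • T)) :=
    (hT.2 A hA μ⁻¹ ‖A‖ (norm_nonneg _) (specLE_norm A)).isUnit_sub (by simpa using h1)
  have hinj := (ContinuousLinearMap.isUnit_iff_bijective.1 hu).1
  have e1 : S x - A (S x) = x := by simpa using congrArg (fun f : X →L[ℂ] X => f x) hAS
  have e2 : T (S x) = μ • (x : X) := by
    rw [← coe_rangeCompression_apply, hx.apply_eq_smul]
    rfl
  have e3 : S x = 0 := hinj (by
    simp only [map_one, map_zero]
    change S x - (A (S x) + μ⁻¹ • T (S x)) = 0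
    rw [e2, smul_smul, inv_mul_cancel₀ hμ0, one_smul, ← sub_sub, e1, sub_self])
  refine hx.2 (Subtype.ext ?_)
  rw [← e1, e3]
  simp

theorem exists_invariant_of_finiteDimensional_range {J : Submodule ℂ (X →L[ℂ] X)}
    (hJ : IsClosed (J : Set (X →L[ℂ] X))) (hLie : ∀ A ∈ J, ∀ B ∈ J, A * B - B * A ∈ J)
    {T : X →L[ℂ] X} (hT : T ∈ stableSubmodule J) (hT0 : T ≠ 0)
    [FiniteDimensional ℂ (LinearMap.range (T : X →ₗ[ℂ] X))] :
    ∃ M : Submodule ℂ X, IsClosed (M : Set X) ∧ M ≠ ⊥ ∧ M ≠ ⊤ ∧ ∀ A ∈ J, ∀ x ∈ M, A x ∈ M := by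
  obtain ⟨φ, hφ⟩ := exists_trace_rangeCompression T
  set 𝒜 := Algebra.adjoin ℂ (J : Set (X →L[ℂ] X)) with h𝒜
  have hJ𝒜 : ∀ A ∈ J, A ∈ 𝒜 := fun A hA => Algebra.subset_adjoin hA
  have htr : ∀ a ∈ 𝒜, LinearMap.trace ℂ _ (rangeCompression T a) = 0 := fun a ha => by
    rw [← hφ]
    exact map_eq_zero_of_mem_adjoin hJ hLie
      (fun A hA h1 => by rw [hφ, trace_rangeCompression_tsum_eq_zero hT hA h1]) ha
  obtain ⟨x, hx⟩ : ∃ x, T x ≠ 0 := by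
    by_contra! h
    exact hT0 (ContinuousLinearMap.ext h)
  set N := 𝒜.toSubmodule.map (ContinuousLinearMap.apply ℂ X (T x)).toLinearMap with hN
  have hmem : ∀ z, z ∈ N ↔ ∃ b ∈ 𝒜, b (T x) = z := fun z => Iff.rfl
  refine ⟨N.topologicalClosure, N.isClosed_topologicalClosure, ?_, fun htop => ?_, ?_⟩
  · exact (Submodule.ne_bot_iff _).2
      ⟨T x, N.le_topologicalClosure ((hmem _).2 ⟨1, one_mem _, rfl⟩), hx⟩
  · set P := N.map (T : X →ₗ[ℂ] X) with hP
    have : FiniteDimensional ℂ P :=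
      Submodule.finiteDimensional_of_le (LinearMap.map_le_range (f := (T : X →ₗ[ℂ] X)))
    have hcl : IsClosed (P : Set X) := P.closed_of_finiteDimensional
    have hxN : x ∈ closure (N : Set X) := by
      rw [← Submodule.topologicalClosure_coe, htop]
      trivial
    have hTx : T x ∈ P := by
      have := map_mem_closure T.continuous hxN (t := (P : Set X)) fun u hu => ⟨u, hu, rfl⟩
      rwa [hcl.closure_eq] at this
    obtain ⟨_, ⟨a, ha, rfl⟩, hax⟩ := hTx
    have hfix : rangeCompression T a ⟨T x, x, rfl⟩ = ⟨T x, x, rfl⟩ := Subtype.ext hax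
    refine hx (congrArg Subtype.val (eq_zero_of_trace_pow_eq_zero (fun n => ?_) hfix))
    rw [rangeCompression_pow]
    exact htr _ (mul_mem ha (pow_mem (mul_mem (hJ𝒜 T hT.1) ha) n))
  · intro A hA z hz
    refine map_mem_closure A.continuous hz fun u hu => ?_
    obtain ⟨b, hb, rfl⟩ := (hmem _).1 hu
    exact (hmem _).2 ⟨A * b, mul_mem (hJ𝒜 A hA) hb, rfl⟩

end FiniteRank

/-- A Lie algebra of compact operators with `T`-stable spectrum, for some nonzero
`T` in the algebra, is reducible. -/
theorem lie_algebra_stable_spectrum_reducible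
    {X : Type*} [NormedAddCommGroup X] [NormedSpace ℂ X] [CompleteSpace X]
    (L : Submodule ℂ (X →L[ℂ] X))
    (hLie : ∀ A ∈ L, ∀ B ∈ L, A * B - B * A ∈ L)
    (hcompact : ∀ A ∈ L, IsCompactOperator A)
    (T : X →L[ℂ] X) (hT : T ∈ L) (hT0 : T ≠ 0)
    (hstable : ∀ A ∈ L, ∀ lam : ℂ, spectralRadius ℂ (A + lam • T) ≤ spectralRadius ℂ A) :
    ∃ M : Submodule ℂ X, IsClosed (M : Set X) ∧ M ≠ ⊥ ∧ M ≠ ⊤ ∧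
      ∀ A ∈ L, ∀ x ∈ M, A x ∈ M := by
  set J := L.topologicalClosure with hJ
  have hJc : IsClosed (J : Set (X →L[ℂ] X)) := L.isClosed_topologicalClosure
  have hJLie : ∀ A ∈ J, ∀ B ∈ J, A * B - B * A ∈ J := fun A hA B hB =>
    commutator_mem_topologicalClosure hLie hA hB
  have hJcomp : ∀ A ∈ J, IsCompactOperator A := fun A hA =>
    isCompactOperator_of_mem_topologicalClosure hcompact hA
  have hTI : T ∈ stableSubmodule J := mem_stableSubmodule_closure hJcomp hT hstable
  suffices h : ∃ M : Submodule ℂ X, IsClosed (M : Set X) ∧ M ≠ ⊥ ∧ M ≠ ⊤ ∧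
      ∀ A ∈ J, ∀ x ∈ M, A x ∈ M by
    obtain ⟨M, h1, h2, h3, h4⟩ := h
    exact ⟨M, h1, h2, h3, fun A hA => h4 A (L.le_topologicalClosure hA)⟩
  by_cases hvol : ∀ A ∈ J, SpecLE A 0
  · exact exists_invariant_of_forall_specLE_zero hJc hJLie hJcomp hvol hTI.1 hT0
  · push Not at hvol
    obtain ⟨b, hb, hb0⟩ := hvol
    rcases exists_finiteDimensional_range_or_invariant (isClosed_stableSubmodule hJc hJcomp)
      (fun S hS => hS.1) (fun A hA S hS => commutator_mem_stableSubmodule hJc hJLie hJcomp hA hS)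
      (fun S hS => specLE_zero_of_mem_stableSubmodule hS) hb (hJcomp b hb) hb0 hTI hT0 with
      ⟨S, hS, hS0, hfin⟩ | h
    · exact exists_invariant_of_finiteDimensional_range hJc hJLie hS hS0
    · exact h
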